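/- Let 1 ≤ s < t be fixed integers. There exists m₀ such that the following holds for all m ≥ m₀: if G is a balanced bipartite graph on 2n = 2m(s+t) vertices with δ(G) ≥ n/2 + s − 1 when m is even, and δ(G) ≥ (n+t+s)/2 − 1 when m is odd, then G can be tiled with K_{s,t}. -/

import Mathlib

open scoped Classical
open Finset

namespace PaperTiling

variable {V : Type*} [Fintype V] [DecidableEq V]

/-- The number of neighbours of `v` inside the set `S`. -/
noncomputable def degS (G : SimpleGraph V) (v : V) (S : Finset V) : ℕ :=
  (S.filter fun w => G.Adj v w).card

/-- The number of edges of `G` with one end in `A` and the other in `B`. -/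
noncomputable def eAB (G : SimpleGraph V) (A B : Finset V) : ℕ :=
  ∑ v ∈ A, degS G v B

/-- The edge density `d(A,B) = e(A,B)/(|A||B|)`. -/
noncomputable def dens (G : SimpleGraph V) (A B : Finset V) : ℝ :=
  (eAB G A B : ℝ) / ((A.card : ℝ) * (B.card : ℝ))

/-- `G` is a bipartite graph with parts `A` and `B`. -/
def IsBipartition (G : SimpleGraph V) (A B : Finset V) : Prop :=
  Disjoint A B ∧ A ∪ B = Finset.univ ∧
    ∀ u v : V, G.Adj u v → (u ∈ A ∧ v ∈ B) ∨ (u ∈ B ∧ v ∈ A)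

/-- `(S, T)` spans a copy of the complete bipartite graph `K_{s,t}` in `G`,
with `S` the side of size `s` and `T` the side of size `t`. -/
def IsKst (G : SimpleGraph V) (s t : ℕ) (S T : Finset V) : Prop :=
  Disjoint S T ∧ S.card = s ∧ T.card = t ∧ ∀ u ∈ S, ∀ v ∈ T, G.Adj u v

/-- `𝒯` is a perfect `K_{s,t}`-tiling of `G`: a collection of pairwise
vertex-disjoint copies of `K_{s,t}` covering all vertices. -/
def IsKstTiling (G : SimpleGraph V) (s t : ℕ)
    (𝒯 : Finset (Finset V × Finset V)) : Prop :=
  (∀ P ∈ 𝒯, IsKst G s t P.1 P.2) ∧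
  (𝒯 : Set (Finset V × Finset V)).PairwiseDisjoint (fun P => P.1 ∪ P.2) ∧
  𝒯.sup (fun P => P.1 ∪ P.2) = Finset.univ

/-- `G` can be tiled with `K_{s,t}`. -/
def KstTileable (G : SimpleGraph V) (s t : ℕ) : Prop :=
  ∃ 𝒯 : Finset (Finset V × Finset V), IsKstTiling G s t 𝒯

/-- `G` can be tiled with the complete graph `K_s`. -/
def CliqueTileable (G : SimpleGraph V) (s : ℕ) : Prop :=
  ∃ 𝒞 : Finset (Finset V),
    (∀ S ∈ 𝒞, S.card = s ∧ G.IsClique (S : Set V)) ∧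
    (𝒞 : Set (Finset V)).PairwiseDisjoint id ∧
    𝒞.sup id = Finset.univ

/-- The minimum degree of `G` equals the real number `c`. -/
def MinDegreeIs (G : SimpleGraph V) (c : ℝ) : Prop :=
  (∀ v : V, c ≤ (degS G v Finset.univ : ℝ)) ∧
  ∃ v : V, (degS G v Finset.univ : ℝ) = c

/-- `(c, L)` is an `h`-star with centre `c ∈ A` and `h` leaves `L ⊆ B`. -/
def IsStar (G : SimpleGraph V) (h : ℕ) (A B : Finset V) (c : V) (L : Finset V) : Prop :=
  c ∈ A ∧ L ⊆ B ∧ L.card = h ∧ ∀ v ∈ L, G.Adj c v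

/-- `𝒮` is a family of pairwise vertex-disjoint `h`-stars from `A` to `B`. -/
def StarFamily (G : SimpleGraph V) (h : ℕ) (A B : Finset V)
    (𝒮 : Finset (V × Finset V)) : Prop :=
  (∀ S ∈ 𝒮, IsStar G h A B S.1 S.2) ∧
  (𝒮 : Set (V × Finset V)).PairwiseDisjoint (fun S => insert S.1 S.2)

/-- The structure hypotheses (H) for the extremal construction of the paper:
`1 ≤ s < t`, `t ≥ 2s+1`, `k ≥ 1`, `G` is bipartite with parts
`U₀ ∪ U₁ ∪ U₂` and `V₀ ∪ V₁ ∪ V₂`, with the prescribed part sizes,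
complete pairs `(U₁,V₁)`, `(U₂,V₂)`, `(U₀, V₁∪V₂)`, `(V₀, U₁∪U₂)`,
no edges between `U₀` and `V₀`, and sparse `K_{2,2}`-free diagonal pairs. -/
structure StructH (G : SimpleGraph V) (s t k : ℕ)
    (U0 U1 U2 V0 V1 V2 : Finset V) : Prop where
  hs : 1 ≤ s
  hst : s < t
  ht : 2 * s + 1 ≤ t
  hk : 1 ≤ k
  bip : IsBipartition G (U0 ∪ U1 ∪ U2) (V0 ∪ V1 ∪ V2)
  hU01 : Disjoint U0 U1
  hU02 : Disjoint U0 U2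
  hU12 : Disjoint U1 U2
  hV01 : Disjoint V0 V1
  hV02 : Disjoint V0 V2
  hV12 : Disjoint V1 V2
  cardU0 : U0.card = s - 1
  cardV0 : V0.card = s - 1
  cardU1 : U1.card = k * (s + t) + (t + 1) / 2
  cardV2 : V2.card = k * (s + t) + (t + 1) / 2
  cardV1 : V1.card = k * (s + t) + (t + 2) / 2
  cardU2 : U2.card = k * (s + t) + (t + 2) / 2
  compU1V1 : ∀ u ∈ U1, ∀ v ∈ V1, G.Adj u v
  compU2V2 : ∀ u ∈ U2, ∀ v ∈ V2, G.Adj u v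
  compU0 : ∀ u ∈ U0, ∀ v ∈ V1 ∪ V2, G.Adj u v
  compV0 : ∀ v ∈ V0, ∀ u ∈ U1 ∪ U2, G.Adj u v
  emptyU0V0 : ∀ u ∈ U0, ∀ v ∈ V0, ¬ G.Adj u v
  K22freeU1V2 : ∀ S T : Finset V, S ⊆ U1 → T ⊆ V2 → ¬ IsKst G 2 2 S T
  K22freeU2V1 : ∀ S T : Finset V, S ⊆ U2 → T ⊆ V1 → ¬ IsKst G 2 2 S T
  degU1 : ∀ u ∈ U1, degS G u V2 ≤ s - 1
  degU2 : ∀ u ∈ U2, degS G u V1 ≤ s - 1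
  degV1 : ∀ v ∈ V1, degS G v U2 ≤ s - 1
  degV2 : ∀ v ∈ V2, degS G v U1 ≤ s - 1

/-- The vertex set `W` of a copy of `K_{s,t}` is crossing. -/
def Crossing (U1 V1 U2 V2 W : Finset V) : Prop :=
  (W ∩ (U1 ∪ V1)).Nonempty ∧ (W ∩ (U2 ∪ V2)).Nonempty

/-- `W` is crossing from the set `A`, where `AD = A^D` is the diagonal set of `A`
and `AM = A^M` is the opposite middle set of `A`. -/
def CrossingFrom (W A AD AM : Finset V) : Prop :=
  (W ∩ A).card = 1 ∧
    (2 ≤ (W ∩ AD).card ∨ ((W ∩ AD).card = 1 ∧ (W ∩ AM).Nonempty))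

/-- `W` is of Type 1 (crossing from `A`), where `AD = A^D`, `AN = A^N`,
`ANM = (A^N)^M`. -/
def Type1From (s t : ℕ) (W AD AN ANM : Finset V) : Prop :=
  ∃ p : ℕ, 2 ≤ p ∧ p ≤ s - 1 ∧ (W ∩ ANM).card = s - 1 ∧
    (W ∩ AN).card = t - p ∧ (W ∩ AD).card = p

/-- `W` is of Type 2 (crossing from `A`), where `AD = A^D`, `AM = A^M`,
`AND = (A^N)^D`. -/
def Type2From (s t : ℕ) (W AD AM AND : Finset V) : Prop :=
  ∃ p : ℕ, 1 ≤ p ∧ p ≤ s - 1 ∧ (W ∩ AND).card = t - 1 ∧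
    (W ∩ AM).card = s - p ∧ (W ∩ AD).card = p

section Basics

set_option linter.unusedSectionVars false
set_option linter.unusedDecidableInType false

variable {α β : Type} [DecidableEq α] [DecidableEq β]

/-- The number of `b ∈ S` related to `a`. -/
noncomputable def nbr (R : α → β → Prop) (a : α) (S : Finset β) : ℕ :=
  (S.filter fun b => R a b).card

/-- The number of `b ∈ S` not related to `a`. -/
noncomputable def miss (R : α → β → Prop) (a : α) (S : Finset β) : ℕ :=
  (S.filter fun b => ¬ R a b).card

/-- Every element of `A` is related to every element of `B`. -/
def Joined (R : α → β → Prop) (A : Finset α) (B : Finset β) : Prop :=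
  ∀ a ∈ A, ∀ b ∈ B, R a b

/-- `A` and `B` can be partitioned into complete pairs of sizes `(s, t)` or `(t, s)`. -/
inductive Tileable (R : α → β → Prop) (s t : ℕ) : Finset α → Finset β → Prop
  | empty : Tileable R s t ∅ ∅
  | union_tile {A S : Finset α} {B T : Finset β} : Tileable R s t A B →
      Disjoint A S → Disjoint B T →
      (S.card = s ∧ T.card = t ∨ S.card = t ∧ T.card = s) → Joined R S T →
      Tileable R s t (A ∪ S) (B ∪ T)

/-- `A` and `B` can be partitioned into `k` complete pairs of size `(h, h)`. -/
inductive Packed (R : α → β → Prop) (h : ℕ) : ℕ → Finset α → Finset β → Prop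
  | empty : Packed R h 0 ∅ ∅
  | union_tile {k : ℕ} {A S : Finset α} {B T : Finset β} : Packed R h k A B →
      Disjoint A S → Disjoint B T → S.card = h → T.card = h → Joined R S T →
      Packed R h (k + 1) (A ∪ S) (B ∪ T)

/-- `(p, q)` lies in the lattice generated by `(s, t)` and `(t, s)`. -/
def InLat (s t : ℕ) (p q : ℤ) : Prop :=
  ∃ x y : ℤ, p = x * s + y * t ∧ q = x * t + y * s

variable {R : α → β → Prop} {s t : ℕ}

theorem nbr_add_miss (a : α) (S : Finset β) : nbr R a S + miss R a S = S.card :=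
  S.card_filter_add_card_filter_not _

theorem nbr_le_card (a : α) (S : Finset β) : nbr R a S ≤ S.card :=
  Finset.card_filter_le _ _

theorem nbr_mono (a : α) {S T : Finset β} (h : S ⊆ T) : nbr R a S ≤ nbr R a T :=
  Finset.card_le_card (Finset.filter_subset_filter _ h)

theorem miss_mono (a : α) {S T : Finset β} (h : S ⊆ T) : miss R a S ≤ miss R a T :=
  Finset.card_le_card (Finset.filter_subset_filter _ h)

theorem nbr_union_of_disjoint (a : α) {S T : Finset β} (h : Disjoint S T) :
    nbr R a (S ∪ T) = nbr R a S + nbr R a T := by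
  unfold nbr
  rw [Finset.filter_union, Finset.card_union_of_disjoint]
  exact Finset.disjoint_filter_filter h

theorem nbr_union_le (a : α) (S T : Finset β) :
    nbr R a (S ∪ T) ≤ nbr R a S + nbr R a T := by
  unfold nbr
  rw [Finset.filter_union]
  exact Finset.card_union_le _ _

theorem nbr_sdiff_add (a : α) {S T : Finset β} (h : T ⊆ S) :
    nbr R a (S \ T) + nbr R a T = nbr R a S := by
  rw [← nbr_union_of_disjoint a Finset.sdiff_disjoint, Finset.sdiff_union_of_subset h]

theorem nbr_le_nbr_sdiff (a : α) (S T : Finset β) :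
    nbr R a S ≤ nbr R a (S \ T) + T.card := by
  calc nbr R a S ≤ nbr R a ((S \ T) ∪ T) := nbr_mono a (by simp [Finset.subset_union_left])
    _ ≤ nbr R a (S \ T) + nbr R a T := nbr_union_le _ _ _
    _ ≤ _ := by gcongr; exact nbr_le_card _ _

theorem sum_nbr_comm (X : Finset α) (Y : Finset β) :
    ∑ a ∈ X, nbr R a Y = ∑ b ∈ Y, nbr (flip R) b X :=
  Finset.sum_card_bipartiteAbove_eq_sum_card_bipartiteBelow R

theorem Joined.flip {A : Finset α} {B : Finset β} (h : Joined R A B) : Joined (flip R) B A :=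
  fun b hb a ha => h a ha b hb

theorem Joined.mono {A A' : Finset α} {B B' : Finset β} (h : Joined R A B)
    (hA : A' ⊆ A) (hB : B' ⊆ B) : Joined R A' B' :=
  fun a ha b hb => h a (hA ha) b (hB hb)

theorem Joined.nbr_eq {A : Finset α} {B : Finset β} (h : Joined R A B) {a : α} (ha : a ∈ A) :
    nbr R a B = B.card := by
  unfold nbr
  rw [Finset.filter_true_of_mem fun b hb => h a ha b hb]

theorem Joined.miss_eq {A : Finset α} {B : Finset β} (h : Joined R A B) {a : α} (ha : a ∈ A) :
    miss R a B = 0 := by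
  have := nbr_add_miss (R := R) a B
  have := h.nbr_eq ha
  omega

theorem Tileable.union {A A' : Finset α} {B B' : Finset β} (h : Tileable R s t A B)
    (h' : Tileable R s t A' B') (hA : Disjoint A A') (hB : Disjoint B B') :
    Tileable R s t (A ∪ A') (B ∪ B') := by
  induction h' with
  | empty => simpa using h
  | @union_tile A' S B' T _ hS hT hc hj ih =>
    rw [Finset.disjoint_union_right] at hA hB
    rw [← Finset.union_assoc, ← Finset.union_assoc]
    refine (ih hA.1 hB.1).union_tile ?_ ?_ hc hj
    · rw [Finset.disjoint_union_left]; exact ⟨hA.2, hS⟩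
    · rw [Finset.disjoint_union_left]; exact ⟨hB.2, hT⟩

theorem Tileable.flip {A : Finset α} {B : Finset β} (h : Tileable R s t A B) :
    Tileable (flip R) s t B A := by
  induction h with
  | empty => exact Tileable.empty
  | union_tile _ hS hT hc hj ih => exact ih.union_tile hT hS (by tauto) hj.flip

theorem Tileable.card_inLat {A : Finset α} {B : Finset β} (h : Tileable R s t A B) :
    InLat s t A.card B.card := by
  induction h with
  | empty => exact ⟨0, 0, by simp⟩
  | @union_tile A S B T _ hS hT hc hj ih =>
    obtain ⟨x, y, h1, h2⟩ := ih
    rw [Finset.card_union_of_disjoint hS, Finset.card_union_of_disjoint hT]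
    rcases hc with ⟨h3, h4⟩ | ⟨h3, h4⟩
    · exact ⟨x + 1, y, by push_cast [h3]; linarith, by push_cast [h4]; linarith⟩
    · exact ⟨x, y + 1, by push_cast [h3]; linarith, by push_cast [h4]; linarith⟩

theorem InLat.add {p q p' q' : ℤ} (h : InLat s t p q) (h' : InLat s t p' q') :
    InLat s t (p + p') (q + q') := by
  obtain ⟨x, y, rfl, rfl⟩ := h
  obtain ⟨x', y', rfl, rfl⟩ := h'
  exact ⟨x + x', y + y', by ring, by ring⟩

theorem InLat.sub {p q p' q' : ℤ} (h : InLat s t p q) (h' : InLat s t p' q') :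
    InLat s t (p - p') (q - q') := by
  obtain ⟨x, y, rfl, rfl⟩ := h
  obtain ⟨x', y', rfl, rfl⟩ := h'
  exact ⟨x - x', y - y', by ring, by ring⟩

theorem InLat.swap {p q : ℤ} (h : InLat s t p q) : InLat s t q p := by
  obtain ⟨x, y, rfl, rfl⟩ := h
  exact ⟨y, x, by ring, by ring⟩

theorem Joined.tileable_aux (x y : ℕ) : ∀ {A : Finset α} {B : Finset β}, Joined R A B →
    A.card = x * s + y * t → B.card = x * t + y * s → Tileable R s t A B := by
  induction x with
  | zero =>
    induction y with
    | zero =>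
      intro A B _ hA hB
      simp only [Nat.zero_mul, Nat.add_zero, Finset.card_eq_zero] at hA hB
      subst hA hB
      exact Tileable.empty
    | succ y ih =>
      intro A B h hA hB
      obtain ⟨S, hS, hSc⟩ := Finset.exists_subset_card_eq (s := A) (n := t) (by rw [hA]; lia)
      obtain ⟨T, hT, hTc⟩ := Finset.exists_subset_card_eq (s := B) (n := s) (by rw [hB]; lia)
      have := (ih (h.mono (Finset.sdiff_subset (t := S)) (Finset.sdiff_subset (t := T)))
        (by rw [Finset.card_sdiff_of_subset hS, hA, hSc]; lia)
        (by rw [Finset.card_sdiff_of_subset hT, hB, hTc]; lia)).union_tile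
        Finset.sdiff_disjoint Finset.sdiff_disjoint (Or.inr ⟨hSc, hTc⟩) (h.mono hS hT)
      rwa [Finset.sdiff_union_of_subset hS, Finset.sdiff_union_of_subset hT] at this
  | succ x ih =>
    intro A B h hA hB
    obtain ⟨S, hS, hSc⟩ := Finset.exists_subset_card_eq (s := A) (n := s) (by rw [hA]; lia)
    obtain ⟨T, hT, hTc⟩ := Finset.exists_subset_card_eq (s := B) (n := t) (by rw [hB]; lia)
    have := (ih (h.mono (Finset.sdiff_subset (t := S)) (Finset.sdiff_subset (t := T)))
      (by rw [Finset.card_sdiff_of_subset hS, hA, hSc]; lia)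
      (by rw [Finset.card_sdiff_of_subset hT, hB, hTc]; lia)).union_tile
      Finset.sdiff_disjoint Finset.sdiff_disjoint (Or.inl ⟨hSc, hTc⟩) (h.mono hS hT)
    rwa [Finset.sdiff_union_of_subset hS, Finset.sdiff_union_of_subset hT] at this

/-- A complete pair whose sizes lie in the lattice and are not too unbalanced is tileable. -/
theorem Joined.tileable {A : Finset α} {B : Finset β} (h : Joined R A B) (hst : s < t)
    (hL : InLat s t A.card B.card) (h1 : s * A.card ≤ t * B.card)
    (h2 : s * B.card ≤ t * A.card) : Tileable R s t A B := by
  obtain ⟨x, y, hx, hy⟩ := hL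
  have hst' : (s : ℤ) < t := by exact_mod_cast hst
  have hs0 : (0 : ℤ) ≤ s := by positivity
  have hN : (0 : ℤ) < (t : ℤ) * t - s * s := by nlinarith
  have h1' : (s : ℤ) * A.card ≤ t * B.card := by exact_mod_cast h1
  have h2' : (s : ℤ) * B.card ≤ t * A.card := by exact_mod_cast h2
  have hx0 : 0 ≤ x := by
    have : 0 ≤ ((t : ℤ) * t - s * s) * x := by rw [hx, hy] at h1'; linarith
    exact nonneg_of_mul_nonneg_right this hN
  have hy0 : 0 ≤ y := by
    have : 0 ≤ ((t : ℤ) * t - s * s) * y := by rw [hx, hy] at h2'; linarith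
    exact nonneg_of_mul_nonneg_right this hN
  lift x to ℕ using hx0
  lift y to ℕ using hy0
  exact h.tileable_aux x y (by exact_mod_cast hx) (by exact_mod_cast hy)

/-- Common neighbours: if every `b ∈ T` misses at most `μ` elements of `P`, then all but
`|T| * μ` elements of `P` are related to all of `T`. -/
theorem card_le_common (P : Finset α) (T : Finset β) (μ : ℕ)
    (h : ∀ b ∈ T, miss (flip R) b P ≤ μ) :
    P.card ≤ (P.filter fun a => ∀ b ∈ T, R a b).card + T.card * μ := by
  have h1 := P.card_filter_add_card_filter_not (fun a => ∀ b ∈ T, R a b)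
  have h2 : (P.filter fun a => ¬ ∀ b ∈ T, R a b) ⊆
      T.biUnion fun b => P.filter fun a => ¬ flip R b a := by
    intro a ha
    simp only [Finset.mem_filter, not_forall, Finset.mem_biUnion] at ha ⊢
    obtain ⟨ha, b, hb, hab⟩ := ha
    exact ⟨b, hb, ha, hab⟩
  have h3 := (Finset.card_le_card h2).trans (Finset.card_biUnion_le_card_mul T _ μ h)
  omega

/-- Every vertex of `F` can be covered by its own tile inside `F ∪ P` and `Q`. -/
theorem exists_carve {F P : Finset α} {Q : Finset β} {μ f : ℕ} (hs : 1 ≤ s) (hFP : Disjoint F P)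
    (hmiss : ∀ b ∈ Q, miss (flip R) b P ≤ μ) (hf : F.card ≤ f)
    (hdeg : ∀ x ∈ F, f * t ≤ nbr R x Q) (hP : t * μ + f * (s - 1) ≤ P.card) :
    ∃ P' ⊆ P, ∃ Q' ⊆ Q, P'.card = F.card * (s - 1) ∧ Q'.card = F.card * t ∧
      Tileable R s t (F ∪ P') Q' := by
  induction F using Finset.induction_on with
  | empty => exact ⟨∅, by simp, ∅, by simp, by simp, by simp, by simpa using Tileable.empty⟩
  | @insert x F hx ih =>
    rw [Finset.card_insert_of_notMem hx] at hf
    rw [Finset.disjoint_insert_left] at hFP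
    obtain ⟨P', hP', Q', hQ', hPc, hQc, hT⟩ := ih hFP.2 (by omega)
      (fun y hy => hdeg y (Finset.mem_insert_of_mem hy))
    have hd := hdeg x (Finset.mem_insert_self _ _)
    have e1 := nbr_le_nbr_sdiff (R := R) x Q Q'
    have hft : (F.card + 1) * t ≤ f * t := by gcongr
    have hfs : (F.card + 1) * (s - 1) ≤ f * (s - 1) := by gcongr
    rw [Nat.add_mul, Nat.one_mul] at hft hfs
    obtain ⟨T, hTs, hTc⟩ := Finset.exists_subset_card_eq
      (s := (Q \ Q').filter fun b => R x b) (n := t) (by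
        change t ≤ nbr R x (Q \ Q'); omega)
    have hTQ : T ⊆ Q \ Q' := hTs.trans (Finset.filter_subset _ _)
    have e2 := card_le_common (R := R) (P \ P') T μ (fun b hb =>
      (miss_mono _ Finset.sdiff_subset).trans (hmiss b (Finset.sdiff_subset (hTQ hb))))
    rw [Finset.card_sdiff_of_subset hP', hTc, hPc] at e2
    obtain ⟨S, hSs, hSc⟩ := Finset.exists_subset_card_eq
      (s := (P \ P').filter fun a => ∀ b ∈ T, R a b) (n := s - 1) (by omega)
    have hSP : S ⊆ P \ P' := hSs.trans (Finset.filter_subset _ _)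
    have hxS : x ∉ S := fun hxS => hFP.1 (Finset.sdiff_subset (hSP hxS))
    have hdS : Disjoint P' S := (Finset.disjoint_sdiff).mono_right hSP
    have hdT : Disjoint Q' T := (Finset.disjoint_sdiff).mono_right hTQ
    refine ⟨P' ∪ S, Finset.union_subset hP' (hSP.trans Finset.sdiff_subset), Q' ∪ T,
      Finset.union_subset hQ' (hTQ.trans Finset.sdiff_subset), ?_, ?_, ?_⟩
    · rw [Finset.card_union_of_disjoint hdS, hPc, hSc, Finset.card_insert_of_notMem hx]; ring
    · rw [Finset.card_union_of_disjoint hdT, hQc, hTc, Finset.card_insert_of_notMem hx]; ring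
    · have : insert x F ∪ (P' ∪ S) = (F ∪ P') ∪ insert x S := by
        ext z; simp only [Finset.mem_union, Finset.mem_insert]; tauto
      rw [this]
      refine hT.union_tile ?_ hdT (Or.inl ⟨?_, hTc⟩) ?_
      · rw [Finset.disjoint_insert_right, Finset.disjoint_union_left]
        refine ⟨?_, ?_, hdS⟩
        · rw [Finset.mem_union]
          rintro (h | h)
          exacts [hx h, hFP.1 (hP' h)]
        · exact hFP.2.mono_right (hSP.trans Finset.sdiff_subset)
      · rw [Finset.card_insert_of_notMem hxS, hSc]; omega
      · intro a ha b hb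
        rw [Finset.mem_insert] at ha
        rcases ha with rfl | ha
        · exact (Finset.mem_filter.1 (hTs hb)).2
        · exact (Finset.mem_filter.1 (hSs ha)).2 b hb

end Basics

section AlmostTiling

set_option linter.unusedSectionVars false
set_option linter.unusedDecidableInType false

variable {α β : Type} [DecidableEq α] [DecidableEq β] {R : α → β → Prop}

theorem Packed.single {h : ℕ} {S : Finset α} {T : Finset β} (hS : S.card = h) (hT : T.card = h)
    (hj : Joined R S T) : Packed R h 1 S T := by
  simpa using Packed.union_tile Packed.empty (Finset.disjoint_empty_left S)
    (Finset.disjoint_empty_left T) hS hT hj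

theorem Packed.card_left {h k : ℕ} {A : Finset α} {B : Finset β} (hp : Packed R h k A B) :
    A.card = h * k := by
  induction hp with
  | empty => simp
  | union_tile _ hS hT hc hc' hj ih => rw [Finset.card_union_of_disjoint hS, ih, hc]; ring

theorem Packed.card_right {h k : ℕ} {A : Finset α} {B : Finset β} (hp : Packed R h k A B) :
    B.card = h * k := by
  induction hp with
  | empty => simp
  | union_tile _ hS hT hc hc' hj ih => rw [Finset.card_union_of_disjoint hT, ih, hc']; ring

theorem Packed.union {h k k' : ℕ} {A A' : Finset α} {B B' : Finset β} (hp : Packed R h k A B)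
    (h' : Packed R h k' A' B') (hA : Disjoint A A') (hB : Disjoint B B') :
    Packed R h (k + k') (A ∪ A') (B ∪ B') := by
  induction h' with
  | empty => simpa using hp
  | @union_tile k' A' S B' T _ hS hT hc hc' hj ih =>
    rw [Finset.disjoint_union_right] at hA hB
    rw [← Finset.union_assoc, ← Finset.union_assoc]
    refine (ih hA.1 hB.1).union_tile ?_ ?_ hc hc' hj
    · rw [Finset.disjoint_union_left]; exact ⟨hA.2, hS⟩
    · rw [Finset.disjoint_union_left]; exact ⟨hB.2, hT⟩

theorem Joined.packed {h : ℕ} (k : ℕ) : ∀ {A : Finset α} {B : Finset β}, Joined R A B →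
    A.card = h * k → B.card = h * k → Packed R h k A B := by
  induction k with
  | zero =>
    intro A B _ hA hB
    simp only [Nat.mul_zero, Finset.card_eq_zero] at hA hB
    subst hA hB
    exact Packed.empty
  | succ k ih =>
    intro A B hj hA hB
    obtain ⟨S, hS, hSc⟩ := Finset.exists_subset_card_eq (s := A) (n := h) (by rw [hA]; lia)
    obtain ⟨T, hT, hTc⟩ := Finset.exists_subset_card_eq (s := B) (n := h) (by rw [hB]; lia)
    have := (ih (hj.mono (Finset.sdiff_subset (t := S)) (Finset.sdiff_subset (t := T)))
      (by rw [Finset.card_sdiff_of_subset hS, hA, hSc]; lia)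
      (by rw [Finset.card_sdiff_of_subset hT, hB, hTc]; lia)).union_tile
      Finset.sdiff_disjoint Finset.sdiff_disjoint hSc hTc (hj.mono hS hT)
    rwa [Finset.sdiff_union_of_subset hS, Finset.sdiff_union_of_subset hT] at this

/-- Each tile of size `q * h` splits into `q` tiles of size `h`. -/
theorem Packed.split {h k : ℕ} (q : ℕ) {A : Finset α} {B : Finset β}
    (hp : Packed R (h * q) k A B) : Packed R h (q * k) A B := by
  induction hp with
  | empty => exact Packed.empty
  | union_tile _ hS hT hc hc' hj ih => exact ih.union (hj.packed q hc hc') hS hT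

theorem Packed.exists_sub {h k : ℕ} {A : Finset α} {B : Finset β} (hp : Packed R h k A B)
    {k' : ℕ} (hk : k' ≤ k) : ∃ A' ⊆ A, ∃ B' ⊆ B, Packed R h k' A' B' := by
  induction hp with
  | empty =>
    obtain rfl : k' = 0 := by omega
    exact ⟨∅, by simp, ∅, by simp, Packed.empty⟩
  | @union_tile k A S B T hp hS hT hc hc' hj ih =>
    rcases Nat.lt_or_ge k k' with h1 | h1
    · obtain rfl : k' = k + 1 := by omega
      exact ⟨_, subset_rfl, _, subset_rfl, hp.union_tile hS hT hc hc' hj⟩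
    · obtain ⟨A', hA', B', hB', h2⟩ := ih h1
      exact ⟨A', hA'.trans Finset.subset_union_left, B', hB'.trans Finset.subset_union_left, h2⟩

/-- Some tile carries at least the average weight. -/
theorem Packed.exists_heavy {h k : ℕ} {A : Finset α} {B : Finset β} (hp : Packed R h k A B)
    (f : α → ℝ) (g : β → ℝ) (c : ℝ) (hc : k * c < ∑ a ∈ A, f a + ∑ b ∈ B, g b) :
    ∃ k₀ A₀ B₀ S T, k = k₀ + 1 ∧ Packed R h k₀ A₀ B₀ ∧ Disjoint A₀ S ∧ Disjoint B₀ T ∧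
      A = A₀ ∪ S ∧ B = B₀ ∪ T ∧ S.card = h ∧ T.card = h ∧ Joined R S T ∧
      c < ∑ a ∈ S, f a + ∑ b ∈ T, g b := by
  induction hp with
  | empty => simp at hc
  | @union_tile k A S B T hp hS hT hSc hTc hj ih =>
    by_cases h1 : c < ∑ a ∈ S, f a + ∑ b ∈ T, g b
    · exact ⟨k, A, B, S, T, rfl, hp, hS, hT, rfl, rfl, hSc, hTc, hj, h1⟩
    · rw [Finset.sum_union hS, Finset.sum_union hT] at hc
      push_cast at hc
      obtain ⟨k₀, A₀, B₀, S', T', rfl, hp', hS', hT', rfl, rfl, hSc', hTc', hj', h2⟩ :=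
        ih (by linarith)
      rw [Finset.disjoint_union_left] at hS hT
      refine ⟨k₀ + 1, A₀ ∪ S, B₀ ∪ T, S', T', rfl, hp'.union_tile hS.1 hT.1 hSc hTc hj, ?_, ?_,
        ?_, ?_, hSc', hTc', hj', h2⟩
      · rw [Finset.disjoint_union_left]; exact ⟨hS', hS.2.symm⟩
      · rw [Finset.disjoint_union_left]; exact ⟨hT', hT.2.symm⟩
      · rw [Finset.union_right_comm]
      · rw [Finset.union_right_comm]

/-- Many vertices with at least `d` neighbours in a small set `T` yield a complete pair. -/
theorem exists_joined_of_nbr (T : Finset β) (A : Finset α) {d C : ℕ} (hC : 0 < C)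
    (h : 2 ^ T.card * C ≤ (A.filter fun a => d ≤ nbr R a T).card) :
    ∃ X ⊆ T, ∃ Y ⊆ A, X.card = d ∧ Y.card = C ∧ Joined R Y X := by
  have hmaps : ∀ a ∈ A.filter (fun a => d ≤ nbr R a T),
      (T.filter fun b => R a b) ∈ T.powerset := fun a _ => by
    rw [Finset.mem_powerset]; exact Finset.filter_subset _ _
  obtain ⟨X₀, hX₀, hX⟩ := Finset.exists_le_card_fiber_of_mul_le_card_of_maps_to hmaps
    ⟨∅, by simp⟩ (n := C) (by rwa [Finset.card_powerset])
  obtain ⟨Y, hY, hYc⟩ := Finset.exists_subset_card_eq hX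
  obtain ⟨y, hy⟩ := Finset.card_pos.1 (hYc ▸ hC)
  have hy' := hY hy
  simp only [Finset.mem_filter] at hy'
  obtain ⟨X, hXs, hXc⟩ := Finset.exists_subset_card_eq (s := X₀) (n := d) (by
    rw [← hy'.2]; exact hy'.1.2)
  refine ⟨X, hXs.trans (Finset.mem_powerset.1 hX₀), Y, fun a ha => ?_, hXc, hYc, ?_⟩
  · have := hY ha
    simp only [Finset.mem_filter] at this
    exact this.1.1
  · intro a ha b hb
    have := hY ha
    simp only [Finset.mem_filter] at this
    have hb' := hXs hb
    rw [← this.2] at hb'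
    exact (Finset.mem_filter.1 hb').2

/-- If the average number of neighbours of `A` in `T` is at least `D`, there is a complete pair
using any `d ≤ D - η |T|` vertices of `T`. -/
theorem exists_joined_of_average (T : Finset β) (A : Finset α) {d C : ℕ} {D η : ℝ} (hC : 0 < C)
    (hT : 0 < T.card) (hsum : D * A.card ≤ ∑ a ∈ A, (nbr R a T : ℝ))
    (hd : d + η * T.card ≤ D) (hA : (2 : ℝ) ^ T.card * C ≤ η * A.card) :
    ∃ X ⊆ T, ∃ Y ⊆ A, X.card = d ∧ Y.card = C ∧ Joined R Y X := by
  refine exists_joined_of_nbr T A hC ?_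
  have h1 : ∑ a ∈ A, (nbr R a T : ℝ) ≤
      ∑ a ∈ A, ((d : ℝ) + if d ≤ nbr R a T then (T.card : ℝ) else 0) := by
    refine Finset.sum_le_sum fun a _ => ?_
    have := nbr_le_card (R := R) a T
    split_ifs with hh
    · have : (nbr R a T : ℝ) ≤ T.card := by exact_mod_cast this
      have : (0 : ℝ) ≤ d := by positivity
      linarith
    · rw [add_zero]; exact_mod_cast (not_le.1 hh).le
  rw [Finset.sum_add_distrib, ← Finset.sum_filter, Finset.sum_const, Finset.sum_const,
    nsmul_eq_mul, nsmul_eq_mul] at h1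
  have hT' : (0 : ℝ) < T.card := by exact_mod_cast hT
  have hA0 : (0 : ℝ) ≤ A.card := by positivity
  have h2 : η * A.card ≤ (A.filter fun a => d ≤ nbr R a T).card := by
    have : η * A.card * T.card ≤ (A.filter fun a => d ≤ nbr R a T).card * T.card := by
      nlinarith [mul_le_mul_of_nonneg_right hd hA0]
    exact le_of_mul_le_mul_right this hT'
  exact_mod_cast hA.trans h2

/-- Dense bipartite graphs contain large complete bipartite graphs. -/
theorem exists_joined_of_dense (h : ℕ) (hh : 0 < h) {ε : ℝ} (hε : 0 < ε) :
    ∃ L₀ : ℕ, ∀ (α β : Type) [DecidableEq α] [DecidableEq β] (R : α → β → Prop)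
      (A : Finset α) (B : Finset β), L₀ ≤ A.card → L₀ ≤ B.card →
      ε * A.card * B.card ≤ ∑ b ∈ B, (nbr (flip R) b A : ℝ) →
      ∃ S ⊆ A, ∃ T ⊆ B, S.card = h ∧ T.card = h ∧ Joined R S T := by
  set H : ℕ := ⌈4 * h / ε⌉₊ with hH
  have hh' : (0 : ℝ) < h := by exact_mod_cast hh
  have hHr : 4 * h / ε ≤ H := Nat.le_ceil _
  have hH0 : 0 < H := Nat.ceil_pos.2 (by positivity)
  have hHe : 4 * h ≤ ε * H := by rw [div_le_iff₀ hε] at hHr; linarith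
  refine ⟨max ⌈2 * H / ε⌉₊ ⌈(2 : ℝ) ^ H * h / (ε / 4)⌉₊, ?_⟩
  intro α β _ _ R A B hA hB hsum
  have hB' : 2 * H / ε ≤ B.card :=
    (Nat.le_ceil _).trans (by exact_mod_cast (le_max_left _ _).trans hB)
  have hA' : (2 : ℝ) ^ H * h / (ε / 4) ≤ A.card :=
    (Nat.le_ceil _).trans (by exact_mod_cast (le_max_right _ _).trans hA)
  rw [div_le_iff₀ (by positivity)] at hB' hA'
  have hApos : (0 : ℝ) < A.card := by
    by_contra hcon
    have : (A.card : ℝ) = 0 := le_antisymm (not_lt.1 hcon) (by positivity)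
    rw [this] at hA'
    have : 0 < (2 : ℝ) ^ H * h := by positivity
    linarith
  have hgood : (H : ℝ) ≤ (B.filter fun b => ε / 2 * A.card ≤ nbr (flip R) b A).card := by
    have h1 : ∑ b ∈ B, (nbr (flip R) b A : ℝ) ≤ ∑ b ∈ B, (ε / 2 * A.card +
        if ε / 2 * A.card ≤ nbr (flip R) b A then (A.card : ℝ) else 0) := by
      refine Finset.sum_le_sum fun b _ => ?_
      have h2 : (nbr (flip R) b A : ℝ) ≤ A.card := by exact_mod_cast nbr_le_card (R := flip R) b A
      split_ifs with h3
      · have : 0 ≤ ε / 2 * A.card := by positivity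
        linarith
      · linarith
    rw [Finset.sum_add_distrib, ← Finset.sum_filter, Finset.sum_const, Finset.sum_const,
      nsmul_eq_mul, nsmul_eq_mul] at h1
    have h4 : (ε / 2 * B.card) * A.card ≤
        (B.filter fun b => ε / 2 * A.card ≤ nbr (flip R) b A).card * A.card := by nlinarith
    have := le_of_mul_le_mul_right h4 hApos
    linarith
  obtain ⟨T, hT, hTc⟩ := Finset.exists_subset_card_eq (s := B.filter fun b =>
    ε / 2 * A.card ≤ nbr (flip R) b A) (n := H) (by exact_mod_cast hgood)
  obtain ⟨X, hX, Y, hY, hXc, hYc, hj⟩ := exists_joined_of_average (R := R) T A (d := h) (C := h)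
    (D := ε / 2 * H) (η := ε / 4) hh (by omega) (by
      have : ∑ a ∈ A, (nbr R a T : ℝ) = ∑ b ∈ T, (nbr (flip R) b A : ℝ) := by
        exact_mod_cast sum_nbr_comm A T
      rw [this]
      have h5 : ∑ b ∈ T, ε / 2 * (A.card : ℝ) ≤ ∑ b ∈ T, (nbr (flip R) b A : ℝ) :=
        Finset.sum_le_sum fun b hb => (Finset.mem_filter.1 (hT hb)).2
      rw [Finset.sum_const, nsmul_eq_mul, hTc] at h5
      linarith) (by rw [hTc]; linarith) (by rw [hTc]; linarith)
  exact ⟨Y, hY, X, hX.trans (hT.trans (Finset.filter_subset _ _)), hYc, hXc, hj⟩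

end AlmostTiling

section Improve

set_option linter.unusedSectionVars false
set_option linter.unusedDecidableInType false

/-- A tile with large average degree to the leftover can be replaced by more smaller tiles. -/
theorem exists_more_tiles {α β : Type} [DecidableEq α] [DecidableEq β]
    {R : α → β → Prop} {h q L : ℕ} {ε : ℝ} (hh : 0 < h) (hε : 0 < ε) (hε1 : ε ≤ 1)
    (hq : 32 ≤ ε * q) (hL : (2 : ℝ) ^ (h * q) * (h * q : ℕ) ≤ ε / 32 * L)
    {S A' : Finset α} {T B' : Finset β} (hj : Joined R S T) (hS : S.card = h * q)
    (hT : T.card = h * q) (hA' : A'.card = L) (hB' : B'.card = L) (hSA : Disjoint S A')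
    (hTB : Disjoint T B')
    (hw : (L : ℝ) * (h * q) * (1 + ε / 4) < ∑ a ∈ S, (nbr R a B' : ℝ) +
      ∑ b ∈ T, (nbr (flip R) b A' : ℝ)) :
    ∃ SA ⊆ S ∪ A', ∃ SB ⊆ T ∪ B', Packed R h (q + 1) SA SB := by
  have hhr : (0 : ℝ) < h := by exact_mod_cast hh
  have hq0 : (32 : ℝ) ≤ q := by nlinarith
  have hqn : 32 ≤ q := by exact_mod_cast hq0
  have hL0 : (0 : ℝ) < L := by
    have : 0 < (2 : ℝ) ^ (h * q) * (h * q : ℕ) := by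
      have : 0 < h * q := by positivity
      positivity
    have h2 := this.trans_le hL
    exact pos_of_mul_pos_right h2 (by positivity)
  set D1 : ℝ := (∑ b ∈ T, (nbr (flip R) b A' : ℝ)) / L with hD1
  set D2 : ℝ := (∑ a ∈ S, (nbr R a B' : ℝ)) / L with hD2
  have e1 : D1 * L = ∑ b ∈ T, (nbr (flip R) b A' : ℝ) := div_mul_cancel₀ _ hL0.ne'
  have e2 : D2 * L = ∑ a ∈ S, (nbr R a B' : ℝ) := div_mul_cancel₀ _ hL0.ne'
  have b1 : D1 ≤ h * q := by
    have : ∑ b ∈ T, (nbr (flip R) b A' : ℝ) ≤ ∑ b ∈ T, (L : ℝ) :=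
      Finset.sum_le_sum fun b _ => by
        have := nbr_le_card (R := flip R) b A'
        rw [hA'] at this; exact_mod_cast this
    rw [Finset.sum_const, nsmul_eq_mul, hT, ← e1] at this
    have := le_of_mul_le_mul_right this hL0
    push_cast at this; exact this
  have b2 : D2 ≤ h * q := by
    have : ∑ a ∈ S, (nbr R a B' : ℝ) ≤ ∑ a ∈ S, (L : ℝ) :=
      Finset.sum_le_sum fun b _ => by
        have := nbr_le_card (R := R) b B'
        rw [hB'] at this; exact_mod_cast this
    rw [Finset.sum_const, nsmul_eq_mul, hS, ← e2] at this
    have := le_of_mul_le_mul_right this hL0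
    push_cast at this; exact this
  have hsum : h * q * (1 + ε / 4) < D1 + D2 := by
    rw [← e1, ← e2] at hw
    have : (h * q * (1 + ε / 4)) * L < (D1 + D2) * L := by linarith
    exact lt_of_mul_lt_mul_right this hL0.le
  set x : ℕ := ⌊(D1 - ε / 32 * (h * q)) / h⌋₊ with hx
  set y : ℕ := ⌊(D2 - ε / 32 * (h * q)) / h⌋₊ with hy
  have hqh : 32 * h ≤ ε * (h * q) := by nlinarith
  have x1 : x * h ≤ D1 - ε / 32 * (h * q) := by
    rw [← le_div_iff₀ hhr]; exact Nat.floor_le (div_nonneg (by nlinarith) hhr.le)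
  have y1 : y * h ≤ D2 - ε / 32 * (h * q) := by
    rw [← le_div_iff₀ hhr]; exact Nat.floor_le (div_nonneg (by nlinarith) hhr.le)
  have x2 : D1 - ε / 32 * (h * q) < (x + 1) * h := by
    rw [← div_lt_iff₀ hhr]; exact Nat.lt_floor_add_one _
  have y2 : D2 - ε / 32 * (h * q) < (y + 1) * h := by
    rw [← div_lt_iff₀ hhr]; exact Nat.lt_floor_add_one _
  have x0 : 0 < x := by
    have : (0 : ℝ) < x := by
      have : (0 : ℝ) < x * h := by nlinarith
      exact pos_of_mul_pos_left this hhr.le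
    exact_mod_cast this
  have y0 : 0 < y := by
    have : (0 : ℝ) < y := by
      have : (0 : ℝ) < y * h := by nlinarith
      exact pos_of_mul_pos_left this hhr.le
    exact_mod_cast this
  have x3 : x ≤ q := by
    have : (x : ℝ) * h ≤ q * h := by nlinarith
    exact_mod_cast le_of_mul_le_mul_right this hhr
  have y3 : y ≤ q := by
    have : (y : ℝ) * h ≤ q * h := by nlinarith
    exact_mod_cast le_of_mul_le_mul_right this hhr
  have hxy : q + 1 ≤ x + y := by
    have : ((q : ℝ) + 1) * h ≤ (x + y) * h := by nlinarith
    exact_mod_cast le_of_mul_le_mul_right this hhr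
  have key : ∀ z : ℕ, z ≤ q → (2 : ℝ) ^ (h * q) * (h * z : ℕ) ≤ ε / 32 * L := fun z hz => by
    refine le_trans ?_ hL
    gcongr
  obtain ⟨X, hX, Y, hY, hXc, hYc, hXY⟩ := exists_joined_of_average (R := R) T A' (d := h * x)
    (C := h * x) (D := D1) (η := ε / 32) (by positivity) (by rw [hT]; positivity) (by
      have : ∑ a ∈ A', (nbr R a T : ℝ) = ∑ b ∈ T, (nbr (flip R) b A' : ℝ) := by
        exact_mod_cast sum_nbr_comm A' T
      rw [this, hA', e1]) (by rw [hT]; push_cast; linarith) (by rw [hT, hA']; exact key x x3)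
  obtain ⟨X', hX', Y', hY', hXc', hYc', hXY'⟩ := exists_joined_of_average (R := flip R) S B'
    (d := h * y) (C := h * y) (D := D2) (η := ε / 32) (by positivity) (by rw [hS]; positivity) (by
      have : ∑ a ∈ S, (nbr R a B' : ℝ) = ∑ b ∈ B', (nbr (flip R) b S : ℝ) := by
        exact_mod_cast sum_nbr_comm S B'
      rw [← this, hB', e2]) (by rw [hS]; push_cast; linarith) (by rw [hS, hB']; exact key y y3)
  have hz : h * min (q - x) (q - y) ≤ h * q - h * x := by
    rw [← Nat.mul_sub]; gcongr; exact min_le_left _ _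
  have hz' : h * min (q - x) (q - y) ≤ h * q - h * y := by
    rw [← Nat.mul_sub]; gcongr; exact min_le_right _ _
  obtain ⟨S₃, hS₃, hSc₃⟩ := Finset.exists_subset_card_eq (s := S \ X')
    (n := h * min (q - x) (q - y)) (by rw [Finset.card_sdiff_of_subset hX', hS, hXc']; exact hz')
  obtain ⟨T₃, hT₃, hTc₃⟩ := Finset.exists_subset_card_eq (s := T \ X)
    (n := h * min (q - x) (q - y)) (by rw [Finset.card_sdiff_of_subset hX, hT, hXc]; exact hz)
  have p1 := hXY.packed x hYc hXc
  have p2 := hXY'.flip.packed y hXc' hYc'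
  have p3 := (hj.mono (hS₃.trans Finset.sdiff_subset) (hT₃.trans Finset.sdiff_subset)).packed
    (min (q - x) (q - y)) hSc₃ hTc₃
  have p := (p1.union p2 ((hSA.symm.mono hY hX')) (hTB.mono hX hY')).union p3
    (by
      rw [Finset.disjoint_union_left]
      exact ⟨hSA.symm.mono hY (hS₃.trans Finset.sdiff_subset),
        (Finset.disjoint_sdiff).mono_right hS₃⟩)
    (by
      rw [Finset.disjoint_union_left]
      exact ⟨(Finset.disjoint_sdiff).mono_right hT₃,
        hTB.symm.mono hY' (hT₃.trans Finset.sdiff_subset)⟩)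
  obtain ⟨SA, hSA', SB, hSB', hp⟩ := p.exists_sub (k' := q + 1) (by omega)
  refine ⟨SA, hSA'.trans ?_, SB, hSB'.trans ?_, hp⟩
  · refine Finset.union_subset (Finset.union_subset ?_ ?_) ?_
    · exact hY.trans Finset.subset_union_right
    · exact hX'.trans Finset.subset_union_left
    · exact (hS₃.trans Finset.sdiff_subset).trans Finset.subset_union_left
  · refine Finset.union_subset (Finset.union_subset ?_ ?_) ?_
    · exact hX.trans Finset.subset_union_left
    · exact hY'.trans Finset.subset_union_right
    · exact (hT₃.trans Finset.sdiff_subset).trans Finset.subset_union_left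

/-- One improvement of a partial tiling consisting of large old tiles and few small new ones. -/
theorem exists_improvement (h : ℕ) (hh : 0 < h) {ε : ℝ} (hε : 0 < ε) (hε1 : ε ≤ 1) (q : ℕ)
    (hq : 32 ≤ ε * q) :
    ∃ L₀ : ℕ, ∀ (α β : Type) [DecidableEq α] [DecidableEq β] (R : α → β → Prop)
      (A A₁ A' : Finset α) (B B₁ B' : Finset β) (n k w : ℕ), A.card = n → B.card = n →
      (∀ a ∈ A, n ≤ 2 * nbr R a B) → (∀ b ∈ B, n ≤ 2 * nbr (flip R) b A) →
      Packed R (h * q) k A₁ B₁ → A' ⊆ A → B' ⊆ B → Disjoint A₁ A' → Disjoint B₁ B' →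
      A₁ ⊆ A → B₁ ⊆ B → A'.card = B'.card →
      A.card ≤ A₁.card + A'.card + w → B.card ≤ B₁.card + B'.card + w → (w : ℝ) ≤ ε / 8 * n →
      L₀ ≤ A'.card → (h * q * k : ℝ) ≤ (1 - ε) * n →
      ∃ k₀ A₀ B₀ r SA SB, Packed R (h * q) k₀ A₀ B₀ ∧ A₀ ⊆ A₁ ∧ B₀ ⊆ B₁ ∧ Packed R h r SA SB ∧
        SA ⊆ (A₁ \ A₀) ∪ A' ∧ SB ⊆ (B₁ \ B₀) ∪ B' ∧ r ≤ q + 1 ∧ q * k + 1 = q * k₀ + r := by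
  obtain ⟨L₀, hL₀⟩ := exists_joined_of_dense h hh (ε := ε / 8) (by positivity)
  refine ⟨max L₀ ⌈(2 : ℝ) ^ (h * q) * (h * q : ℕ) / (ε / 32)⌉₊, ?_⟩
  intro α β _ _ R A A₁ A' B B₁ B' n k w hA hB hdA hdB hp hA' hB' hdisA hdisB hA₁ hB₁ hcard
    hwA hwB hw hL hk
  have hq0 : (32 : ℝ) ≤ q := by nlinarith
  have hqn : 32 ≤ q := by exact_mod_cast hq0
  have hLr : (2 : ℝ) ^ (h * q) * (h * q : ℕ) ≤ ε / 32 * A'.card := by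
    have : (2 : ℝ) ^ (h * q) * (h * q : ℕ) / (ε / 32) ≤ A'.card :=
      (Nat.le_ceil _).trans (by exact_mod_cast (le_max_right _ _).trans hL)
    rw [div_le_iff₀ (by positivity)] at this
    linarith
  have hL0 : (0 : ℝ) < A'.card := by
    have : 0 < (2 : ℝ) ^ (h * q) * (h * q : ℕ) := by
      have : 0 < h * q := by positivity
      positivity
    exact pos_of_mul_pos_right (this.trans_le hLr) (by positivity)
  by_cases hd : ε / 8 * A'.card * B'.card ≤ ∑ b ∈ B', (nbr (flip R) b A' : ℝ)
  · obtain ⟨S, hS, T, hT, hSc, hTc, hj⟩ := hL₀ α β R A' B' ((le_max_left _ _).trans hL)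
      (by rw [← hcard]; exact (le_max_left _ _).trans hL) hd
    exact ⟨k, A₁, B₁, 1, S, T, hp, subset_rfl, subset_rfl, Packed.single hSc hTc hj,
      hS.trans Finset.subset_union_right, hT.trans Finset.subset_union_right, by omega, by omega⟩
  rw [not_le] at hd
  have hLn : (A'.card : ℝ) ≤ n := by exact_mod_cast hA ▸ Finset.card_le_card hA'
  have hn0 : (0 : ℝ) < n := hL0.trans_le hLn
  have aux : ∀ {γ δ : Type} [DecidableEq γ] [DecidableEq δ] (Q : γ → δ → Prop) (C' : Finset γ)
      (D D₁ D' : Finset δ), (∀ c ∈ C', n ≤ 2 * nbr Q c D) → D₁ ⊆ D → D' ⊆ D → Disjoint D₁ D' →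
      D.card ≤ D₁.card + D'.card + w →
      (C'.card : ℝ) * (n / 2 - w) ≤ ∑ c ∈ C', (nbr Q c D₁ : ℝ) + ∑ c ∈ C', (nbr Q c D' : ℝ) := by
    intro γ δ _ _ Q C' D D₁ D' hdeg h1 h2 h3 h4
    rw [← Finset.sum_add_distrib, ← nsmul_eq_mul, ← Finset.sum_const]
    refine Finset.sum_le_sum fun c hc => ?_
    have i1 := hdeg c hc
    have i2 := nbr_le_nbr_sdiff (R := Q) c D (D \ (D₁ ∪ D'))
    rw [Finset.sdiff_sdiff_eq_self (Finset.union_subset h1 h2), nbr_union_of_disjoint c h3,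
      Finset.card_sdiff_of_subset (Finset.union_subset h1 h2), Finset.card_union_of_disjoint h3] at i2
    have : n ≤ 2 * (nbr Q c D₁ + nbr Q c D' + w) := by omega
    have : (n : ℝ) ≤ 2 * (nbr Q c D₁ + nbr Q c D' + w) := by exact_mod_cast this
    linarith
  have a1 := aux R A' B B₁ B' (fun a ha => hdA a (hA' ha)) hB₁ hB' hdisB hwB
  have a2 := aux (flip R) B' A A₁ A' (fun a ha => hdB a (hB' ha)) hA₁ hA' hdisA hwA
  have s1 : ∑ a ∈ A', (nbr R a B' : ℝ) = ∑ b ∈ B', (nbr (flip R) b A' : ℝ) := by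
    exact_mod_cast sum_nbr_comm A' B'
  have s2 : ∑ a ∈ A', (nbr R a B₁ : ℝ) = ∑ b ∈ B₁, (nbr (flip R) b A' : ℝ) := by
    exact_mod_cast sum_nbr_comm A' B₁
  have s3 : ∑ a ∈ A₁, (nbr R a B' : ℝ) = ∑ b ∈ B', (nbr (flip R) b A₁ : ℝ) := by
    exact_mod_cast sum_nbr_comm A₁ B'
  rw [s1, s2] at a1
  rw [← s3, ← hcard] at a2
  rw [← hcard] at hd
  set L : ℝ := (A'.card : ℝ) with hLdef
  obtain ⟨k₀, A₀, B₀, S, T, rfl, hp₀, hAS, hBT, rfl, rfl, hSc, hTc, hj, hw'⟩ :=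
    hp.exists_heavy (fun a => (nbr R a B' : ℝ)) (fun b => (nbr (flip R) b A' : ℝ))
      (L * (h * q) * (1 + ε / 4)) (by
        have m1 : L * L ≤ L * n := by gcongr
        have m2 : L * w ≤ L * (ε / 8 * n) := by gcongr
        have m3 : L * (h * q * k) ≤ L * ((1 - ε) * n) := by gcongr
        have m4 : L * (h * q * k) * (1 + ε / 4) ≤ L * ((1 - ε) * n) * (1 + ε / 4) := by gcongr
        have m5 : 0 < L * n * ε := by positivity
        have m6 : 0 < L * n * ε * ε := by positivity
        have m7 : ε / 8 * (L * L) ≤ ε / 8 * (L * n) := by gcongr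
        nlinarith)
  rw [Finset.disjoint_union_left] at hdisA hdisB
  obtain ⟨SA, hSA, SB, hSB, hnew⟩ := exists_more_tiles hh hε hε1 hq hLr hj hSc hTc rfl hcard.symm
    hdisA.2 hdisB.2 hw'
  refine ⟨k₀, A₀, B₀, q + 1, SA, SB, hp₀, Finset.subset_union_left, Finset.subset_union_left,
    hnew, ?_, ?_, le_rfl, by ring⟩
  · rwa [Finset.union_sdiff_cancel_left hAS]
  · rwa [Finset.union_sdiff_cancel_left hBT]

end Improve

section AlmostTile

set_option linter.unusedSectionVars false
set_option linter.unusedDecidableInType false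

/-- Large balanced bipartite graphs with minimum degree at least half the part size contain
disjoint copies of `K_{h,h}` covering a proportion `c` of all vertices. -/
def AlmostTile (c : ℝ) : Prop :=
  ∀ h : ℕ, 0 < h → ∃ n₀ : ℕ, ∀ (α β : Type) [DecidableEq α] [DecidableEq β] (R : α → β → Prop)
    (A : Finset α) (B : Finset β) (n : ℕ), n₀ ≤ n → A.card = n → B.card = n →
    (∀ a ∈ A, n ≤ 2 * nbr R a B) → (∀ b ∈ B, n ≤ 2 * nbr (flip R) b A) →
    ∃ k, ∃ A₁ ⊆ A, ∃ B₁ ⊆ B, Packed R h k A₁ B₁ ∧ c * n ≤ h * k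

theorem AlmostTile.mono {c c' : ℝ} (H : AlmostTile c) (hc : c' ≤ c) : AlmostTile c' := by
  intro h hh
  obtain ⟨n₀, h0⟩ := H h hh
  refine ⟨n₀, fun α β _ _ R A B n hn hA hB h1 h2 => ?_⟩
  obtain ⟨k, A₁, hA₁, B₁, hB₁, hp, hk⟩ := h0 α β R A B n hn hA hB h1 h2
  exact ⟨k, A₁, hA₁, B₁, hB₁, hp, le_trans (by gcongr) hk⟩

theorem AlmostTile.step {c ε : ℝ} (H : AlmostTile c) (hε : 0 < ε) (hε1 : ε ≤ 1) (q : ℕ)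
    (hq : 32 ≤ ε * q) : AlmostTile (min (c + ε / (32 * q)) (1 - ε)) := by
  intro h hh
  have hq0 : (32 : ℝ) ≤ q := by nlinarith
  have hqn : 32 ≤ q := by exact_mod_cast hq0
  have hhr : (0 : ℝ) < h := by exact_mod_cast hh
  obtain ⟨n₁, hn₁⟩ := H (h * q) (by positivity)
  obtain ⟨L₀, hL₀⟩ := exists_improvement h hh hε hε1 q hq
  refine ⟨max n₁ (max ⌈L₀ / ε⌉₊ ⌈32 * (h * q) / ε⌉₊), ?_⟩
  intro α β _ _ R A B n hn hA hB hdA hdB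
  rw [max_le_iff, max_le_iff, Nat.ceil_le, Nat.ceil_le, div_le_iff₀ hε, div_le_iff₀ hε] at hn
  obtain ⟨hn1, hn2, hn3⟩ := hn
  obtain ⟨ko, Ao, hAo, Bo, hBo, hpo, hko⟩ := hn₁ α β R A B n hn1 hA hB hdA hdB
  have key : ∀ j : ℕ, 2 * (h * q) * (j : ℝ) ≤ ε / 8 * n → ∃ k k' A₁ B₁ A₂ B₂,
      Packed R (h * q) k A₁ B₁ ∧ Packed R h k' A₂ B₂ ∧ A₁ ⊆ A ∧ B₁ ⊆ B ∧ A₂ ⊆ A ∧ B₂ ⊆ B ∧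
      Disjoint A₁ A₂ ∧ Disjoint B₁ B₂ ∧ k' ≤ 2 * q * j ∧
      (q * ko + j ≤ q * k + k' ∨ (1 - ε) * n ≤ h * (q * k + k')) := by
    intro j
    induction j with
    | zero =>
      intro _
      exact ⟨ko, 0, Ao, Bo, ∅, ∅, hpo, Packed.empty, hAo, hBo, by simp, by simp, by simp,
        by simp, by simp, by simp⟩
    | succ j ih =>
      intro hj
      push_cast at hj
      have hhq : 0 ≤ 2 * ((h : ℝ) * q) := by positivity
      obtain ⟨k, k', A₁, B₁, A₂, B₂, hp, hp', hA₁, hB₁, hA₂, hB₂, hdis, hdis', hk', hor⟩ :=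
        ih (by nlinarith)
      by_cases hbig : (1 - ε) * n ≤ h * (q * k + k')
      · exact ⟨k, k', A₁, B₁, A₂, B₂, hp, hp', hA₁, hB₁, hA₂, hB₂, hdis, hdis',
          hk'.trans (by gcongr; omega), Or.inr hbig⟩
      have hor' := hor.resolve_right hbig
      rw [not_le] at hbig
      have cA : (A \ (A₁ ∪ A₂)).card + (h * q * k + h * k') = n := by
        rw [← hp.card_left, ← hp'.card_left, ← Finset.card_union_of_disjoint hdis, ← hA,
          Finset.card_sdiff_add_card_eq_card (Finset.union_subset hA₁ hA₂)]
      have cB : (B \ (B₁ ∪ B₂)).card + (h * q * k + h * k') = n := by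
        rw [← hp.card_right, ← hp'.card_right, ← Finset.card_union_of_disjoint hdis', ← hB,
          Finset.card_sdiff_add_card_eq_card (Finset.union_subset hB₁ hB₂)]
      have hw : ((h * k' : ℕ) : ℝ) ≤ ε / 8 * n := by
        have : h * k' ≤ h * (2 * q * j) := by gcongr
        have : ((h * k' : ℕ) : ℝ) ≤ ((h * (2 * q * j) : ℕ) : ℝ) := by exact_mod_cast this
        push_cast at this ⊢
        nlinarith
      obtain ⟨k₀, A₀, B₀, r, SA, SB, hp₀, hA₀, hB₀, hnew, hSA, hSB, hr, hcount⟩ :=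
        hL₀ α β R A A₁ (A \ (A₁ ∪ A₂)) B B₁ (B \ (B₁ ∪ B₂)) n k (h * k') hA hB hdA hdB hp
          Finset.sdiff_subset Finset.sdiff_subset
          (Finset.disjoint_sdiff.mono_left Finset.subset_union_left)
          (Finset.disjoint_sdiff.mono_left Finset.subset_union_left) hA₁ hB₁ (by omega)
          (by rw [hp.card_left]; omega) (by rw [hp.card_right]; omega) hw
          (by
            have : (((A \ (A₁ ∪ A₂)).card + (h * q * k + h * k') : ℕ) : ℝ) = n := by
              exact_mod_cast cA
            push_cast at this
            have : (L₀ : ℝ) ≤ (A \ (A₁ ∪ A₂)).card := by nlinarith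
            exact_mod_cast this)
          (by
            have : (0 : ℝ) ≤ h * k' := by positivity
            nlinarith)
      have dA : Disjoint A₂ SA := by
        refine Disjoint.mono_right hSA (Finset.disjoint_union_right.2 ⟨?_, ?_⟩)
        · exact hdis.symm.mono_right Finset.sdiff_subset
        · exact Finset.disjoint_sdiff.mono_left Finset.subset_union_right
      have dB : Disjoint B₂ SB := by
        refine Disjoint.mono_right hSB (Finset.disjoint_union_right.2 ⟨?_, ?_⟩)
        · exact hdis'.symm.mono_right Finset.sdiff_subset
        · exact Finset.disjoint_sdiff.mono_left Finset.subset_union_right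
      refine ⟨k₀, k' + r, A₀, B₀, A₂ ∪ SA, B₂ ∪ SB, hp₀, hp'.union hnew dA dB, hA₀.trans hA₁,
        hB₀.trans hB₁, Finset.union_subset hA₂ (hSA.trans ?_),
        Finset.union_subset hB₂ (hSB.trans ?_), ?_, ?_, ?_, ?_⟩
      · exact Finset.union_subset (Finset.sdiff_subset.trans hA₁) Finset.sdiff_subset
      · exact Finset.union_subset (Finset.sdiff_subset.trans hB₁) Finset.sdiff_subset
      · refine Finset.disjoint_union_right.2 ⟨hdis.mono_left hA₀, Disjoint.mono_right hSA
          (Finset.disjoint_union_right.2 ⟨Finset.disjoint_sdiff, ?_⟩)⟩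
        exact Finset.disjoint_sdiff.mono_left (hA₀.trans Finset.subset_union_left)
      · refine Finset.disjoint_union_right.2 ⟨hdis'.mono_left hB₀, Disjoint.mono_right hSB
          (Finset.disjoint_union_right.2 ⟨Finset.disjoint_sdiff, ?_⟩)⟩
        exact Finset.disjoint_sdiff.mono_left (hB₀.trans Finset.subset_union_left)
      · nlinarith
      · left; omega
  have hHpos : (0 : ℝ) < 16 * (h * q) := by positivity
  obtain ⟨k, k', A₁, B₁, A₂, B₂, hp, hp', hA₁, hB₁, hA₂, hB₂, hdis, hdis', hk', hor⟩ :=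
    key ⌊ε * n / (16 * (h * q))⌋₊ (by
      have := Nat.floor_le (a := ε * n / (16 * (h * q))) (by positivity)
      rw [le_div_iff₀ hHpos] at this
      linarith)
  refine ⟨q * k + k', A₁ ∪ A₂, Finset.union_subset hA₁ hA₂, B₁ ∪ B₂,
    Finset.union_subset hB₁ hB₂, (hp.split q).union hp' hdis hdis', ?_⟩
  push_cast
  rcases hor with hor | hor
  · have hfl := Nat.lt_floor_add_one (ε * n / (16 * (h * q)))
    set j := ⌊ε * n / (16 * (h * q))⌋₊
    rw [div_lt_iff₀ hHpos] at hfl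
    have h1 : ε / (32 * q) * n ≤ h * j := by
      rw [div_mul_eq_mul_div, div_le_iff₀ (by positivity)]
      nlinarith
    have h2 : ((q * ko + j : ℕ) : ℝ) ≤ (q * k + k' : ℕ) := by exact_mod_cast hor
    push_cast at h2 hko
    have h3 : min (c + ε / (32 * q)) (1 - ε) * n ≤ (c + ε / (32 * q)) * n := by
      gcongr; exact min_le_left _ _
    nlinarith
  · refine le_trans ?_ hor
    gcongr
    exact min_le_right _ _

theorem almostTile {ε : ℝ} (hε : 0 < ε) (hε1 : ε ≤ 1) : AlmostTile (1 - ε) := by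
  obtain ⟨q, hq⟩ := exists_nat_ge (32 / ε)
  rw [div_le_iff₀ hε] at hq
  have hq' : 32 ≤ ε * q := by linarith
  have hq0 : (0 : ℝ) < q := by
    have : (32 : ℝ) ≤ q := by nlinarith
    linarith
  have key : ∀ i : ℕ, AlmostTile (min (i * (ε / (32 * q))) (1 - ε)) := by
    intro i
    induction i with
    | zero =>
      intro h hh
      refine ⟨0, fun α β _ _ R A B n _ hA hB _ _ =>
        ⟨0, ∅, by simp, ∅, by simp, Packed.empty, ?_⟩⟩
      have : min (((0 : ℕ) : ℝ) * (ε / (32 * q))) (1 - ε) ≤ 0 := (min_le_left _ _).trans (by simp)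
      have hn : (0 : ℝ) ≤ n := by positivity
      simpa using mul_nonpos_of_nonpos_of_nonneg this hn
    | succ i ih =>
      refine (ih.step hε hε1 q hq').mono (le_min ?_ (min_le_right _ _))
      rw [← min_add_add_right]
      refine min_le_min ?_ ?_
      · push_cast; linarith
      · have : 0 < ε / (32 * q) := by positivity
        linarith
  obtain ⟨i, hi⟩ := exists_nat_ge ((1 - ε) / (ε / (32 * q)))
  rw [div_le_iff₀ (by positivity)] at hi
  exact (key i).mono (le_min hi le_rfl)

end AlmostTile

section Push

set_option linter.unusedSectionVars false
set_option linter.unusedDecidableInType false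

variable {α β : Type} [DecidableEq α] [DecidableEq β] {R : α → β → Prop} {s t : ℕ}

/-- The pair `(P, Q)` has many edges compared to `h`. -/
def Link (R : α → β → Prop) (d h : ℕ) (P : Finset α) (Q : Finset β) : Prop :=
  2 * d * h ≤ ∑ a ∈ P, nbr R a Q

theorem Link.many {d h : ℕ} {P : Finset α} {Q : Finset β} (hl : Link R d h P Q) (hh : 0 < h)
    (hP : P.card ≤ h) (hQ : Q.card ≤ h) : d ≤ (P.filter fun a => d ≤ nbr R a Q).card := by
  have h1 : ∑ a ∈ P, nbr R a Q ≤ ∑ a ∈ P, (d + if d ≤ nbr R a Q then h else 0) := by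
    refine Finset.sum_le_sum fun a _ => ?_
    have := nbr_le_card (R := R) a Q
    split_ifs with h2 <;> omega
  rw [Finset.sum_add_distrib, ← Finset.sum_filter, Finset.sum_const, Finset.sum_const,
    smul_eq_mul, smul_eq_mul] at h1
  have h2 := hl.trans h1
  have h3 : P.card * d ≤ h * d := by gcongr
  have h4 : d * h ≤ (P.filter fun a => d ≤ nbr R a Q).card * h := by nlinarith
  exact le_of_mul_le_mul_right h4 hh

theorem inLat_self {p : ℤ} (h : (s + t : ℤ) ∣ p) : InLat s t p p := by
  obtain ⟨x, rfl⟩ := h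
  exact ⟨x, x, by ring, by ring⟩

set_option maxHeartbeats 1000000 in
/-- A complete pair whose sizes are one vertex off the lattice can pass this defect on to a
linked complete pair. -/
theorem push {d h c K : ℕ} (hs : 1 ≤ s) (hst : s < t) (hK : c + t ^ 3 ≤ K) (hd : K ≤ d)
    (hh : t * (K + 1) ≤ h) {P₀ P P₀' P' : Finset α} {Q₀ Q Q₀' Q' : Finset β}
    (hP : P ⊆ P₀) (hQ : Q ⊆ Q₀) (hP' : P' ⊆ P₀') (hQ' : Q' ⊆ Q₀')
    (cP₀ : P₀.card = h) (cQ₀ : Q₀.card = h) (cP₀' : P₀'.card = h) (cQ₀' : Q₀'.card = h)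
    (cP : h ≤ P.card + c) (cQ : h ≤ Q.card + c) (cP' : h ≤ P'.card + c) (cQ' : h ≤ Q'.card + c)
    (hj : Joined R P Q) (hj' : Joined R P' Q') (hdP : Disjoint P P') (hdQ : Disjoint Q Q')
    (hl : Link R d h P₀ Q₀' ∨ Link R d h P₀' Q₀) (hlat : InLat s t (P.card - 1) Q.card) :
    ∃ P'' ⊆ P', ∃ Q'' ⊆ Q', h ≤ P''.card + (c + t ^ 3) ∧ h ≤ Q''.card + (c + t ^ 3) ∧
      InLat s t (P''.card - P'.card - 1) (Q''.card - Q'.card) ∧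
      Tileable R s t (P ∪ (P' \ P'')) (Q ∪ (Q' \ Q'')) := by
  have ht3 : t * t ≤ t ^ 3 := by
    rw [pow_succ, pow_two]; nlinarith
  have ht1 : t ≤ t * t := by nlinarith
  have hst1 : (s - 1) ≤ t := by omega
  have hts : (s + 1) * h ≤ t * h := by gcongr; omega
  have hKh : t * (c + t ^ 3 + 1) ≤ h := le_trans (by gcongr) hh
  have hch : c + t ^ 3 + 1 ≤ h := le_trans (Nat.le_mul_of_pos_left _ (by omega)) hKh
  have hKc : t * (c + 1) ≤ h := le_trans (by gcongr; omega) hKh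
  have lossP : ∀ {x : α}, nbr R x Q₀ ≤ nbr R x Q + c := fun {x} => by
    have := nbr_sdiff_add (R := R) x hQ
    have h2 := nbr_le_card (R := R) x (Q₀ \ Q)
    rw [Finset.card_sdiff_of_subset hQ] at h2
    omega
  have lossP' : ∀ {x : α}, nbr R x Q₀' ≤ nbr R x Q' + c := fun {x} => by
    have := nbr_sdiff_add (R := R) x hQ'
    have h2 := nbr_le_card (R := R) x (Q₀' \ Q')
    rw [Finset.card_sdiff_of_subset hQ'] at h2
    omega
  have uP := Finset.card_le_card hP
  have uQ := Finset.card_le_card hQ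
  have many : ∀ {Z Z₀ : Finset α} {Y : Finset β}, Z ⊆ Z₀ → Z₀.card = h → h ≤ Z.card + c →
      d ≤ (Z₀.filter fun a => d ≤ nbr R a Y).card →
      d ≤ (Z.filter fun a => d ≤ nbr R a Y).card + c := by
    intro Z Z₀ Y hZ hc hc' hd
    have h1 : (Z₀.filter fun a => d ≤ nbr R a Y) ⊆
        (Z.filter fun a => d ≤ nbr R a Y) ∪ (Z₀ \ Z) := by
      intro x hx
      simp only [Finset.mem_filter, Finset.mem_union, Finset.mem_sdiff] at hx ⊢
      tauto
    have h2 := (Finset.card_le_card h1).trans (Finset.card_union_le _ _)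
    rw [Finset.card_sdiff_of_subset hZ] at h2
    omega
  rcases hl with hl | hl
  · have h1 := many hP cP₀ cP (hl.many (by omega) cP₀.le cQ₀'.le)
    obtain ⟨x, hx⟩ : (P.filter fun a => d ≤ nbr R a Q₀').Nonempty := by
      rw [← Finset.card_pos]; omega
    rw [Finset.mem_filter] at hx
    have hxP' : x ∉ P' := Finset.disjoint_left.1 hdP hx.1
    have h3 := lossP' (x := x)
    obtain ⟨Pr, hPr, Qr, hQr, cPr, cQr, hT⟩ := exists_carve (R := R) (s := s) (t := t) (F := {x})
      (P := P') (Q := Q') (μ := 0) (f := 1) hs (by simpa using hxP')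
      (fun b hb => (hj'.flip.miss_eq hb).le) (by simp) (by
        intro y hy
        rw [Finset.mem_singleton] at hy
        subst hy
        omega) (by omega)
    rw [Finset.card_singleton, Nat.one_mul] at cPr cQr
    refine ⟨P' \ Pr, Finset.sdiff_subset, Q' \ Qr, Finset.sdiff_subset, ?_, ?_, ?_, ?_⟩
    · rw [Finset.card_sdiff_of_subset hPr]; omega
    · rw [Finset.card_sdiff_of_subset hQr]; omega
    · refine ⟨-1, 0, ?_, ?_⟩
      · rw [Finset.cast_card_sdiff hPr, cPr]
        push_cast [Nat.cast_sub hs]; ring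
      · rw [Finset.cast_card_sdiff hQr, cQr]; ring
    · have hxc : (P \ {x}).card = P.card - 1 := by
        rw [Finset.card_sdiff_of_subset (by simpa using hx.1), Finset.card_singleton]
      have hT' : Tileable R s t (P \ {x}) Q := by
        refine (hj.mono Finset.sdiff_subset subset_rfl).tileable hst ?_ ?_ ?_
        · rw [hxc, Nat.cast_sub (by omega)]; exact_mod_cast hlat
        · rw [hxc]
          have i1 : s * (P.card - 1) ≤ s * h := by gcongr; omega
          have i2 : t * h ≤ t * (Q.card + c) := by gcongr
          linarith
        · rw [hxc]
          have i1 : s * Q.card ≤ s * h := by gcongr; omega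
          have i2 : t * h ≤ t * (P.card - 1 + 1 + c) := by gcongr; omega
          linarith
      rw [Finset.sdiff_sdiff_eq_self hPr, Finset.sdiff_sdiff_eq_self hQr]
      have := hT'.union hT (Finset.disjoint_union_right.2 ⟨Finset.sdiff_disjoint,
        hdP.mono Finset.sdiff_subset hPr⟩) (hdQ.mono_right hQr)
      rwa [← Finset.union_assoc, Finset.sdiff_union_of_subset (by simpa using hx.1)] at this
  · have hN : s * s + 1 ≤ t * t := by nlinarith
    obtain ⟨N, hN⟩ := Nat.exists_eq_add_of_le hN
    have hNt : (N + 1) * t ≤ t ^ 3 := by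
      rw [pow_succ, pow_two]; gcongr; omega
    have hNs : N * (s - 1) ≤ N * t := by gcongr
    have hN1 : N ≤ N * t := Nat.le_mul_of_pos_right _ (by omega)
    have hNt' : N * t + t ≤ t ^ 3 := by rw [← Nat.succ_mul]; exact hNt
    have h1 := many hP' cP₀' cP' (hl.many (by omega) cP₀'.le cQ₀.le)
    obtain ⟨X, hX, cX⟩ := Finset.exists_subset_card_eq
      (s := P'.filter fun a => d ≤ nbr R a Q₀) (n := N) (by omega)
    have hXP : X ⊆ P' := hX.trans (Finset.filter_subset _ _)
    obtain ⟨Pr, hPr, Qr, hQr, cPr, cQr, hT⟩ := exists_carve (R := R) (s := s) (t := t) (F := X)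
      (P := P) (Q := Q) (μ := 0) (f := N) hs (hdP.symm.mono_left hXP)
      (fun b hb => (hj.flip.miss_eq hb).le) cX.le (by
        intro y hy
        have h3 := (Finset.mem_filter.1 (hX hy)).2
        have h4 := lossP (x := y)
        omega) (by omega)
    rw [cX] at cPr cQr
    refine ⟨P' \ X, Finset.sdiff_subset, Q', subset_rfl, ?_, ?_, ?_, ?_⟩
    · rw [Finset.card_sdiff_of_subset hXP]
      have : N ≤ t ^ 3 := by omega
      omega
    · omega
    · refine ⟨s, -t, ?_, ?_⟩
      · rw [Finset.cast_card_sdiff hXP, cX]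
        zify at hN
        linarith
      · ring
    · have e1 : (P \ Pr).card + N * (s - 1) = P.card := by
        rw [← cPr, Finset.card_sdiff_add_card_eq_card hPr]
      have e2 : (Q \ Qr).card + N * t = Q.card := by
        rw [← cQr, Finset.card_sdiff_add_card_eq_card hQr]
      have hT' : Tileable R s t (P \ Pr) (Q \ Qr) := by
        refine (hj.mono Finset.sdiff_subset Finset.sdiff_subset).tileable hst ?_ ?_ ?_
        · obtain ⟨x, y, hx, hy⟩ := hlat
          zify [hs] at e1 e2 hN
          exact ⟨x - N - s, y + t, by linear_combination e1 + hx - hN, by linear_combination e2 + hy⟩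
        · have i1 : s * (P \ Pr).card ≤ s * h := by gcongr; omega
          have i2 : t * h ≤ t * ((Q \ Qr).card + (c + t ^ 3)) := by gcongr; omega
          linarith
        · have i1 : s * (Q \ Qr).card ≤ s * h := by gcongr; omega
          have i2 : t * h ≤ t * ((P \ Pr).card + (c + t ^ 3)) := by gcongr; omega
          linarith
      rw [Finset.sdiff_sdiff_eq_self hXP, Finset.sdiff_self, Finset.union_empty]
      have := hT'.union hT (Finset.disjoint_union_right.2
        ⟨hdP.mono Finset.sdiff_subset hXP, Finset.sdiff_disjoint⟩) Finset.sdiff_disjoint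
      rwa [Finset.union_comm X, ← Finset.union_assoc, Finset.sdiff_union_of_subset hPr,
        Finset.sdiff_union_of_subset hQr] at this

end Push

section Absorb

set_option linter.unusedSectionVars false
set_option linter.unusedDecidableInType false

variable {α β : Type} [DecidableEq α] [DecidableEq β]

/-- Disjoint complete pairs `(P i, Q i)` of size `(h, h)`. -/
structure Clusters (R : α → β → Prop) (h : ℕ) (I : Finset ℕ) (P : ℕ → Finset α)
    (Q : ℕ → Finset β) : Prop where
  card_left : ∀ i ∈ I, (P i).card = h
  card_right : ∀ i ∈ I, (Q i).card = h
  joined : ∀ i ∈ I, Joined R (P i) (Q i)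
  disj_left : ∀ i ∈ I, ∀ j ∈ I, i ≠ j → Disjoint (P i) (P j)
  disj_right : ∀ i ∈ I, ∀ j ∈ I, i ≠ j → Disjoint (Q i) (Q j)

/-- The clusters `i` and `j` are linked in one of the two directions. -/
def Linked (R : α → β → Prop) (d h : ℕ) (P : ℕ → Finset α) (Q : ℕ → Finset β) (i j : ℕ) : Prop :=
  Link R d h (P i) (Q j) ∨ Link R d h (P j) (Q i)

/-- From every vertex of `A` one reaches any cluster `z` in at most two links, even after
discarding `r` clusters. -/
def Conn (R : α → β → Prop) (d h r : ℕ) (I₀ : Finset ℕ) (P : ℕ → Finset α) (Q : ℕ → Finset β)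
    (A : Finset α) : Prop :=
  ∀ I ⊆ I₀, (I₀ \ I).card ≤ r → ∀ z ∈ I₀, z ∉ I → ∀ v ∈ A, ∃ i ∈ I, d ≤ nbr R v (Q i) ∧
    (Linked R d h P Q i z ∨ ∃ j ∈ I, j ≠ i ∧ Linked R d h P Q i j ∧ Linked R d h P Q j z)

variable {R : α → β → Prop} {s t : ℕ}

theorem Clusters.flip {h : ℕ} {I : Finset ℕ} {P : ℕ → Finset α} {Q : ℕ → Finset β}
    (H : Clusters R h I P Q) : Clusters (flip R) h I Q P :=
  ⟨H.card_right, H.card_left, fun i hi => (H.joined i hi).flip, H.disj_right, H.disj_left⟩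

theorem Clusters.mono {h : ℕ} {I J : Finset ℕ} {P : ℕ → Finset α} {Q : ℕ → Finset β}
    (H : Clusters R h I P Q) (hJ : J ⊆ I) : Clusters R h J P Q :=
  ⟨fun i hi => H.card_left i (hJ hi), fun i hi => H.card_right i (hJ hi),
    fun i hi => H.joined i (hJ hi), fun i hi j hj => H.disj_left i (hJ hi) j (hJ hj),
    fun i hi j hj => H.disj_right i (hJ hi) j (hJ hj)⟩

theorem Clusters.tileable {h : ℕ} {I : Finset ℕ} {P : ℕ → Finset α} {Q : ℕ → Finset β}
    (H : Clusters R h I P Q) (hst : s < t) (hh : s + t ∣ h) :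
    Tileable R s t (I.biUnion P) (I.biUnion Q) := by
  induction I using Finset.induction_on with
  | empty => simpa using Tileable.empty
  | @insert i I hi ih =>
    rw [Finset.biUnion_insert, Finset.biUnion_insert]
    have c1 := H.card_left i (Finset.mem_insert_self _ _)
    have c2 := H.card_right i (Finset.mem_insert_self _ _)
    refine Tileable.union ((H.joined i (Finset.mem_insert_self _ _)).tileable hst ?_ ?_ ?_)
      (ih (H.mono (Finset.subset_insert _ _))) ?_ ?_
    · rw [c1, c2]; exact inLat_self (by exact_mod_cast hh)
    · rw [c1, c2]; gcongr
    · rw [c1, c2]; gcongr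
    · rw [Finset.disjoint_biUnion_right]
      exact fun j hj => H.disj_left i (Finset.mem_insert_self _ _) j (Finset.mem_insert_of_mem hj)
        (by rintro rfl; exact hi hj)
    · rw [Finset.disjoint_biUnion_right]
      exact fun j hj => H.disj_right i (Finset.mem_insert_self _ _) j (Finset.mem_insert_of_mem hj)
        (by rintro rfl; exact hi hj)

/-- A single vertex is absorbed, using at most two further clusters, at the expense of a lattice
defect in the partially used cluster `z`. -/
theorem absorb_vertex {d h c K : ℕ} (hs : 1 ≤ s) (hst : s < t) (htc : t ≤ c)
    (hK : c + 2 * t ^ 3 ≤ K) (hd : K ≤ d) (hh : t * (K + 1) ≤ h) (hdvd : s + t ∣ h)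
    {I₀ I : Finset ℕ} {P : ℕ → Finset α} {Q : ℕ → Finset β} (H : Clusters R h I₀ P Q)
    (hI : I ⊆ I₀) {z : ℕ} (hz : z ∈ I₀) (hzI : z ∉ I) {P' : Finset α} {Q' : Finset β}
    (hP' : P' ⊆ P z) (hQ' : Q' ⊆ Q z) (cP' : h ≤ P'.card + c) (cQ' : h ≤ Q'.card + c)
    {v : α} (hv : v ∉ I₀.biUnion P)
    (hconn : ∃ i ∈ I, d ≤ nbr R v (Q i) ∧ (Linked R d h P Q i z ∨
      ∃ j ∈ I, j ≠ i ∧ Linked R d h P Q i j ∧ Linked R d h P Q j z)) :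
    ∃ P'' ⊆ P', ∃ Q'' ⊆ Q', h ≤ P''.card + (c + 2 * t ^ 3) ∧ h ≤ Q''.card + (c + 2 * t ^ 3) ∧
      InLat s t (P''.card - P'.card - 1) (Q''.card - Q'.card) ∧
      ∃ J ⊆ I, J.card ≤ 2 ∧
        Tileable R s t (insert v (J.biUnion P) ∪ (P' \ P'')) (J.biUnion Q ∪ (Q' \ Q'')) := by
  obtain ⟨i, hi, hvi, hl⟩ := hconn
  have hi₀ := hI hi
  have ht3 : t ≤ t ^ 3 := Nat.le_self_pow (by omega) t
  have hhK : K + 1 ≤ h := le_trans (Nat.le_mul_of_pos_left _ (by omega)) hh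
  have ci := H.card_left i hi₀
  have ci' := H.card_right i hi₀
  have hv' : ∀ j ∈ I₀, v ∉ P j := fun j hj h1 => hv (Finset.mem_biUnion.2 ⟨j, hj, h1⟩)
  have hiz : i ≠ z := by rintro rfl; exact hzI hi
  obtain ⟨Pr, hPr, Qr, hQr, cPr, cQr, hT⟩ := exists_carve (R := R) (s := s) (t := t) (F := {v})
    (P := P i) (Q := Q i) (μ := 0) (f := 1) hs (by simpa using hv' i hi₀)
    (fun b hb => ((H.joined i hi₀).flip.miss_eq hb).le) (by simp) (by
      intro y hy
      rw [Finset.mem_singleton] at hy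
      subst hy
      omega) (by omega)
  rw [Finset.card_singleton, Nat.one_mul] at cPr cQr
  have dP : ({v} ∪ Pr) ∪ (P i \ Pr) = insert v (P i) := by
    rw [Finset.union_assoc, Finset.union_sdiff_of_subset hPr]; rfl
  have dQ : Qr ∪ (Q i \ Qr) = Q i := Finset.union_sdiff_of_subset hQr
  have hlat : InLat s t ((P i \ Pr).card - 1) (Q i \ Qr).card := by
    rw [Finset.cast_card_sdiff hPr, Finset.cast_card_sdiff hQr, cPr, cQr, ci, ci']
    obtain ⟨m, hm⟩ := hdvd
    refine ⟨m - 1, m, ?_, ?_⟩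
    · zify [hs] at hm ⊢; rw [hm]; ring
    · zify at hm ⊢; rw [hm]; ring
  have kP : h ≤ (P i \ Pr).card + c := by
    rw [Finset.card_sdiff_of_subset hPr]; omega
  have kQ : h ≤ (Q i \ Qr).card + c := by
    rw [Finset.card_sdiff_of_subset hQr]; omega
  have hjz : Joined R P' Q' := (H.joined z hz).mono hP' hQ'
  have hji : Joined R (P i \ Pr) (Q i \ Qr) :=
    (H.joined i hi₀).mono Finset.sdiff_subset Finset.sdiff_subset
  rcases hl with hl | ⟨j, hj, hji', hl1, hl2⟩
  · obtain ⟨P'', hP'', Q'', hQ'', c1, c2, hlat', hT'⟩ := push (c := c) hs hst (by omega) hd hh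
      (Finset.sdiff_subset (t := Pr)) (Finset.sdiff_subset (t := Qr)) hP' hQ' ci ci'
      (H.card_left z hz) (H.card_right z hz) kP kQ cP' cQ' hji hjz
      ((H.disj_left i hi₀ z hz hiz).mono Finset.sdiff_subset hP')
      ((H.disj_right i hi₀ z hz hiz).mono Finset.sdiff_subset hQ') hl hlat
    refine ⟨P'', hP'', Q'', hQ'', by omega, by omega, hlat', {i}, by simpa using hi, by simp, ?_⟩
    have hu := hT.union hT'
      (by
        rw [Finset.disjoint_union_right, Finset.disjoint_union_left, Finset.disjoint_union_left]
        refine ⟨⟨?_, Finset.disjoint_sdiff⟩, ?_, ?_⟩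
        · rw [Finset.disjoint_singleton_left]; exact fun h1 => hv' i hi₀ (Finset.sdiff_subset h1)
        · rw [Finset.disjoint_singleton_left]
          exact fun h1 => hv' z hz (hP' (Finset.sdiff_subset h1))
        · exact (H.disj_left i hi₀ z hz hiz).mono hPr (Finset.sdiff_subset.trans hP'))
      (by
        rw [Finset.disjoint_union_right]
        exact ⟨Finset.disjoint_sdiff,
          (H.disj_right i hi₀ z hz hiz).mono hQr (Finset.sdiff_subset.trans hQ')⟩)
    rw [← Finset.union_assoc, ← Finset.union_assoc, dP, dQ] at hu
    simpa using hu
  · have hj₀ := hI hj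
    have hjz' : j ≠ z := by rintro rfl; exact hzI hj
    obtain ⟨P₂, hP₂, Q₂, hQ₂, c1, c2, hlat', hT'⟩ := push (c := c) hs hst (by omega) hd hh
      (Finset.sdiff_subset (t := Pr)) (Finset.sdiff_subset (t := Qr))
      (subset_refl (P j)) (subset_refl (Q j)) ci ci'
      (H.card_left j hj₀) (H.card_right j hj₀) kP kQ (by rw [H.card_left j hj₀]; omega)
      (by rw [H.card_right j hj₀]; omega) hji (H.joined j hj₀)
      ((H.disj_left i hi₀ j hj₀ hji'.symm).mono Finset.sdiff_subset subset_rfl)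
      ((H.disj_right i hi₀ j hj₀ hji'.symm).mono Finset.sdiff_subset subset_rfl) hl1 hlat
    obtain ⟨P'', hP'', Q'', hQ'', c3, c4, hlat'', hT''⟩ := push (c := c + t ^ 3) hs hst
      (by omega) hd hh hP₂ hQ₂ hP' hQ' (H.card_left j hj₀) (H.card_right j hj₀)
      (H.card_left z hz) (H.card_right z hz) c1 c2 (by omega) (by omega)
      ((H.joined j hj₀).mono hP₂ hQ₂) hjz ((H.disj_left j hj₀ z hz hjz').mono hP₂ hP')
      ((H.disj_right j hj₀ z hz hjz').mono hQ₂ hQ') hl2 (by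
        have := hlat'.add (inLat_self (s := s) (t := t) (p := h) (by exact_mod_cast hdvd))
        rw [H.card_left j hj₀, H.card_right j hj₀] at this
        convert this using 1 <;> ring)
    refine ⟨P'', hP'', Q'', hQ'', by omega, by omega, hlat'', {i, j}, ?_, Finset.card_le_two, ?_⟩
    · intro x hx
      rw [Finset.mem_insert, Finset.mem_singleton] at hx
      rcases hx with rfl | rfl <;> assumption
    · have hu := hT.union hT'
        (by
          rw [Finset.disjoint_union_right, Finset.disjoint_union_left, Finset.disjoint_union_left]
          refine ⟨⟨?_, Finset.disjoint_sdiff⟩, ?_, ?_⟩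
          · rw [Finset.disjoint_singleton_left]; exact fun h1 => hv' i hi₀ (Finset.sdiff_subset h1)
          · rw [Finset.disjoint_singleton_left]
            exact fun h1 => hv' j hj₀ (Finset.sdiff_subset h1)
          · exact (H.disj_left i hi₀ j hj₀ hji'.symm).mono hPr Finset.sdiff_subset)
        (by
          rw [Finset.disjoint_union_right]
          exact ⟨Finset.disjoint_sdiff,
            (H.disj_right i hi₀ j hj₀ hji'.symm).mono hQr Finset.sdiff_subset⟩)
      rw [← Finset.union_assoc, ← Finset.union_assoc, dP, dQ] at hu
      have hu' := hu.union hT''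
        (by
          rw [Finset.disjoint_union_right, Finset.disjoint_union_left, Finset.disjoint_union_left,
            Finset.disjoint_insert_left, Finset.disjoint_insert_left]
          refine ⟨⟨⟨fun h1 => hv' j hj₀ (hP₂ h1), (H.disj_left i hi₀ j hj₀ hji'.symm).mono_right hP₂⟩,
            Finset.sdiff_disjoint⟩, ⟨fun h1 => hv' z hz (hP' (Finset.sdiff_subset h1)), ?_⟩, ?_⟩
          · exact (H.disj_left i hi₀ z hz hiz).mono_right (Finset.sdiff_subset.trans hP')
          · exact (H.disj_left j hj₀ z hz hjz').mono Finset.sdiff_subset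
              (Finset.sdiff_subset.trans hP'))
        (by
          rw [Finset.disjoint_union_right, Finset.disjoint_union_left, Finset.disjoint_union_left]
          refine ⟨⟨(H.disj_right i hi₀ j hj₀ hji'.symm).mono_right hQ₂,
            Finset.sdiff_disjoint⟩, ?_, ?_⟩
          · exact (H.disj_right i hi₀ z hz hiz).mono_right (Finset.sdiff_subset.trans hQ')
          · exact (H.disj_right j hj₀ z hz hjz').mono Finset.sdiff_subset
              (Finset.sdiff_subset.trans hQ'))
      have e1 : insert v (P i) ∪ P j \ P₂ ∪ (P₂ ∪ P' \ P'') =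
          insert v (({i, j} : Finset ℕ).biUnion P) ∪ P' \ P'' := by
        rw [Finset.biUnion_insert, Finset.singleton_biUnion, Finset.union_assoc,
          ← Finset.union_assoc (P j \ P₂), Finset.sdiff_union_of_subset hP₂, ← Finset.union_assoc,
          Finset.insert_union]
      have e2 : Q i ∪ Q j \ Q₂ ∪ (Q₂ ∪ Q' \ Q'') =
          ({i, j} : Finset ℕ).biUnion Q ∪ Q' \ Q'' := by
        rw [Finset.biUnion_insert, Finset.singleton_biUnion, Finset.union_assoc,
          ← Finset.union_assoc (Q j \ Q₂), Finset.sdiff_union_of_subset hQ₂, ← Finset.union_assoc]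
      rwa [e1, e2] at hu'

end Absorb

section AbsorbSet

set_option linter.unusedSectionVars false
set_option linter.unusedDecidableInType false

variable {α β : Type} [DecidableEq α] [DecidableEq β] {R : α → β → Prop} {s t : ℕ}

theorem disjoint_biUnion_of_disjoint {I₀ J J' : Finset ℕ} {P : ℕ → Finset α}
    (H : ∀ i ∈ I₀, ∀ j ∈ I₀, i ≠ j → Disjoint (P i) (P j)) (hJ : J ⊆ I₀) (hJ' : J' ⊆ I₀)
    (hd : Disjoint J J') : Disjoint (J.biUnion P) (J'.biUnion P) := by
  rw [Finset.disjoint_biUnion_left]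
  intro i hi
  rw [Finset.disjoint_biUnion_right]
  exact fun j hj => H i (hJ hi) j (hJ' hj) (fun h => Finset.disjoint_left.1 hd hi (h ▸ hj))

theorem disjoint_biUnion_of_notMem {I₀ J : Finset ℕ} {P : ℕ → Finset α}
    (H : ∀ i ∈ I₀, ∀ j ∈ I₀, i ≠ j → Disjoint (P i) (P j)) (hJ : J ⊆ I₀) {z : ℕ} (hz : z ∈ I₀)
    (hd : z ∉ J) : Disjoint (J.biUnion P) (P z) := by
  rw [Finset.disjoint_biUnion_left]
  exact fun i hi => H i (hJ hi) z hz (fun h => hd (h ▸ hi))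

theorem union_insert_union_eq (v : α) (W J S J' T : Finset α) :
    W ∪ J ∪ S ∪ (insert v J' ∪ T) = insert v W ∪ (J ∪ J') ∪ (S ∪ T) := by
  rw [Finset.insert_eq, Finset.insert_eq]
  ac_rfl

theorem absorb_set {d h c K r : ℕ} (hs : 1 ≤ s) (hst : s < t) (htc : t ≤ c)
    (hd : K ≤ d) (hh : t * (K + 1) ≤ h) (hdvd : s + t ∣ h)
    {I₀ I : Finset ℕ} {P : ℕ → Finset α} {Q : ℕ → Finset β} (H : Clusters R h I₀ P Q)
    (hI : I ⊆ I₀) {z : ℕ} (hz : z ∈ I₀) (hzI : z ∉ I) {P' : Finset α} {Q' : Finset β}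
    (hP' : P' ⊆ P z) (hQ' : Q' ⊆ Q z) (cP' : h ≤ P'.card + c) (cQ' : h ≤ Q'.card + c)
    {A W : Finset α} (hconn : Conn R d h r I₀ P Q A) (hWA : W ⊆ A)
    (hW : Disjoint W (I₀.biUnion P)) (hK : c + 2 * t ^ 3 * W.card ≤ K)
    (hr : (I₀ \ I).card + 2 * W.card ≤ r) :
    ∃ P'' ⊆ P', ∃ Q'' ⊆ Q', h ≤ P''.card + (c + 2 * t ^ 3 * W.card) ∧
      h ≤ Q''.card + (c + 2 * t ^ 3 * W.card) ∧
      InLat s t (P''.card - P'.card - W.card) (Q''.card - Q'.card) ∧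
      ∃ J ⊆ I, J.card ≤ 2 * W.card ∧
        Tileable R s t (W ∪ J.biUnion P ∪ (P' \ P'')) (J.biUnion Q ∪ (Q' \ Q'')) := by
  induction W using Finset.induction_on with
  | empty =>
    exact ⟨P', subset_rfl, Q', subset_rfl, by simpa using cP', by simpa using cQ',
      ⟨0, 0, by simp⟩, ∅, by simp, by simp, by simpa using Tileable.empty⟩
  | @insert v W hv ih =>
    rw [Finset.card_insert_of_notMem hv] at *
    rw [Finset.disjoint_insert_left] at hW
    rw [Nat.mul_add, Nat.mul_one] at hK
    obtain ⟨P₁, hP₁, Q₁, hQ₁, c1, c2, hlat, J, hJ, cJ, hT⟩ :=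
      ih ((Finset.subset_insert _ _).trans hWA) hW.2 (by omega) (by omega)
    have hsub : I \ J ⊆ I₀ := Finset.sdiff_subset.trans hI
    have hcard : (I₀ \ (I \ J)).card ≤ (I₀ \ I).card + J.card := by
      refine (Finset.card_le_card ?_).trans (Finset.card_union_le (I₀ \ I) J)
      intro x hx
      simp only [Finset.mem_sdiff, Finset.mem_union] at hx ⊢
      tauto
    have hzJ : z ∉ I \ J := fun h1 => hzI (Finset.sdiff_subset h1)
    have hco := hconn (I \ J) hsub (by omega) z hz hzJ v (hWA (Finset.mem_insert_self _ _))
    obtain ⟨P₂, hP₂, Q₂, hQ₂, c3, c4, hlat', J', hJ', cJ', hT'⟩ := absorb_vertex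
      (c := c + 2 * t ^ 3 * W.card) hs hst (by omega)
      (by omega) hd hh hdvd H hsub hz hzJ (hP₁.trans hP') (hQ₁.trans hQ') c1 c2 hW.1 hco
    have hJ₀ := hJ.trans hI
    have hJ₀' := hJ'.trans hsub
    have hJJ' : Disjoint J J' := Finset.disjoint_sdiff.mono_right hJ'
    refine ⟨P₂, hP₂.trans hP₁, Q₂, hQ₂.trans hQ₁, by lia, by lia, ?_, J ∪ J',
      Finset.union_subset hJ (hJ'.trans Finset.sdiff_subset), ?_, ?_⟩
    · convert hlat.add hlat' using 1
      · push_cast; ring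
      · ring
    · exact (Finset.card_union_le _ _).trans (by omega)
    · have k1 : ∀ {J₁ : Finset ℕ}, J₁ ⊆ I₀ → v ∉ J₁.biUnion P := fun hJ₁ h1 =>
        hW.1 (Finset.biUnion_subset_biUnion_of_subset_left _ hJ₁ h1)
      have k2 : P' ⊆ I₀.biUnion P := hP'.trans (Finset.subset_biUnion_of_mem _ hz)
      have a1 := hW.2.mono_right (Finset.biUnion_subset_biUnion_of_subset_left P hJ₀')
      have a2 := k1 hJ₀
      have a3 := disjoint_biUnion_of_disjoint H.disj_left hJ₀ hJ₀' hJJ'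
      have a4 : v ∉ P' \ P₁ := fun h1 => hW.1 (k2 (Finset.sdiff_subset h1))
      have a5 : Disjoint (P' \ P₁) (J'.biUnion P) :=
        (disjoint_biUnion_of_notMem H.disj_left hJ₀' hz (fun h1 => hzJ (hJ' h1))).symm.mono_left
          (Finset.sdiff_subset.trans hP')
      have a6 : Disjoint W (P₁ \ P₂) :=
        hW.2.mono_right (Finset.sdiff_subset.trans (hP₁.trans k2))
      have a7 : Disjoint (J.biUnion P) (P₁ \ P₂) :=
        (disjoint_biUnion_of_notMem H.disj_left hJ₀ hz (fun h1 => hzI (hJ h1))).mono_right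
          (Finset.sdiff_subset.trans (hP₁.trans hP'))
      have a8 : Disjoint (P' \ P₁) (P₁ \ P₂) := Finset.sdiff_disjoint.mono_right Finset.sdiff_subset
      have b1 := disjoint_biUnion_of_disjoint H.disj_right hJ₀ hJ₀' hJJ'
      have b2 : Disjoint (Q' \ Q₁) (J'.biUnion Q) :=
        (disjoint_biUnion_of_notMem H.disj_right hJ₀' hz (fun h1 => hzJ (hJ' h1))).symm.mono_left
          (Finset.sdiff_subset.trans hQ')
      have b3 : Disjoint (J.biUnion Q) (Q₁ \ Q₂) :=
        (disjoint_biUnion_of_notMem H.disj_right hJ₀ hz (fun h1 => hzI (hJ h1))).mono_right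
          (Finset.sdiff_subset.trans (hQ₁.trans hQ'))
      have b4 : Disjoint (Q' \ Q₁) (Q₁ \ Q₂) := Finset.sdiff_disjoint.mono_right Finset.sdiff_subset
      have hu := hT.union hT'
        (by simp only [Finset.disjoint_union_left, Finset.disjoint_union_right,
              Finset.disjoint_insert_right, Finset.mem_union, hv, a1, a2, a3, a4, a5, a6, a7, a8,
              or_self, not_false_eq_true, and_self])
        (by simp only [Finset.disjoint_union_left, Finset.disjoint_union_right, b1, b2, b3, b4,
              and_self])
      have e1 : W ∪ J.biUnion P ∪ P' \ P₁ ∪ (insert v (J'.biUnion P) ∪ P₁ \ P₂) =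
          insert v W ∪ (J ∪ J').biUnion P ∪ P' \ P₂ := by
        rw [union_insert_union_eq, Finset.sdiff_union_sdiff_cancel hP₁ hP₂, Finset.union_biUnion]
      have e2 : J.biUnion Q ∪ Q' \ Q₁ ∪ (J'.biUnion Q ∪ Q₁ \ Q₂) =
          (J ∪ J').biUnion Q ∪ Q' \ Q₂ := by
        rw [Finset.union_union_union_comm, Finset.sdiff_union_sdiff_cancel hQ₁ hQ₂,
          Finset.union_biUnion]
      rwa [e1, e2] at hu

set_option maxHeartbeats 1000000 in
/-- All leftover vertices can be absorbed by the clusters. -/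
theorem absorb_leftover {d h K r : ℕ} (hs : 1 ≤ s) (hst : s < t)
    (hK : t + 4 * t ^ 3 * (s + t) ≤ K) (hd : K ≤ d) (hh : t * (K + 1) ≤ h) (hdvd : s + t ∣ h)
    {I₀ : Finset ℕ} {P : ℕ → Finset α} {Q : ℕ → Finset β} (H : Clusters R h I₀ P Q)
    {A : Finset α} {B : Finset β} (hcA : Conn R d h r I₀ P Q A)
    (hcB : Conn (flip R) d h r I₀ Q P B) (hr : r ≤ I₀.card) (g : ℕ) :
    ∀ {I : Finset ℕ} {UA : Finset α} {UB : Finset β}, I ⊆ I₀ → UA ⊆ A → UB ⊆ B →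
      Disjoint UA (I₀.biUnion P) → Disjoint UB (I₀.biUnion Q) → UA.card = (s + t) * g →
      UB.card = (s + t) * g → (I₀ \ I).card + (4 * (s + t) + 1) * g ≤ r →
      Tileable R s t (UA ∪ I.biUnion P) (UB ∪ I.biUnion Q) := by
  induction g with
  | zero =>
    intro I UA UB hI _ _ _ _ hA hB _
    simp only [Nat.mul_zero, Finset.card_eq_zero] at hA hB
    subst hA hB
    simpa using (H.mono hI).tileable hst hdvd
  | succ g ih =>
    intro I UA UB hI hUA hUB hdA hdB hA hB hIr
    rw [Nat.mul_add, Nat.mul_one] at hA hB hIr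
    have hIc := Finset.card_sdiff_add_card_eq_card hI
    obtain ⟨z, hz⟩ : I.Nonempty := by rw [← Finset.card_pos]; omega
    obtain ⟨WA, hWA, cWA⟩ := Finset.exists_subset_card_eq (s := UA) (n := s + t) (by omega)
    obtain ⟨WB, hWB, cWB⟩ := Finset.exists_subset_card_eq (s := UB) (n := s + t) (by omega)
    have sub : ∀ {X Y : Finset ℕ}, (I₀ \ (X \ Y)).card ≤ (I₀ \ X).card + Y.card := by
      intro X Y
      refine (Finset.card_le_card ?_).trans (Finset.card_union_le (I₀ \ X) Y)
      intro x hx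
      simp only [Finset.mem_sdiff, Finset.mem_union] at hx ⊢
      tauto
    have hI₁ : I \ {z} ⊆ I₀ := Finset.sdiff_subset.trans hI
    have hc₁ := sub (X := I) (Y := {z})
    rw [Finset.card_singleton] at hc₁
    have hz₁ : z ∉ I \ {z} := by simp
    have cz := H.card_left z (hI hz)
    have cz' := H.card_right z (hI hz)
    have hKt : t + 2 * t ^ 3 * (s + t) + 2 * t ^ 3 * (s + t) ≤ K := by linarith
    obtain ⟨P₁, hP₁, Q₁, hQ₁, c1, c2, hlat, J, hJ, cJ, hT⟩ := absorb_set (c := t) (W := WA) hs hst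
      le_rfl hd hh hdvd H hI₁ (hI hz) hz₁ subset_rfl subset_rfl (by omega) (by omega) hcA
      (hWA.trans hUA) (hdA.mono_left hWA) (by rw [cWA]; omega) (by rw [cWA]; omega)
    rw [cWA] at c1 c2 hlat cJ
    have hI₂ : (I \ {z}) \ J ⊆ I₀ := Finset.sdiff_subset.trans hI₁
    have hc₂ := sub (X := I \ {z}) (Y := J)
    have hz₂ : z ∉ (I \ {z}) \ J := by simp
    obtain ⟨Q₂, hQ₂, P₂, hP₂, c3, c4, hlat', J', hJ', cJ', hT'⟩ := absorb_set
      (c := t + 2 * t ^ 3 * (s + t)) (W := WB) hs hst (by omega) hd hh hdvd H.flip hI₂ (hI hz) hz₂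
      hQ₁ hP₁ c2 c1 hcB (hWB.trans hUB) (hdB.mono_left hWB) (by rw [cWB]; omega)
      (by rw [cWB]; omega)
    rw [cWB] at c3 c4 hlat' cJ'
    have hJ₀ := hJ.trans hI₁
    have hJ₀' := hJ'.trans hI₂
    have hJJ' : Disjoint J J' := Finset.disjoint_sdiff.mono_right hJ'
    have hzJ : z ∉ J := fun h1 => hz₁ (hJ h1)
    have hzJ' : z ∉ J' := fun h1 => hz₂ (hJ' h1)
    have hlast : Tileable R s t P₂ Q₂ := by
      refine ((H.joined z (hI hz)).mono (hP₂.trans hP₁) (hQ₂.trans hQ₁)).tileable hst ?_ ?_ ?_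
      · have e := (hlat.add hlat'.swap).add (inLat_self (s := s) (t := t) (p := h + (s + t))
          (dvd_add (by exact_mod_cast hdvd) dvd_rfl))
        rw [cz, cz'] at e
        convert e using 1 <;> push_cast <;> ring
      · have i0 : (s + 1) * h ≤ t * h := by gcongr; omega
        have i1 : s * P₂.card ≤ s * h := by
          gcongr; rw [← cz]; exact Finset.card_le_card (hP₂.trans hP₁)
        have i2 : t * h ≤ t * (Q₂.card + K) := by gcongr; omega
        linarith
      · have i0 : (s + 1) * h ≤ t * h := by gcongr; omega
        have i1 : s * Q₂.card ≤ s * h := by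
          gcongr; rw [← cz']; exact Finset.card_le_card (hQ₂.trans hQ₁)
        have i2 : t * h ≤ t * (P₂.card + K) := by gcongr; omega
        linarith
    have k2 := Finset.subset_biUnion_of_mem P (hI hz)
    have k3 := Finset.subset_biUnion_of_mem Q (hI hz)
    have kA := hdA.mono_left hWA
    have kB := hdB.mono_left hWB
    have a1 := kA.mono_right (Finset.biUnion_subset_biUnion_of_subset_left P hJ₀')
    have a2 := disjoint_biUnion_of_disjoint H.disj_left hJ₀ hJ₀' hJJ'
    have m1 := disjoint_biUnion_of_notMem H.disj_left hJ₀ (hI hz) hzJ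
    have m2 := disjoint_biUnion_of_notMem H.disj_left hJ₀' (hI hz) hzJ'
    have a3 : Disjoint (P z \ P₁) (J'.biUnion P) := m2.symm.mono_left Finset.sdiff_subset
    have a4 : Disjoint WA (P₁ \ P₂) := kA.mono_right (Finset.sdiff_subset.trans (hP₁.trans k2))
    have a5 : Disjoint (J.biUnion P) (P₁ \ P₂) := m1.mono_right (Finset.sdiff_subset.trans hP₁)
    have a6 : Disjoint (P z \ P₁) (P₁ \ P₂) := Finset.sdiff_disjoint.mono_right Finset.sdiff_subset
    have a7 : Disjoint WA P₂ := kA.mono_right (hP₂.trans (hP₁.trans k2))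
    have a8 : Disjoint (J.biUnion P) P₂ := m1.mono_right (hP₂.trans hP₁)
    have a9 : Disjoint (P z \ P₁) P₂ := Finset.sdiff_disjoint.mono_right hP₂
    have a10 : Disjoint (J'.biUnion P) P₂ := m2.mono_right (hP₂.trans hP₁)
    have a11 : Disjoint (P₁ \ P₂) P₂ := Finset.sdiff_disjoint
    have n1 := disjoint_biUnion_of_notMem H.disj_right hJ₀ (hI hz) hzJ
    have n2 := disjoint_biUnion_of_notMem H.disj_right hJ₀' (hI hz) hzJ'
    have b1 := (kB.mono_right (Finset.biUnion_subset_biUnion_of_subset_left Q hJ₀)).symm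
    have b2 := disjoint_biUnion_of_disjoint H.disj_right hJ₀ hJ₀' hJJ'
    have b3 : Disjoint (Q z \ Q₁) (J'.biUnion Q) := n2.symm.mono_left Finset.sdiff_subset
    have b4 : Disjoint (Q z \ Q₁) WB := (kB.mono_right (Finset.sdiff_subset.trans k3)).symm
    have b5 : Disjoint (J.biUnion Q) (Q₁ \ Q₂) := n1.mono_right (Finset.sdiff_subset.trans hQ₁)
    have b6 : Disjoint (Q z \ Q₁) (Q₁ \ Q₂) := Finset.sdiff_disjoint.mono_right Finset.sdiff_subset
    have b7 : Disjoint WB Q₂ := kB.mono_right (hQ₂.trans (hQ₁.trans k3))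
    have b8 : Disjoint (J.biUnion Q) Q₂ := n1.mono_right (hQ₂.trans hQ₁)
    have b9 : Disjoint (Q z \ Q₁) Q₂ := Finset.sdiff_disjoint.mono_right hQ₂
    have b10 : Disjoint (J'.biUnion Q) Q₂ := n2.mono_right (hQ₂.trans hQ₁)
    have b11 : Disjoint (Q₁ \ Q₂) Q₂ := Finset.sdiff_disjoint
    have hgroup := (hT.union hT'.flip
      (by simp only [Finset.disjoint_union_left, Finset.disjoint_union_right, a1, a2, a3, a4, a5,
            a6, and_self])
      (by simp only [Finset.disjoint_union_left, Finset.disjoint_union_right, b1, b2, b3, b4, b5,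
            b6, and_self])).union hlast
      (by simp only [Finset.disjoint_union_left, a7, a8, a9, a10, a11, and_self])
      (by simp only [Finset.disjoint_union_left, b7, b8, b9, b10, b11, and_self])
    set E : Finset ℕ := J ∪ J' ∪ {z} with hE
    have hEI : E ⊆ I := Finset.union_subset (Finset.union_subset (hJ.trans Finset.sdiff_subset)
      ((hJ'.trans Finset.sdiff_subset).trans Finset.sdiff_subset)) (by simpa using hz)
    have hEc : E.card ≤ 4 * (s + t) + 1 := by
      have e1 : E.card ≤ _ := Finset.card_union_le (J ∪ J') {z}
      have e2 := Finset.card_union_le J J'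
      rw [Finset.card_singleton] at e1
      omega
    have fP : P z = P z \ P₁ ∪ P₁ \ P₂ ∪ P₂ := by
      rw [Finset.sdiff_union_sdiff_cancel hP₁ hP₂, Finset.sdiff_union_of_subset (hP₂.trans hP₁)]
    have fQ : Q z = Q z \ Q₁ ∪ Q₁ \ Q₂ ∪ Q₂ := by
      rw [Finset.sdiff_union_sdiff_cancel hQ₁ hQ₂, Finset.sdiff_union_of_subset (hQ₂.trans hQ₁)]
    have e1 : WA ∪ J.biUnion P ∪ P z \ P₁ ∪ (J'.biUnion P ∪ P₁ \ P₂) ∪ P₂ =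
        WA ∪ E.biUnion P := by
      rw [hE, Finset.union_biUnion, Finset.union_biUnion, Finset.singleton_biUnion]
      nth_rw 2 [fP]
      ac_rfl
    have e2 : J.biUnion Q ∪ Q z \ Q₁ ∪ (WB ∪ J'.biUnion Q ∪ Q₁ \ Q₂) ∪ Q₂ =
        WB ∪ E.biUnion Q := by
      rw [hE, Finset.union_biUnion, Finset.union_biUnion, Finset.singleton_biUnion]
      nth_rw 2 [fQ]
      ac_rfl
    rw [e1, e2] at hgroup
    have hc₃ := sub (X := I) (Y := E)
    have hI₃ : I \ E ⊆ I₀ := Finset.sdiff_subset.trans hI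
    have hrest := ih hI₃ (Finset.sdiff_subset.trans hUA : UA \ WA ⊆ A)
      (Finset.sdiff_subset.trans hUB : UB \ WB ⊆ B) (hdA.mono_left Finset.sdiff_subset)
      (hdB.mono_left Finset.sdiff_subset) (by rw [Finset.card_sdiff_of_subset hWA]; omega)
      (by rw [Finset.card_sdiff_of_subset hWB]; omega) (by omega)
    have hE₀ := hEI.trans hI
    have hall := hrest.union hgroup
      (by
        have f1 : Disjoint (UA \ WA) WA := Finset.sdiff_disjoint
        have f2 := (hdA.mono_left (Finset.sdiff_subset (t := WA))).mono_right
          (Finset.biUnion_subset_biUnion_of_subset_left P hE₀)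
        have f3 := (kA.mono_right (Finset.biUnion_subset_biUnion_of_subset_left P hI₃)).symm
        have f4 := disjoint_biUnion_of_disjoint H.disj_left hI₃ hE₀ Finset.sdiff_disjoint
        simp only [Finset.disjoint_union_left, Finset.disjoint_union_right, f1, f2, f3, f4,
          and_self])
      (by
        have f1 : Disjoint (UB \ WB) WB := Finset.sdiff_disjoint
        have f2 := (hdB.mono_left (Finset.sdiff_subset (t := WB))).mono_right
          (Finset.biUnion_subset_biUnion_of_subset_left Q hE₀)
        have f3 := (kB.mono_right (Finset.biUnion_subset_biUnion_of_subset_left Q hI₃)).symm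
        have f4 := disjoint_biUnion_of_disjoint H.disj_right hI₃ hE₀ Finset.sdiff_disjoint
        simp only [Finset.disjoint_union_left, Finset.disjoint_union_right, f1, f2, f3, f4,
          and_self])
    have e3 : UA \ WA ∪ (I \ E).biUnion P ∪ (WA ∪ E.biUnion P) = UA ∪ I.biUnion P := by
      rw [Finset.union_union_union_comm, Finset.sdiff_union_of_subset hWA, ← Finset.union_biUnion,
        Finset.sdiff_union_of_subset hEI]
    have e4 : UB \ WB ∪ (I \ E).biUnion Q ∪ (WB ∪ E.biUnion Q) = UB ∪ I.biUnion Q := by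
      rw [Finset.union_union_union_comm, Finset.sdiff_union_of_subset hWB, ← Finset.union_biUnion,
        Finset.sdiff_union_of_subset hEI]
    rwa [e3, e4] at hall

end AbsorbSet

section NonExtremal

set_option linter.unusedSectionVars false
set_option linter.unusedDecidableInType false

variable {α β : Type} [DecidableEq α] [DecidableEq β]

/-- Up to `F` edges on each side, the pair `(A, B)` splits into two unrelated large pairs. -/
def Extremal (R : α → β → Prop) (F : ℕ) (A : Finset α) (B : Finset β) : Prop :=
  ∃ X ⊆ A, ∃ Y ⊆ B, A.card ≤ 3 * X.card ∧ A.card ≤ 3 * (A \ X).card ∧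
    B.card ≤ 3 * Y.card ∧ B.card ≤ 3 * (B \ Y).card ∧
    ∑ a ∈ X, nbr R a (B \ Y) ≤ F ∧ ∑ a ∈ A \ X, nbr R a Y ≤ F

variable {R : α → β → Prop} {s t : ℕ}

theorem Extremal.flip {F : ℕ} {A : Finset α} {B : Finset β} (H : Extremal R F A B) :
    Extremal (flip R) F B A := by
  obtain ⟨X, hX, Y, hY, h1, h2, h3, h4, h5, h6⟩ := H
  exact ⟨Y, hY, X, hX, h3, h4, h1, h2, by rwa [← sum_nbr_comm], by rwa [← sum_nbr_comm]⟩

theorem Packed.exists_clusters {h k : ℕ} {A : Finset α} {B : Finset β} (H : Packed R h k A B) :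
    ∃ P : ℕ → Finset α, ∃ Q : ℕ → Finset β, Clusters R h (Finset.range k) P Q ∧
      (Finset.range k).biUnion P = A ∧ (Finset.range k).biUnion Q = B := by
  induction H with
  | empty => exact ⟨fun _ => ∅, fun _ => ∅, ⟨by simp, by simp, by simp, by simp, by simp⟩,
      by simp, by simp⟩
  | @union_tile k A S B T _ hS hT cS cT hj ih =>
    obtain ⟨P, Q, H, hP, hQ⟩ := ih
    have e1 : (Finset.range k).biUnion (fun i => if i = k then S else P i) = A := by
      rw [← hP]
      refine Finset.biUnion_congr rfl fun i hi => ?_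
      rw [if_neg (Finset.mem_range.1 hi).ne]
    have e2 : (Finset.range k).biUnion (fun i => if i = k then T else Q i) = B := by
      rw [← hQ]
      refine Finset.biUnion_congr rfl fun i hi => ?_
      rw [if_neg (Finset.mem_range.1 hi).ne]
    have dS : ∀ i < k, Disjoint (P i) S := fun i hi =>
      hS.mono_left (hP ▸ Finset.subset_biUnion_of_mem P (Finset.mem_range.2 hi))
    have dT : ∀ i < k, Disjoint (Q i) T := fun i hi =>
      hT.mono_left (hQ ▸ Finset.subset_biUnion_of_mem Q (Finset.mem_range.2 hi))
    refine ⟨fun i => if i = k then S else P i, fun i => if i = k then T else Q i,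
      ⟨?_, ?_, ?_, ?_, ?_⟩, ?_, ?_⟩
    · intro i hi
      rw [Finset.mem_range] at hi
      split_ifs with h1
      · exact cS
      · exact H.card_left i (Finset.mem_range.2 (by omega))
    · intro i hi
      rw [Finset.mem_range] at hi
      split_ifs with h1
      · exact cT
      · exact H.card_right i (Finset.mem_range.2 (by omega))
    · intro i hi
      rw [Finset.mem_range] at hi
      split_ifs with h1
      · exact hj
      · exact H.joined i (Finset.mem_range.2 (by omega))
    · intro i hi j hj' hij
      rw [Finset.mem_range] at hi hj'
      split_ifs with h1 h2 h2
      · omega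
      · exact (dS j (by omega)).symm
      · exact dS i (by omega)
      · exact H.disj_left i (Finset.mem_range.2 (by omega)) j (Finset.mem_range.2 (by omega)) hij
    · intro i hi j hj' hij
      rw [Finset.mem_range] at hi hj'
      split_ifs with h1 h2 h2
      · omega
      · exact (dT j (by omega)).symm
      · exact dT i (by omega)
      · exact H.disj_right i (Finset.mem_range.2 (by omega)) j (Finset.mem_range.2 (by omega)) hij
    · rw [Finset.range_add_one, Finset.biUnion_insert, e1, if_pos rfl, Finset.union_comm]
    · rw [Finset.range_add_one, Finset.biUnion_insert, e2, if_pos rfl, Finset.union_comm]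

theorem Clusters.card_biUnion_left {h : ℕ} {I : Finset ℕ} {P : ℕ → Finset α} {Q : ℕ → Finset β}
    (H : Clusters R h I P Q) {S : Finset ℕ} (hS : S ⊆ I) : (S.biUnion P).card = S.card * h := by
  rw [Finset.card_biUnion fun i hi j hj => H.disj_left i (hS hi) j (hS hj)]
  exact Finset.sum_const_nat fun i hi => H.card_left i (hS hi)

theorem Clusters.card_biUnion_right {h : ℕ} {I : Finset ℕ} {P : ℕ → Finset α} {Q : ℕ → Finset β}
    (H : Clusters R h I P Q) {S : Finset ℕ} (hS : S ⊆ I) : (S.biUnion Q).card = S.card * h :=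
  H.flip.card_biUnion_left hS

theorem nbr_biUnion_le (a : α) (S : Finset ℕ) (Q : ℕ → Finset β) :
    nbr R a (S.biUnion Q) ≤ ∑ i ∈ S, nbr R a (Q i) := by
  induction S using Finset.induction_on with
  | empty => simp [nbr]
  | @insert i S hi ih =>
    rw [Finset.biUnion_insert, Finset.sum_insert hi]
    exact (nbr_union_le _ _ _).trans (by gcongr)

theorem Clusters.nbr_le {h : ℕ} {I₀ I S : Finset ℕ} {P : ℕ → Finset α} {Q : ℕ → Finset β}
    (H : Clusters R h I₀ P Q) (hI : I ⊆ I₀) (hS : S ⊆ I) {B : Finset β}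
    (hB : I₀.biUnion Q ⊆ B) (a : α) :
    nbr R a B + I₀.card * h ≤
      B.card + (I₀ \ I).card * h + ∑ j ∈ I \ S, nbr R a (Q j) + S.card * h := by
  have e : B = B \ I₀.biUnion Q ∪ ((I₀ \ I).biUnion Q ∪ ((I \ S).biUnion Q ∪ S.biUnion Q)) := by
    rw [← Finset.union_biUnion, ← Finset.union_biUnion, Finset.sdiff_union_of_subset hS,
      Finset.sdiff_union_of_subset hI, Finset.sdiff_union_of_subset hB]
  have h1 := (congrArg (nbr R a) e).le
  have h2 := nbr_union_le (R := R) a (B \ I₀.biUnion Q)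
    ((I₀ \ I).biUnion Q ∪ ((I \ S).biUnion Q ∪ S.biUnion Q))
  have h3 := nbr_union_le (R := R) a ((I₀ \ I).biUnion Q) ((I \ S).biUnion Q ∪ S.biUnion Q)
  have h4 := nbr_union_le (R := R) a ((I \ S).biUnion Q) (S.biUnion Q)
  have h5 := nbr_le_card (R := R) a (B \ I₀.biUnion Q)
  have h6 := nbr_le_card (R := R) a ((I₀ \ I).biUnion Q)
  have h7 := nbr_le_card (R := R) a (S.biUnion Q)
  have h8 := nbr_biUnion_le (R := R) a (I \ S) Q
  rw [H.card_biUnion_right Finset.sdiff_subset] at h6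
  rw [H.card_biUnion_right (hS.trans hI)] at h7
  have h9 := Finset.card_sdiff_add_card_eq_card hB
  rw [H.card_biUnion_right subset_rfl] at h9
  omega

theorem sum_nbr_le_of_unlinked {d h E : ℕ} {I₀ S D : Finset ℕ} {P : ℕ → Finset α}
    {Q : ℕ → Finset β} (H : Clusters R h I₀ P Q) (hS : S ⊆ I₀) (hD : D ⊆ I₀) (hSD : Disjoint S D)
    {B : Finset β} (hB : I₀.biUnion Q ⊆ B)
    (hun : ∀ i ∈ S, ∀ j ∈ D, ∑ a ∈ P i, nbr R a (Q j) ≤ 2 * d * h)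
    (hc : B.card ≤ S.card * h + D.card * h + 2 * E) :
    ∑ a ∈ S.biUnion P, nbr R a (B \ S.biUnion Q) ≤
      S.card * h * (2 * E) + S.card * (D.card * (2 * d * h)) := by
  have hdisj : Disjoint (S.biUnion Q) (D.biUnion Q) :=
    disjoint_biUnion_of_disjoint H.disj_right hS hD hSD
  have hDB : D.biUnion Q ⊆ B \ S.biUnion Q := Finset.subset_sdiff.2
    ⟨(Finset.biUnion_subset_biUnion_of_subset_left Q hD).trans hB, hdisj.symm⟩
  have hSB : S.biUnion Q ⊆ B := (Finset.biUnion_subset_biUnion_of_subset_left Q hS).trans hB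
  have hcard : ((B \ S.biUnion Q) \ D.biUnion Q).card ≤ 2 * E := by
    rw [Finset.card_sdiff_of_subset hDB, Finset.card_sdiff_of_subset hSB,
      H.card_biUnion_right hS, H.card_biUnion_right hD]
    omega
  have h1 : ∀ a, nbr R a (B \ S.biUnion Q) ≤ 2 * E + ∑ j ∈ D, nbr R a (Q j) := by
    intro a
    rw [← nbr_sdiff_add a hDB]
    exact Nat.add_le_add ((nbr_le_card _ _).trans hcard) (nbr_biUnion_le _ _ _)
  calc ∑ a ∈ S.biUnion P, nbr R a (B \ S.biUnion Q)
      ≤ ∑ a ∈ S.biUnion P, (2 * E + ∑ j ∈ D, nbr R a (Q j)) := Finset.sum_le_sum fun a _ => h1 a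
    _ = S.card * h * (2 * E) + ∑ a ∈ S.biUnion P, ∑ j ∈ D, nbr R a (Q j) := by
        rw [Finset.sum_add_distrib, Finset.sum_const, H.card_biUnion_left hS, smul_eq_mul]
    _ = S.card * h * (2 * E) + ∑ i ∈ S, ∑ j ∈ D, ∑ a ∈ P i, nbr R a (Q j) := by
        rw [Finset.sum_biUnion fun i hi j hj => H.disj_left i (hS hi) j (hS hj)]
        congr 1
        exact Finset.sum_congr rfl fun i _ => Finset.sum_comm
    _ ≤ S.card * h * (2 * E) + S.card * (D.card * (2 * d * h)) := by
        gcongr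
        refine Finset.sum_le_card_nsmul _ _ _ fun i hi => ?_
        exact Finset.sum_le_card_nsmul _ _ _ fun j hj => hun i hi j hj

/-- If the clusters are not well connected, then the pair is extremal. -/
theorem conn_or_extremal {n d h r E : ℕ} {I₀ : Finset ℕ} {P : ℕ → Finset α} {Q : ℕ → Finset β}
    (H : Clusters R h I₀ P Q) (hh : 0 < h) {A : Finset α} {B : Finset β} (hPA : I₀.biUnion P ⊆ A)
    (hQB : I₀.biUnion Q ⊆ B) (hA : A.card = n) (hB : B.card = n)
    (hdeg : ∀ a ∈ A, n ≤ 2 * nbr R a B)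
    (hE : n + r * h + 2 * (I₀.card * d) ≤ I₀.card * h + E) (hEn : 6 * E ≤ n) :
    Conn R d h r I₀ P Q A ∨
      Extremal R (n * (2 * E) + I₀.card * (I₀.card * (2 * d * h))) A B := by
  rw [or_iff_not_imp_left]
  intro hconn
  unfold Conn at hconn
  push Not at hconn
  obtain ⟨I, hI, hr, z, hz, hzI, v, hv, hno⟩ := hconn
  set S := I.filter fun i => d ≤ nbr R v (Q i) with hSdef
  set D := I.filter fun j => Linked R d h P Q j z with hDdef
  have hSI : S ⊆ I := Finset.filter_subset _ _
  have hDI : D ⊆ I := Finset.filter_subset _ _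
  have hSD : Disjoint S D := by
    rw [Finset.disjoint_left]
    intro i h1 h2
    rw [hSdef, Finset.mem_filter] at h1
    rw [hDdef, Finset.mem_filter] at h2
    exact (hno i h1.1 h1.2).1 h2.2
  have hun : ∀ i ∈ S, ∀ j ∈ D, ¬ Linked R d h P Q i j := by
    intro i h1 j h2 h3
    have hne : j ≠ i := by rintro rfl; exact Finset.disjoint_left.1 hSD h1 h2
    rw [hSdef, Finset.mem_filter] at h1
    rw [hDdef, Finset.mem_filter] at h2
    exact (hno i h1.1 h1.2).2 j h2.1 hne h3 h2.2
  have hrh : (I₀ \ I).card * h ≤ r * h := Nat.mul_le_mul_right _ hr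
  have hcS : n ≤ 2 * (S.card * h + E) := by
    have h1 := H.nbr_le hI hSI hQB v
    have h2 : ∑ j ∈ I \ S, nbr R v (Q j) ≤ I₀.card * d := by
      refine (Finset.sum_le_card_nsmul _ _ d fun j hj => ?_).trans
        (Nat.mul_le_mul_right _ (Finset.card_le_card (Finset.sdiff_subset.trans hI)))
      rw [Finset.mem_sdiff, hSdef, Finset.mem_filter, not_and, not_le] at hj
      exact (hj.2 hj.1).le
    have h3 := hdeg v hv
    omega
  have hcD : n ≤ 2 * (D.card * h + E) := by
    have cz := H.card_left z hz
    have h1 := Finset.sum_le_sum fun a (_ : a ∈ P z) => H.nbr_le hI hDI hQB a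
    have h2 : ∑ a ∈ P z, ∑ j ∈ I \ D, nbr R a (Q j) ≤ I₀.card * (2 * d * h) := by
      rw [Finset.sum_comm]
      refine (Finset.sum_le_card_nsmul _ _ (2 * d * h) fun j hj => ?_).trans
        (Nat.mul_le_mul_right _ (Finset.card_le_card (Finset.sdiff_subset.trans hI)))
      rw [Finset.mem_sdiff, hDdef, Finset.mem_filter, not_and] at hj
      have := hj.2 hj.1
      unfold Linked Link at this
      push Not at this
      exact this.2.le
    have h3 : h * n ≤ ∑ a ∈ P z, 2 * nbr R a B := by
      rw [← cz, ← smul_eq_mul]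
      exact Finset.card_nsmul_le_sum _ _ _ fun a ha =>
        hdeg a (hPA (Finset.mem_biUnion.2 ⟨z, hz, ha⟩))
    rw [← Finset.mul_sum] at h3
    simp only [Finset.sum_add_distrib, Finset.sum_const, smul_eq_mul, cz] at h1
    have h4 : h * n ≤ h * (2 * (D.card * h + E)) := by
      have k1 := Nat.mul_le_mul_left h hE
      have k2 := Nat.mul_le_mul_left h hrh
      rw [hB] at h1
      linarith
    exact Nat.le_of_mul_le_mul_left h4 hh
  have hS₀ := hSI.trans hI
  have hD₀ := hDI.trans hI
  have hX : S.biUnion P ⊆ A := (Finset.biUnion_subset_biUnion_of_subset_left P hS₀).trans hPA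
  have hY : S.biUnion Q ⊆ B := (Finset.biUnion_subset_biUnion_of_subset_left Q hS₀).trans hQB
  have hX' : D.biUnion P ⊆ A \ S.biUnion P := Finset.subset_sdiff.2
    ⟨(Finset.biUnion_subset_biUnion_of_subset_left P hD₀).trans hPA,
      (disjoint_biUnion_of_disjoint H.disj_left hS₀ hD₀ hSD).symm⟩
  have hY' : D.biUnion Q ⊆ B \ S.biUnion Q := Finset.subset_sdiff.2
    ⟨(Finset.biUnion_subset_biUnion_of_subset_left Q hD₀).trans hQB,
      (disjoint_biUnion_of_disjoint H.disj_right hS₀ hD₀ hSD).symm⟩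
  have cX := H.card_biUnion_left hS₀
  have cY := H.card_biUnion_right hS₀
  have cX' := Finset.card_le_card hX'
  have cY' := Finset.card_le_card hY'
  rw [H.card_biUnion_left hD₀] at cX'
  rw [H.card_biUnion_right hD₀] at cY'
  have hSn : S.card * h ≤ n := by rw [← cX, ← hA]; exact Finset.card_le_card hX
  have hfin : S.card * h * (2 * E) + S.card * (D.card * (2 * d * h)) ≤
      n * (2 * E) + I₀.card * (I₀.card * (2 * d * h)) := by
    have := Finset.card_le_card hS₀
    have := Finset.card_le_card hD₀
    gcongr
  have hun' : ∀ i ∈ S, ∀ j ∈ D, ∑ a ∈ P i, nbr R a (Q j) ≤ 2 * d * h ∧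
      ∑ b ∈ Q i, nbr (flip R) b (P j) ≤ 2 * d * h := by
    intro i hi j hj
    have h1 := hun i hi j hj
    unfold Linked Link at h1
    push Not at h1
    rw [← sum_nbr_comm]
    exact ⟨h1.1.le, h1.2.le⟩
  refine ⟨_, hX, _, hY, by omega, by omega, by omega, by omega, ?_, ?_⟩
  · exact (sum_nbr_le_of_unlinked H hS₀ hD₀ hSD hQB (fun i hi j hj => (hun' i hi j hj).1)
      (by omega)).trans hfin
  · rw [sum_nbr_comm]
    exact (sum_nbr_le_of_unlinked H.flip hS₀ hD₀ hSD hPA (fun i hi j hj => (hun' i hi j hj).2)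
      (by omega)).trans hfin

/-- A balanced pair with minimum degree `n / 2` is tileable unless it is extremal. -/
theorem tileable_or_extremal (hs : 1 ≤ s) (hst : s < t) {N : ℕ} (hN : 1 ≤ N) :
    ∃ n₀ : ℕ, ∀ (α β : Type) [DecidableEq α] [DecidableEq β] (R : α → β → Prop) (A : Finset α)
      (B : Finset β) (n : ℕ), n₀ ≤ n → A.card = n → B.card = n → s + t ∣ n →
      (∀ a ∈ A, n ≤ 2 * nbr R a B) → (∀ b ∈ B, n ≤ 2 * nbr (flip R) b A) →
      Tileable R s t A B ∨ ∃ F, N * F ≤ n ^ 2 ∧ Extremal R F A B := by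
  obtain ⟨K, hK⟩ : ∃ K, K = t + 4 * t ^ 3 * (s + t) := ⟨_, rfl⟩
  obtain ⟨D, hD⟩ : ∃ D, D = 54 * N := ⟨_, rfl⟩
  obtain ⟨h, hh⟩ : ∃ h, h = (s + t) * (t * (K + 1)) * D := ⟨_, rfl⟩
  have ht : 1 ≤ t := by omega
  have hDpos : 1 ≤ D := by omega
  have hmid : t * (K + 1) ≤ (s + t) * (t * (K + 1)) := Nat.le_mul_of_pos_left _ (by omega)
  have hKt : K ≤ t * (K + 1) := le_trans (by omega) (Nat.le_mul_of_pos_left _ ht)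
  have hhD : K * D ≤ h := by rw [hh]; exact Nat.mul_le_mul_right _ (hKt.trans hmid)
  have hhK : t * (K + 1) ≤ h := by rw [hh]; exact hmid.trans (Nat.le_mul_of_pos_right _ hDpos)
  have hpos : 0 < h := lt_of_lt_of_le (Nat.mul_pos ht (Nat.succ_pos K)) hhK
  have hdvd : s + t ∣ h := by rw [hh, Nat.mul_assoc]; exact Nat.dvd_mul_right _ _
  have hεpos : (0 : ℝ) < 1 / (h * D : ℕ) := by
    have : 0 < h * D := Nat.mul_pos hpos hDpos
    positivity
  have hε1 : (1 : ℝ) / (h * D : ℕ) ≤ 1 := by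
    have : 1 ≤ h * D := Nat.mul_pos hpos hDpos
    exact div_le_one_of_le₀ (by exact_mod_cast this) (by positivity)
  obtain ⟨n₀, hn₀⟩ := almostTile hεpos hε1 h hpos
  refine ⟨n₀, fun α β _ _ R A B n hn hA hB hdvdn hdA hdB => ?_⟩
  obtain ⟨k, A₁, hA₁, B₁, hB₁, hpack, hcov⟩ := hn₀ α β R A B n hn hA hB hdA hdB
  have hcov' : n * (h * D) ≤ h * k * (h * D) + n := by
    have hp : (0 : ℝ) < (h * D : ℕ) := by exact_mod_cast Nat.mul_pos hpos hDpos
    have h1 : ((1 : ℝ) - 1 / (h * D : ℕ)) * n * (h * D : ℕ) ≤ h * k * (h * D : ℕ) := by gcongr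
    have h2 : ((1 : ℝ) - 1 / (h * D : ℕ)) * n * (h * D : ℕ) = n * (h * D : ℕ) - n := by
      field_simp
    rw [h2] at h1
    have h3 : (n : ℝ) * (h * D : ℕ) ≤ h * k * (h * D : ℕ) + n := by linarith
    exact_mod_cast h3
  have hcA := hpack.card_left
  have hcB := hpack.card_right
  obtain ⟨P, Q, H, hPA, hQB⟩ := hpack.exists_clusters
  have hkn : h * k ≤ n := by rw [← hcA, ← hA]; exact Finset.card_le_card hA₁
  obtain ⟨g, hg⟩ : s + t ∣ n - h * k := Nat.dvd_sub hdvdn (hdvd.mul_right k)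
  have hu : (s + t) * g * (h * D) ≤ n := by
    rw [← hg, Nat.sub_mul]
    omega
  have hr5 : (4 * (s + t) + 1) * g ≤ 5 * ((s + t) * g) := by
    have : 1 * g ≤ (s + t) * g := Nat.mul_le_mul_right _ (by omega)
    linarith
  have hkK : k * K * D ≤ n := by
    refine le_trans ?_ hkn
    rw [Nat.mul_assoc, Nat.mul_comm]
    exact Nat.mul_le_mul_right _ hhD
  obtain ⟨E, hE⟩ : ∃ E, E = (s + t) * g + (4 * (s + t) + 1) * g * h + 2 * (k * K) := ⟨_, rfl⟩
  have hED : E * D ≤ 8 * n := by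
    have h1 : (s + t) * g * D ≤ (s + t) * g * (h * D) := by
      gcongr
      exact Nat.le_mul_of_pos_left _ hpos
    have h2 : (4 * (s + t) + 1) * g * (h * D) ≤ 5 * ((s + t) * g) * (h * D) := by gcongr
    rw [hE]
    linarith
  have hEn : 6 * E ≤ n := by
    have h1 : 54 * E ≤ D * E := Nat.mul_le_mul_right _ (by omega)
    linarith
  have hrk : (4 * (s + t) + 1) * g ≤ k := by
    have h1 : (4 * (s + t) + 1) * g * h ≤ k * h := by
      have e1 : (4 * (s + t) + 1) * g * h ≤ E := by rw [hE]; omega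
      have e2 : (s + t) * g ≤ E := by rw [hE]; omega
      have e3 : n = h * k + (s + t) * g := by omega
      linarith
    exact Nat.le_of_mul_le_mul_right h1 hpos
  have hEeq : n + (4 * (s + t) + 1) * g * h + 2 * ((Finset.range k).card * K) ≤
      (Finset.range k).card * h + E := by
    rw [Finset.card_range, hE, Nat.mul_comm k h]
    omega
  have hPA' : (Finset.range k).biUnion P ⊆ A := hPA ▸ hA₁
  have hQB' : (Finset.range k).biUnion Q ⊆ B := hQB ▸ hB₁
  have hF : N * (n * (2 * E) + (Finset.range k).card * ((Finset.range k).card * (2 * K * h))) ≤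
      n ^ 2 := by
    rw [Finset.card_range]
    have h1 : n * (E * D) ≤ n * (8 * n) := Nat.mul_le_mul_left _ hED
    have h2 : (h * k) * (k * K * D) ≤ n * n := Nat.mul_le_mul hkn hkK
    have h3 : 54 * (N * (n * (2 * E) + k * (k * (2 * K * h)))) =
        2 * (n * (E * D)) + 2 * ((h * k) * (k * K * D)) := by rw [hD]; ring
    nlinarith
  rcases conn_or_extremal H hpos hPA' hQB' hA hB hdA hEeq hEn with hcA' | hex
  · rcases conn_or_extremal H.flip hpos hQB' hPA' hB hA hdB hEeq hEn with hcB' | hex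
    · left
      have h1 := absorb_leftover hs hst hK.ge le_rfl hhK hdvd H hcA' hcB'
        (by rw [Finset.card_range]; exact hrk) g (I := Finset.range k) (UA := A \ A₁)
        (UB := B \ B₁) subset_rfl Finset.sdiff_subset Finset.sdiff_subset
        (by rw [hPA]; exact Finset.sdiff_disjoint) (by rw [hQB]; exact Finset.sdiff_disjoint)
        (by rw [Finset.card_sdiff_of_subset hA₁, hA, hcA, hg])
        (by rw [Finset.card_sdiff_of_subset hB₁, hB, hcB, hg]) (by simp)
      rwa [hPA, hQB, Finset.sdiff_union_of_subset hA₁, Finset.sdiff_union_of_subset hB₁] at h1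
    · exact Or.inr ⟨_, hF, hex.flip⟩
  · exact Or.inr ⟨_, hF, hex⟩

end NonExtremal

section NearComplete

set_option linter.unusedSectionVars false
set_option linter.unusedDecidableInType false

variable {α β : Type} [DecidableEq α] [DecidableEq β] {R : α → β → Prop} {s t : ℕ}

theorem not_extremal_of_miss_le {A : Finset α} {B : Finset β} {n μ F : ℕ} (hA : A.card = n)
    (hB : B.card = n) (hn : 1 ≤ n) (hμ : 100 * μ ≤ n) (hmiss : ∀ a ∈ A, miss R a B ≤ μ)
    (hF : 20 * F ≤ n ^ 2) : ¬ Extremal R F A B := by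
  rintro ⟨X, hX, Y, hY, h1, -, -, h4, h5, -⟩
  rw [hA] at h1
  rw [hB] at h4
  have h6 : ∀ a ∈ X, 32 * n ≤ 100 * nbr R a (B \ Y) := by
    intro a ha
    have k1 := nbr_add_miss (R := R) a (B \ Y)
    have k2 := (miss_mono (R := R) a (Finset.sdiff_subset (s := B) (t := Y))).trans
      (hmiss a (hX ha))
    omega
  have h7 := Finset.card_nsmul_le_sum _ _ _ h6
  rw [← Finset.mul_sum, smul_eq_mul] at h7
  have h8 : n * (32 * n) ≤ 3 * X.card * (32 * n) := Nat.mul_le_mul_right _ h1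
  nlinarith

theorem tileable_of_miss_le (hs : 1 ≤ s) (hst : s < t) :
    ∃ n₀ : ℕ, ∀ (α β : Type) [DecidableEq α] [DecidableEq β] (R : α → β → Prop) (P : Finset α)
      (Q : Finset β) (μ : ℕ), n₀ + 200 * t * μ ≤ P.card → n₀ + 200 * t * μ ≤ Q.card →
      P.card ≤ Q.card + μ → Q.card ≤ P.card + μ → (∀ a ∈ P, miss R a Q ≤ μ) →
      (∀ b ∈ Q, miss (flip R) b P ≤ μ) → InLat s t P.card Q.card → Tileable R s t P Q := by
  obtain ⟨n₀, hn₀⟩ := tileable_or_extremal hs hst (N := 20) (by norm_num)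
  have key : ∀ (α β : Type) [DecidableEq α] [DecidableEq β] (R : α → β → Prop) (P : Finset α)
      (Q : Finset β) (μ : ℕ), n₀ + 1 + 200 * t * μ ≤ P.card → n₀ + 1 + 200 * t * μ ≤ Q.card →
      P.card ≤ Q.card + μ → Q.card ≤ P.card → (∀ a ∈ P, miss R a Q ≤ μ) →
      (∀ b ∈ Q, miss (flip R) b P ≤ μ) → InLat s t P.card Q.card → Tileable R s t P Q := by
    intro α β _ _ R P Q μ hP hQ hPQ hQP hmP hmQ ⟨x, y, hx, hy⟩
    obtain ⟨j, hj⟩ : ∃ j : ℕ, P.card = Q.card + j * (t - s) := by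
      have hts : (0 : ℤ) < t - s := by
        have : (s : ℤ) < t := by exact_mod_cast hst
        linarith
      have e : ((P.card : ℤ) - Q.card) = (y - x) * (t - s) := by rw [hx, hy]; ring
      have hyx : 0 ≤ y - x := by
        have : (0 : ℤ) ≤ (y - x) * (t - s) := by
          rw [← e]
          have : (Q.card : ℤ) ≤ P.card := by exact_mod_cast hQP
          linarith
        exact nonneg_of_mul_nonneg_left this hts
      obtain ⟨j, hj⟩ := Int.eq_ofNat_of_zero_le hyx
      refine ⟨j, ?_⟩
      zify [hst.le]
      rw [← hj]
      linarith
    have hjμ : j ≤ μ := by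
      have : j * 1 ≤ j * (t - s) := Nat.mul_le_mul_left _ (by omega)
      omega
    have htμ : μ ≤ t * μ := Nat.le_mul_of_pos_left _ (by omega)
    have hjt : j * t ≤ t * μ := by rw [Nat.mul_comm]; exact Nat.mul_le_mul_left _ hjμ
    have hjs : j * s ≤ j * t := Nat.mul_le_mul_left _ hst.le
    have ejs : j * (s - 1) + j = j * s := by
      obtain ⟨u, rfl⟩ : ∃ u, s = u + 1 := ⟨s - 1, by omega⟩
      simp; ring
    have ejt : j * (t - s) + j * s = j * t := by rw [← Nat.mul_add]; congr 1; omega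
    rw [Nat.mul_assoc] at hP hQ
    obtain ⟨F, hFQ, hF⟩ := Finset.exists_subset_card_eq (s := Q) (n := j) (by omega)
    obtain ⟨P', hP', Q', hQ', cP', cQ', hT⟩ := exists_carve (R := flip R) (s := s) (t := t) (F := F)
      (P := Q \ F) (Q := P) (μ := μ) (f := j) hs Finset.disjoint_sdiff
      (fun b hb => (miss_mono b Finset.sdiff_subset).trans (hmP b hb)) hF.le
      (fun z hz => by
        have k1 := nbr_add_miss (R := flip R) z P
        have k2 := hmQ z (hFQ hz)
        omega) (by rw [Finset.card_sdiff_of_subset hFQ]; omega)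
    rw [hF] at cP' cQ'
    have hFP' : F ∪ P' ⊆ Q := Finset.union_subset hFQ (hP'.trans Finset.sdiff_subset)
    have cFP' : (F ∪ P').card = j * s := by
      rw [Finset.card_union_of_disjoint (Finset.disjoint_sdiff.mono_right hP'), hF, cP']
      omega
    have c1 : (P \ Q').card = P.card - j * t := by rw [Finset.card_sdiff_of_subset hQ', cQ']
    have c2 : (Q \ (F ∪ P')).card = P.card - j * t := by
      rw [Finset.card_sdiff_of_subset hFP', cFP']; omega
    have hdvd : s + t ∣ P.card - j * t := by
      have k1 : InLat s t (P \ Q').card (Q \ (F ∪ P')).card := by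
        rw [Finset.cast_card_sdiff hQ', Finset.cast_card_sdiff hFP']
        exact InLat.sub ⟨x, y, hx, hy⟩ hT.flip.card_inLat
      rw [c1, c2] at k1
      obtain ⟨x', y', h1, h2⟩ := k1
      have hxy : x' = y' := by
        have : (x' - y') * ((t : ℤ) - s) = 0 := by linarith
        rcases mul_eq_zero.1 this with h3 | h3
        · linarith
        · have : (s : ℤ) < t := by exact_mod_cast hst
          linarith
      subst hxy
      have : ((s + t : ℕ) : ℤ) ∣ ((P.card - j * t : ℕ) : ℤ) := ⟨x', by rw [h1]; push_cast; ring⟩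
      exact_mod_cast this
    have d1 : ∀ a ∈ P \ Q', miss R a (Q \ (F ∪ P')) ≤ μ := fun a ha =>
      (miss_mono a Finset.sdiff_subset).trans (hmP a (Finset.sdiff_subset ha))
    have d2 : ∀ b ∈ Q \ (F ∪ P'), miss (flip R) b (P \ Q') ≤ μ := fun b hb =>
      (miss_mono b Finset.sdiff_subset).trans (hmQ b (Finset.sdiff_subset hb))
    have hrest : Tileable R s t (P \ Q') (Q \ (F ∪ P')) := by
      rcases hn₀ α β R (P \ Q') (Q \ (F ∪ P')) (P.card - j * t) (by omega) c1 c2 hdvd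
        (fun a ha => by
          have k1 := nbr_add_miss (R := R) a (Q \ (F ∪ P'))
          have k2 := d1 a ha
          omega)
        (fun b hb => by
          have k1 := nbr_add_miss (R := flip R) b (P \ Q')
          have k2 := d2 b hb
          omega) with h | ⟨F', hF', hex⟩
      · exact h
      · exact absurd hex (not_extremal_of_miss_le (μ := μ) c1 c2 (by omega) (by omega) d1 hF')
    have hall := hrest.union hT.flip Finset.sdiff_disjoint Finset.sdiff_disjoint
    rwa [Finset.sdiff_union_of_subset hQ', Finset.sdiff_union_of_subset hFP'] at hall
  refine ⟨n₀ + 1, fun α β _ _ R P Q μ hP hQ hPQ hQP hmP hmQ hlat => ?_⟩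
  rcases le_total Q.card P.card with h | h
  · exact key α β R P Q μ hP hQ hPQ h hmP hmQ hlat
  · exact (key β α (flip R) Q P μ hQ hP hQP h hmQ hmP hlat.swap).flip

end NearComplete

section Stars

set_option linter.unusedSectionVars false
set_option linter.unusedDecidableInType false

variable {α β : Type} [DecidableEq α] [DecidableEq β]

/-- Disjoint stars with `s` leaves: the centres form `C` and the leaves form `L`. -/
inductive StarSet (R : α → β → Prop) (s : ℕ) : Finset α → Finset β → Prop
  | empty : StarSet R s ∅ ∅
  | insert_star {C : Finset α} {L S : Finset β} {x : α} : StarSet R s C L → x ∉ C →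
      Disjoint L S → S.card = s → (∀ b ∈ S, R x b) → StarSet R s (insert x C) (L ∪ S)

variable {R : α → β → Prop} {s t : ℕ}

theorem StarSet.card_leaves {C : Finset α} {L : Finset β} (H : StarSet R s C L) :
    L.card = C.card * s := by
  induction H with
  | empty => simp
  | insert_star _ hx hL hS _ ih =>
    rw [Finset.card_union_of_disjoint hL, Finset.card_insert_of_notMem hx, ih, hS]; ring

/-- Disjoint stars extend to disjoint tiles. -/
theorem StarSet.exists_fill {C : Finset α} {L : Finset β} (H : StarSet R s C L) {P : Finset α}
    {μ : ℕ} (ht : 1 ≤ t) (hCP : Disjoint C P) (hmiss : ∀ b ∈ L, miss (flip R) b P ≤ μ)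
    (hP : s * μ + C.card * (t - 1) ≤ P.card) :
    ∃ P' ⊆ P, P'.card = C.card * (t - 1) ∧ Tileable R s t (C ∪ P') L := by
  induction H with
  | empty => exact ⟨∅, by simp, by simp, by simpa using Tileable.empty⟩
  | @insert_star C L S x _ hx hL hS hxS ih =>
    rw [Finset.card_insert_of_notMem hx, Nat.add_mul, Nat.one_mul] at hP
    rw [Finset.disjoint_insert_left] at hCP
    obtain ⟨P', hP', cP', hT⟩ := ih hCP.2 (fun b hb => hmiss b (Finset.mem_union_left _ hb))
      (by omega)
    have h1 := card_le_common (R := R) (P \ P') S μ fun b hb =>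
      (miss_mono b Finset.sdiff_subset).trans (hmiss b (Finset.mem_union_right _ hb))
    rw [hS, Finset.card_sdiff_of_subset hP', cP'] at h1
    obtain ⟨Z, hZ, cZ⟩ := Finset.exists_subset_card_eq
      (s := (P \ P').filter fun a => ∀ b ∈ S, R a b) (n := t - 1) (by omega)
    have hZP : Z ⊆ P \ P' := hZ.trans (Finset.filter_subset _ _)
    have hxZ : x ∉ Z := fun h => hCP.1 (Finset.sdiff_subset (hZP h))
    refine ⟨P' ∪ Z, Finset.union_subset hP' (hZP.trans Finset.sdiff_subset), ?_, ?_⟩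
    · rw [Finset.card_union_of_disjoint (Finset.disjoint_sdiff.mono_right hZP),
        Finset.card_insert_of_notMem hx, cP', cZ]
      ring
    · have h2 := hT.union_tile (S := insert x Z) (T := S) ?_ hL
        (Or.inr ⟨by rw [Finset.card_insert_of_notMem hxZ, cZ]; omega, hS⟩) ?_
      · have e : insert x C ∪ (P' ∪ Z) = C ∪ P' ∪ insert x Z := by
          rw [Finset.insert_eq, Finset.insert_eq]
          ac_rfl
        rwa [e]
      · rw [Finset.disjoint_insert_right, Finset.mem_union, Finset.disjoint_union_left]
        exact ⟨fun h => h.elim hx fun h => hCP.1 (hP' h),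
          hCP.2.mono_right (hZP.trans Finset.sdiff_subset), Finset.disjoint_sdiff.mono_right hZP⟩
      · intro a ha b hb
        rcases Finset.mem_insert.1 ha with rfl | ha
        · exact hxS b hb
        · exact (Finset.mem_filter.1 (hZ ha)).2 b hb

theorem exists_star {P U : Finset α} {Q W : Finset β} {μ : ℕ} (hU : U ⊆ P) (hW : W ⊆ Q)
    (hP : ∀ a ∈ P, nbr R a Q ≤ μ) (hQ : ∀ b ∈ Q, nbr (flip R) b P ≤ μ)
    (he : (U.card + W.card) * μ + (s - 1) * P.card < ∑ a ∈ P, nbr R a Q) :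
    ∃ x ∈ P \ U, ∃ S ⊆ Q \ W, S.card = s ∧ ∀ b ∈ S, R x b := by
  by_contra! hno
  have h1 : ∀ a ∈ P \ U, nbr R a (Q \ W) ≤ s - 1 := by
    intro a ha
    by_contra! h
    obtain ⟨S, hS, cS⟩ := Finset.exists_subset_card_eq (s := (Q \ W).filter fun b => R a b)
      (n := s) (by unfold nbr at h; omega)
    obtain ⟨b, hb, hab⟩ := hno a ha S (hS.trans (Finset.filter_subset _ _)) cS
    exact hab (Finset.mem_filter.1 (hS hb)).2
  have h2 : ∑ a ∈ P, nbr R a Q = ∑ a ∈ P \ U, nbr R a Q + ∑ a ∈ U, nbr R a Q :=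
    (Finset.sum_sdiff hU).symm
  have h3 : ∑ a ∈ U, nbr R a Q ≤ U.card * μ := Finset.sum_le_card_nsmul _ _ _ fun a ha => hP a (hU ha)
  have h4 : ∑ a ∈ P \ U, nbr R a Q = ∑ a ∈ P \ U, nbr R a (Q \ W) + ∑ a ∈ P \ U, nbr R a W := by
    rw [← Finset.sum_add_distrib]
    exact Finset.sum_congr rfl fun a _ => (nbr_sdiff_add a hW).symm
  have h5 : ∑ a ∈ P \ U, nbr R a W ≤ W.card * μ := by
    rw [sum_nbr_comm]
    exact Finset.sum_le_card_nsmul _ _ _ fun b hb =>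
      (nbr_mono b Finset.sdiff_subset).trans (hQ b (hW hb))
  have h6 : ∑ a ∈ P \ U, nbr R a (Q \ W) ≤ P.card * (s - 1) :=
    (Finset.sum_le_card_nsmul _ _ _ h1).trans
      (Nat.mul_le_mul_right _ (Finset.card_le_card Finset.sdiff_subset))
  rw [Nat.mul_comm P.card] at h6
  rw [Nat.add_mul] at he
  omega

theorem exists_stars_of_sum {P : Finset α} {Q : Finset β} {μ : ℕ}
    (hP : ∀ a ∈ P, nbr R a Q ≤ μ) (hQ : ∀ b ∈ Q, nbr (flip R) b P ≤ μ) (p q : ℕ)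
    (h1 : (p + q) * (s + 1) * μ + (s - 1) * P.card < ∑ a ∈ P, nbr R a Q)
    (h2 : (p + q) * (s + 1) * μ + (s - 1) * Q.card < ∑ a ∈ P, nbr R a Q) :
    ∃ C L C' L', C ⊆ P ∧ L ⊆ Q ∧ C' ⊆ Q ∧ L' ⊆ P ∧ StarSet R s C L ∧ StarSet (flip R) s C' L' ∧
      C.card = p ∧ C'.card = q ∧ Disjoint C L' ∧ Disjoint C' L := by
  induction p with
  | zero =>
    induction q with
    | zero => exact ⟨∅, ∅, ∅, ∅, by simp, by simp, by simp, by simp, .empty, .empty, by simp⟩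
    | succ q ih =>
      have hm : (0 + q) * (s + 1) * μ ≤ (0 + (q + 1)) * (s + 1) * μ := by gcongr; omega
      obtain ⟨C, L, C', L', hC, hL, hC', hL', S1, S2, cC, cC', d1, d2⟩ := ih (by omega) (by omega)
      obtain rfl : C = ∅ := Finset.card_eq_zero.1 cC
      have cL : L.card = 0 := by rw [S1.card_leaves]; simp
      obtain rfl : L = ∅ := Finset.card_eq_zero.1 cL
      have cL' := S2.card_leaves
      obtain ⟨x, hx, S, hS, cS, hxS⟩ := exists_star (R := flip R) (s := s) hC' hL' hQ hP (by
        rw [← sum_nbr_comm, cL', cC']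
        have : (q + q * s) * μ ≤ (0 + q) * (s + 1) * μ := by apply le_of_eq; ring
        omega)
      rw [Finset.mem_sdiff] at hx
      exact ⟨∅, ∅, insert x C', L' ∪ S, hC, hL, Finset.insert_subset hx.1 hC',
        Finset.union_subset hL' (hS.trans Finset.sdiff_subset), S1,
        S2.insert_star hx.2 (Finset.disjoint_sdiff.mono_right hS) cS hxS, cC,
        by rw [Finset.card_insert_of_notMem hx.2, cC'], by simp, by simp⟩
  | succ p ih =>
    have hm : (p + q) * (s + 1) * μ ≤ (p + 1 + q) * (s + 1) * μ := by gcongr; omega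
    obtain ⟨C, L, C', L', hC, hL, hC', hL', S1, S2, cC, cC', d1, d2⟩ := ih (by omega) (by omega)
    have cL := S1.card_leaves
    have cL' := S2.card_leaves
    obtain ⟨x, hx, S, hS, cS, hxS⟩ := exists_star (R := R) (s := s) (U := C ∪ L') (W := L ∪ C')
      (Finset.union_subset hC hL') (Finset.union_subset hL hC') hP hQ (by
        rw [Finset.card_union_of_disjoint d1, Finset.card_union_of_disjoint d2.symm, cL, cL', cC,
          cC']
        have : (p + q * s + (p * s + q)) * μ ≤ (p + q) * (s + 1) * μ := by apply le_of_eq; ring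
        omega)
    rw [Finset.mem_sdiff, Finset.mem_union, not_or] at hx
    rw [Finset.subset_sdiff, Finset.disjoint_union_right] at hS
    refine ⟨insert x C, L ∪ S, C', L', Finset.insert_subset hx.1 hC,
      Finset.union_subset hL hS.1, hC', hL', S1.insert_star hx.2.1 hS.2.1.symm cS hxS, S2,
      by rw [Finset.card_insert_of_notMem hx.2.1, cC], cC', ?_, ?_⟩
    · rw [Finset.disjoint_insert_left]; exact ⟨hx.2.2, d1⟩
    · rw [Finset.disjoint_union_right]; exact ⟨d2, hS.2.2.symm⟩

/-- Disjoint stars in both directions in a sparse pair of bounded degree. -/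
theorem exists_stars {P : Finset α} {Q : Finset β} {μ ν : ℕ} (hs : 1 ≤ s)
    (hP : ∀ a ∈ P, nbr R a Q ≤ μ) (hQ : ∀ b ∈ Q, nbr (flip R) b P ≤ μ) (p q : ℕ)
    (hp : 0 < p → ∀ b ∈ Q, s + p ≤ nbr (flip R) b P + 1)
    (hq : 0 < q → ∀ a ∈ P, s + q ≤ nbr R a Q + 1)
    (hPQ : P.card ≤ Q.card + ν) (hQP : Q.card ≤ P.card + ν)
    (c1 : 2 * (s + 1) * μ + (s - 1) * ν < P.card) (c2 : 2 * (s + 1) * μ + (s - 1) * ν < Q.card) :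
    ∃ C L C' L', C ⊆ P ∧ L ⊆ Q ∧ C' ⊆ Q ∧ L' ⊆ P ∧ StarSet R s C L ∧ StarSet (flip R) s C' L' ∧
      C.card = p ∧ C'.card = q ∧ Disjoint C L' ∧ Disjoint C' L := by
  rcases Nat.eq_zero_or_pos (p + q) with h0 | h0
  · obtain ⟨rfl, rfl⟩ : p = 0 ∧ q = 0 := by omega
    exact ⟨∅, ∅, ∅, ∅, by simp, by simp, by simp, by simp, .empty, .empty, by simp⟩
  obtain ⟨u, rfl⟩ : ∃ u, s = u + 1 := ⟨s - 1, by omega⟩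
  simp only [Nat.add_sub_cancel] at c1 c2
  have key : ∀ {z X Y e : ℕ}, 0 < z → p + q ≤ 2 * z → Y ≤ X + ν → X * (u + z) ≤ e →
      2 * (u + 1 + 1) * μ + u * ν < X →
      (p + q) * (u + 1 + 1) * μ + (u + 1 - 1) * X < e ∧
      (p + q) * (u + 1 + 1) * μ + (u + 1 - 1) * Y < e := by
    intro z X Y e hz hpq hYX he hX
    rw [Nat.add_sub_cancel]
    have k1 : (p + q) * (u + 1 + 1) * μ ≤ 2 * z * (u + 1 + 1) * μ := by gcongr
    have k2 : z * (2 * (u + 1 + 1) * μ + u * ν) < z * X := Nat.mul_lt_mul_of_pos_left hX hz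
    have k3 : u * ν ≤ z * (u * ν) := Nat.le_mul_of_pos_left _ hz
    have k4 : u * Y ≤ u * (X + ν) := Nat.mul_le_mul_left _ hYX
    have k5 : 2 * z * (u + 1 + 1) * μ = z * (2 * (u + 1 + 1) * μ) := by ring
    rw [Nat.mul_add] at k2 k4 he
    rw [Nat.mul_comm X u, Nat.mul_comm X z] at he
    omega
  rcases le_total q p with h | h
  · have h1 : Q.card * (u + p) ≤ ∑ a ∈ P, nbr R a Q := by
      rw [sum_nbr_comm]
      exact Finset.card_nsmul_le_sum _ _ _ fun b hb => by
        have := hp (by omega) b hb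
        omega
    have h2 := key (z := p) (by omega) (by omega) hPQ h1 c2
    exact exists_stars_of_sum hP hQ p q h2.2 h2.1
  · have h1 : P.card * (u + q) ≤ ∑ a ∈ P, nbr R a Q :=
      Finset.card_nsmul_le_sum _ _ _ fun b hb => by
        have := hq (by omega) b hb
        omega
    have h2 := key (z := q) (by omega) (by omega) hQP h1 c1
    exact exists_stars_of_sum hP hQ p q h2.1 h2.2

end Stars

section Block

set_option linter.unusedSectionVars false
set_option linter.unusedDecidableInType false

variable {α β : Type} [DecidableEq α] [DecidableEq β] {R : α → β → Prop} {s t : ℕ}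

theorem Tileable.union_sdiff {X Z P P' Pr : Finset α} {Y W Q Q' Qr : Finset β}
    (h : Tileable R s t (X ∪ P') (Y ∪ Q')) (h' : Tileable R s t (Z ∪ Pr) (W ∪ Qr))
    (hPr : Pr = P \ P') (hQr : Qr = Q \ Q')
    (hP : P' ⊆ P) (hQ : Q' ⊆ Q) (hXZ : Disjoint X Z) (hXP : Disjoint X P) (hZP : Disjoint Z P)
    (hYW : Disjoint Y W) (hYQ : Disjoint Y Q) (hWQ : Disjoint W Q) :
    Tileable R s t (X ∪ Z ∪ P) (Y ∪ W ∪ Q) := by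
  subst hPr hQr
  have hu := h.union h'
    (by
      rw [Finset.disjoint_union_left, Finset.disjoint_union_right, Finset.disjoint_union_right]
      exact ⟨⟨hXZ, hXP.mono_right Finset.sdiff_subset⟩, (hZP.mono_right hP).symm,
        Finset.disjoint_sdiff⟩)
    (by
      rw [Finset.disjoint_union_left, Finset.disjoint_union_right, Finset.disjoint_union_right]
      exact ⟨⟨hYW, hYQ.mono_right Finset.sdiff_subset⟩, (hWQ.mono_right hQ).symm,
        Finset.disjoint_sdiff⟩)
  rwa [Finset.union_union_union_comm, Finset.union_union_union_comm Y,
    Finset.union_sdiff_of_subset hP, Finset.union_sdiff_of_subset hQ] at hu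

/-- A nearly complete pair `(P, Q)` together with few exceptional vertices `F`, `E` of large degree
and few centres `K`, `K'` of disjoint stars is tileable. -/
theorem tileable_block (hs : 1 ≤ s) (hst : s < t) :
    ∃ n₀ : ℕ, ∀ (α β : Type) [DecidableEq α] [DecidableEq β] (R : α → β → Prop)
      (P F K L' : Finset α) (Q E K' L : Finset β) (w μ : ℕ),
      n₀ + 201 * t * (μ + 4 * (w * t)) ≤ P.card → n₀ + 201 * t * (μ + 4 * (w * t)) ≤ Q.card →
      P.card ≤ Q.card + μ → Q.card ≤ P.card + μ → (∀ a ∈ P, miss R a Q ≤ μ) →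
      (∀ b ∈ Q, miss (flip R) b P ≤ μ) → Disjoint F P → Disjoint K P → Disjoint K F →
      Disjoint E Q → Disjoint K' Q → Disjoint K' E → StarSet R s K L → L ⊆ Q →
      StarSet (flip R) s K' L' → L' ⊆ P → F.card ≤ w → K.card ≤ w → E.card ≤ w → K'.card ≤ w →
      (∀ a ∈ F, 5 * (w * t) ≤ nbr R a Q) → (∀ b ∈ E, 5 * (w * t) ≤ nbr (flip R) b P) →
      InLat s t (P.card + F.card + K.card) (Q.card + E.card + K'.card) →
      Tileable R s t (K ∪ (F ∪ P)) (K' ∪ (E ∪ Q)) := by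
  obtain ⟨n₀, hn₀⟩ := tileable_of_miss_le hs hst
  refine ⟨n₀, ?_⟩
  intro α β _ _ R P F K L' Q E K' L w μ hP hQ hPQ hQP mP mQ dFP dKP dKF dEQ dKQ dKE SK hLQ SK' hLP
    cF cK cE cK' hF hE hlat
  have ht : 1 ≤ t := by omega
  have cL := SK.card_leaves
  have cL' := SK'.card_leaves
  have b1 : ∀ {c u : ℕ}, c ≤ w → u ≤ t → c * u ≤ w * t := fun h1 h2 => Nat.mul_le_mul h1 h2
  have bL := b1 cK hst.le
  have bL' := b1 cK' hst.le
  have bK := b1 cK (Nat.sub_le t 1)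
  have bK' := b1 cK' (Nat.sub_le t 1)
  have bF := b1 cF hst.le
  have bF1 := b1 cF ((Nat.sub_le s 1).trans hst.le)
  have bE1 := b1 cE ((Nat.sub_le s 1).trans hst.le)
  have bFt := b1 cF le_rfl
  have bEt := b1 cE le_rfl
  have hsμ : s * μ ≤ t * μ := Nat.mul_le_mul_right _ hst.le
  have hsw : w * (s - 1) ≤ w * t := Nat.mul_le_mul_left _ ((Nat.sub_le s 1).trans hst.le)
  have hbig : 200 * t * (μ + 4 * (w * t)) + t * μ + 4 * (w * t) ≤ 201 * t * (μ + 4 * (w * t)) := by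
    have : 1 * (w * t) ≤ t * (w * t) := Nat.mul_le_mul_right _ ht
    linarith
  have hbig' : 10 * (w * t) ≤ 200 * t * (μ + 4 * (w * t)) := by
    have : 1 * (w * t) ≤ t * (w * t) := Nat.mul_le_mul_right _ ht
    have : 0 ≤ t * μ := Nat.zero_le _
    linarith
  obtain ⟨Q₁, hQ₁, cQ₁, T₁⟩ := SK'.exists_fill (P := Q \ L) (μ := μ) ht
    (dKQ.mono_right Finset.sdiff_subset)
    (fun b hb => (miss_mono b Finset.sdiff_subset).trans (mP b (hLP hb)))
    (by rw [Finset.card_sdiff_of_subset hLQ]; omega)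
  replace T₁ := T₁.flip
  have hQ₁Q := hQ₁.trans Finset.sdiff_subset
  have hLQ₁ : L ⊆ Q \ Q₁ := Finset.subset_sdiff.2 ⟨hLQ, Finset.disjoint_sdiff.mono_right hQ₁⟩
  obtain ⟨Pa, ePa⟩ : ∃ Pa, Pa = P \ L' := ⟨_, rfl⟩
  obtain ⟨Qa, eQa⟩ : ∃ Qa, Qa = Q \ Q₁ := ⟨_, rfl⟩
  rw [← eQa] at hLQ₁
  have sPa : Pa ⊆ P := by rw [ePa]; exact Finset.sdiff_subset
  have sQa : Qa ⊆ Q := by rw [eQa]; exact Finset.sdiff_subset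
  have cPa : Pa.card + L'.card = P.card := by rw [ePa]; exact Finset.card_sdiff_add_card_eq_card hLP
  have cQa : Qa.card + Q₁.card = Q.card := by
    rw [eQa]; exact Finset.card_sdiff_add_card_eq_card hQ₁Q
  obtain ⟨P₁, hP₁, cP₁, T₂⟩ := SK.exists_fill (P := Pa) (μ := μ) ht (dKP.mono_right sPa)
    (fun b hb => (miss_mono b sPa).trans (mQ b (hLQ hb))) (by omega)
  obtain ⟨Pb, ePb⟩ : ∃ Pb, Pb = Pa \ P₁ := ⟨_, rfl⟩
  obtain ⟨Qb, eQb⟩ : ∃ Qb, Qb = Qa \ L := ⟨_, rfl⟩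
  have sPb : Pb ⊆ P := by rw [ePb]; exact Finset.sdiff_subset.trans sPa
  have sQb : Qb ⊆ Q := by rw [eQb]; exact Finset.sdiff_subset.trans sQa
  have cPb : Pb.card + P₁.card = Pa.card := by
    rw [ePb]; exact Finset.card_sdiff_add_card_eq_card hP₁
  have cQb : Qb.card + L.card = Qa.card := by
    rw [eQb]; exact Finset.card_sdiff_add_card_eq_card hLQ₁
  obtain ⟨P₂, hP₂, Q₂, hQ₂, cP₂, cQ₂, T₃⟩ := exists_carve (R := R) (s := s) (t := t) (F := F)
    (P := Pb) (Q := Qb) (μ := μ) (f := w) hs (dFP.mono_right sPb)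
    (fun b hb => (miss_mono b sPb).trans (mQ b (sQb hb))) cF
    (fun x hx => by
      have k1 := hF x hx
      have k2 := nbr_le_nbr_sdiff (R := R) x Q Q₁
      have k3 := nbr_le_nbr_sdiff (R := R) x Qa L
      rw [← eQa] at k2
      rw [← eQb] at k3
      omega) (by omega)
  obtain ⟨Pc, ePc⟩ : ∃ Pc, Pc = Pb \ P₂ := ⟨_, rfl⟩
  obtain ⟨Qc, eQc⟩ : ∃ Qc, Qc = Qb \ Q₂ := ⟨_, rfl⟩
  have sPc : Pc ⊆ P := by rw [ePc]; exact Finset.sdiff_subset.trans sPb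
  have sQc : Qc ⊆ Q := by rw [eQc]; exact Finset.sdiff_subset.trans sQb
  have cPc : Pc.card + P₂.card = Pb.card := by
    rw [ePc]; exact Finset.card_sdiff_add_card_eq_card hP₂
  have cQc : Qc.card + Q₂.card = Qb.card := by
    rw [eQc]; exact Finset.card_sdiff_add_card_eq_card hQ₂
  obtain ⟨Q₃, hQ₃, P₃, hP₃, cQ₃, cP₃, T₄⟩ := exists_carve (R := flip R) (s := s) (t := t) (F := E)
    (P := Qc) (Q := Pc) (μ := μ) (f := w) hs (dEQ.mono_right sQc)
    (fun b hb => (miss_mono b sQc).trans (mP b (sPc hb))) cE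
    (fun x hx => by
      have k1 := hE x hx
      have k2 := nbr_le_nbr_sdiff (R := flip R) x P L'
      have k3 := nbr_le_nbr_sdiff (R := flip R) x Pa P₁
      have k4 := nbr_le_nbr_sdiff (R := flip R) x Pb P₂
      rw [← ePa] at k2
      rw [← ePb] at k3
      rw [← ePc] at k4
      omega) (by omega)
  replace T₄ := T₄.flip
  obtain ⟨Pd, ePd⟩ : ∃ Pd, Pd = Pc \ P₃ := ⟨_, rfl⟩
  obtain ⟨Qd, eQd⟩ : ∃ Qd, Qd = Qc \ Q₃ := ⟨_, rfl⟩
  have sPd : Pd ⊆ P := by rw [ePd]; exact Finset.sdiff_subset.trans sPc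
  have sQd : Qd ⊆ Q := by rw [eQd]; exact Finset.sdiff_subset.trans sQc
  have cPd : Pd.card + P₃.card = Pc.card := by
    rw [ePd]; exact Finset.card_sdiff_add_card_eq_card hP₃
  have cQd : Qd.card + Q₃.card = Qc.card := by
    rw [eQd]; exact Finset.card_sdiff_add_card_eq_card hQ₃
  have hlat' : InLat s t Pd.card Qd.card := by
    have h1 := hlat.sub (((T₁.card_inLat.add T₂.card_inLat).add T₃.card_inLat).add T₄.card_inLat)
    rw [Finset.card_union_of_disjoint (dKQ.mono_right hQ₁Q),
      Finset.card_union_of_disjoint (dKP.mono_right (hP₁.trans sPa)),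
      Finset.card_union_of_disjoint (dFP.mono_right (hP₂.trans sPb)),
      Finset.card_union_of_disjoint (dEQ.mono_right (hQ₃.trans sQc))] at h1
    convert h1 using 1 <;> omega
  have T₅ : Tileable R s t Pd Qd := hn₀ α β R Pd Qd (μ + 4 * (w * t)) (by omega) (by omega)
    (by omega) (by omega)
    (fun a ha => ((miss_mono a sQd).trans (mP a (sPd ha))).trans (Nat.le_add_right _ _))
    (fun b hb => ((miss_mono b sPd).trans (mQ b (sQd hb))).trans (Nat.le_add_right _ _)) hlat'
  have U₄ : Tileable R s t Pc (E ∪ Qc) := by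
    simpa using Tileable.union_sdiff (X := ∅) (Z := ∅) (W := ∅) (by simpa using T₄)
      (by simpa using T₅) ePd eQd hP₃ hQ₃ (by simp) (by simp) (by simp) (by simp)
      (dEQ.mono_right sQc) (by simp)
  have U₃ : Tileable R s t (F ∪ Pb) (E ∪ Qb) := by
    simpa using Tileable.union_sdiff (X := F) (Z := ∅) (Y := ∅) (W := E) (by simpa using T₃)
      (by simpa using U₄) ePc eQc hP₂ hQ₂ (by simp) (dFP.mono_right sPb) (by simp) (by simp)
      (by simp) (dEQ.mono_right sQb)
  have U₂ : Tileable R s t (K ∪ F ∪ Pa) (E ∪ Qa) := by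
    simpa using Tileable.union_sdiff (X := K) (Z := F) (Y := ∅) (W := E) (by simpa using T₂)
      U₃ ePb eQb hP₁ hLQ₁ dKF (dKP.mono_right sPa) (dFP.mono_right sPa) (by simp)
      (by simp) (dEQ.mono_right sQa)
  have U₁ := Tileable.union_sdiff (X := ∅) (P' := L') (by simpa using T₁) U₂ ePa eQa hLP hQ₁Q
    (by simp) (by simp) (Finset.disjoint_union_left.2 ⟨dKP, dFP⟩) dKE dKQ dEQ
  rwa [Finset.empty_union, Finset.union_assoc, Finset.union_assoc] at U₁

end Block

section Split

set_option linter.unusedSectionVars false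
set_option linter.unusedDecidableInType false

variable {α β : Type} [DecidableEq α] [DecidableEq β] {R : α → β → Prop} {s t : ℕ}

/-- `A` splits into two nearly balanced parts `A₁`, `A₂` sending few edges to `B₂` and `B₁`
respectively, and a small part `A₀` of vertices with many neighbours on both sides. -/
structure Split (R : α → β → Prop) (A A₁ A₀ A₂ : Finset α) (B₁ B₂ : Finset β) (n κ f μ : ℕ) :
    Prop where
  eq : A = A₁ ∪ (A₀ ∪ A₂)
  disj₁₀ : Disjoint A₁ A₀
  disj₁₂ : Disjoint A₁ A₂
  disj₀₂ : Disjoint A₀ A₂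
  card₀ : A₀.card ≤ κ
  card₁ : n ≤ 2 * A₁.card + 2 * κ
  card₂ : n ≤ 2 * A₂.card + 2 * κ
  cross₁ : ∀ a ∈ A₁, nbr R a B₂ ≤ μ
  cross₂ : ∀ a ∈ A₂, nbr R a B₁ ≤ μ
  free₁ : ∀ a ∈ A₀, f ≤ nbr R a B₁
  free₂ : ∀ a ∈ A₀, f ≤ nbr R a B₂

theorem Split.card_eq {A A₁ A₀ A₂ : Finset α} {B₁ B₂ : Finset β} {n κ f μ : ℕ}
    (h : Split R A A₁ A₀ A₂ B₁ B₂ n κ f μ) : A₁.card + (A₀.card + A₂.card) = A.card := by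
  rw [h.eq, Finset.card_union_of_disjoint (Finset.disjoint_union_right.2 ⟨h.disj₁₀, h.disj₁₂⟩),
    Finset.card_union_of_disjoint h.disj₀₂]

theorem nbr_split {B B₁ B₀ B₂ F : Finset β} (h : B = B₁ ∪ (B₀ ∪ B₂)) (hF : F ⊆ B₀) (a : α) :
    nbr R a B ≤ nbr R a B₁ + nbr R a B₂ + F.card + (B₀ \ F).card := by
  have h1 := nbr_union_le (R := R) a B₁ (B₀ ∪ B₂)
  have h2 := nbr_union_le (R := R) a B₀ B₂
  have h3 := nbr_le_card (R := R) a B₀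
  have h4 := Finset.card_sdiff_add_card_eq_card hF
  rw [← h] at h1
  omega

theorem Split.swap {A A₁ A₀ A₂ : Finset α} {B₁ B₂ : Finset β} {n κ f μ : ℕ}
    (h : Split R A A₁ A₀ A₂ B₁ B₂ n κ f μ) : Split R A A₂ A₀ A₁ B₂ B₁ n κ f μ where
  eq := by rw [h.eq]; ext x; simp only [Finset.mem_union]; tauto
  disj₁₀ := h.disj₀₂.symm
  disj₁₂ := h.disj₁₂.symm
  disj₀₂ := h.disj₁₀.symm
  card₀ := h.card₀
  card₁ := h.card₂
  card₂ := h.card₁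
  cross₁ := h.cross₂
  cross₂ := h.cross₁
  free₁ := h.free₂
  free₂ := h.free₁

/-- The free vertices can be used to correct the size of `A₁` to `a`, unless they run out; the
remaining defect is bounded by what the minimum degree provides. -/
theorem Split.exists_fill {A A₁ A₀ A₂ : Finset α} {B₁ B₂ : Finset β} {n κ f μ : ℕ}
    (h : Split R A A₁ A₀ A₂ B₁ B₂ n κ f μ) (hn : A.card = n) {a b : ℕ} (hab : a + b = n)
    (h1 : a ≤ b + t) (h2 : b ≤ a + t) (ht : t ≤ κ) :
    ∃ F ⊆ A₀, ∃ p q, A₁.card + F.card + q = a + p ∧ p ≤ 2 * κ ∧ q ≤ 2 * κ ∧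
      (∀ y d, b + s ≤ d + 1 → d ≤ nbr (flip R) y A → 0 < p → s + p ≤ nbr (flip R) y A₁ + 1) ∧
      (∀ y d, a + s ≤ d + 1 → d ≤ nbr (flip R) y A → 0 < q → s + q ≤ nbr (flip R) y A₂ + 1) := by
  have e := h.card_eq
  have c0 := h.card₀
  have c1 := h.card₁
  have c2 := h.card₂
  have hp (y : β) := nbr_split (R := flip R) h.eq (Finset.empty_subset A₀) y
  have hq (y : β) := nbr_split (R := flip R) h.eq (Finset.Subset.refl A₀) y
  simp only [Finset.sdiff_empty, Finset.sdiff_self, Finset.card_empty, Nat.add_zero] at hp hq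
  rcases le_total (A₁.card + A₀.card) a with h3 | h3
  · refine ⟨A₀, Finset.Subset.refl _, 0, a - (A₁.card + A₀.card), by omega, by omega, by omega,
      fun y d _ _ h => absurd h (by omega), fun y d k1 k2 k3 => ?_⟩
    have k4 := hq y
    have k5 := nbr_le_card (R := flip R) y A₁
    omega
  · rcases le_total A₁.card a with h4 | h4
    · obtain ⟨F, hF, hc⟩ := Finset.exists_subset_card_eq (s := A₀) (n := a - A₁.card) (by omega)
      exact ⟨F, hF, 0, 0, by omega, by omega, by omega,
        fun y d _ _ h => absurd h (by omega), fun y d _ _ h => absurd h (by omega)⟩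
    · refine ⟨∅, Finset.empty_subset _, A₁.card - a, 0, ?_, by omega, by omega,
        fun y d k1 k2 k3 => ?_, fun y d _ _ h => absurd h (by omega)⟩
      · rw [Finset.card_empty]; omega
      · have k4 := hp y
        have k5 := nbr_le_card (R := flip R) y A₂
        omega

theorem rearrange {A₁ A₀ A₂ F K K' : Finset α} (h₁₀ : Disjoint A₁ A₀) (h₁₂ : Disjoint A₁ A₂)
    (h₀₂ : Disjoint A₀ A₂) (hF : F ⊆ A₀) (hK : K ⊆ A₁) (hK' : K' ⊆ A₂) :
    (K' ∪ (F ∪ A₁ \ K)) ∪ (K ∪ (A₀ \ F ∪ A₂ \ K')) = A₁ ∪ (A₀ ∪ A₂) ∧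
      Disjoint (K' ∪ (F ∪ A₁ \ K)) (K ∪ (A₀ \ F ∪ A₂ \ K')) := by
  constructor
  · ext x
    have h1 := @hF x
    have h2 := @hK x
    have h3 := @hK' x
    simp only [Finset.mem_union, Finset.mem_sdiff]
    tauto
  · rw [Finset.disjoint_left]
    intro x
    have h1 := @hF x
    have h2 := @hK x
    have h3 := @hK' x
    have h4 : x ∈ A₁ → x ∉ A₀ := fun h => Finset.disjoint_left.1 h₁₀ h
    have h5 : x ∈ A₁ → x ∉ A₂ := fun h => Finset.disjoint_left.1 h₁₂ h
    have h6 : x ∈ A₀ → x ∉ A₂ := fun h => Finset.disjoint_left.1 h₀₂ h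
    simp only [Finset.mem_union, Finset.mem_sdiff]
    tauto

theorem Split.miss_le {A A₁ A₀ A₂ : Finset α} {B B₁ B₀ B₂ : Finset β} {n κ f μ : ℕ}
    (hA : Split R A A₁ A₀ A₂ B₁ B₂ n κ f μ)
    (hB : Split (flip R) B B₁ B₀ B₂ A₁ A₂ n κ f μ) (hn : B.card = n) (hκ : 2 * κ ≤ μ)
    (hd : ∀ a ∈ A, n ≤ 2 * nbr R a B) :
    (∀ a ∈ A₁, miss R a B₁ ≤ 2 * μ) ∧ ∀ a ∈ A₂, miss R a B₂ ≤ 2 * μ := by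
  have e := hB.card_eq
  have c0 := hB.card₀
  have c1 := hB.card₁
  have c2 := hB.card₂
  constructor
  · intro a ha
    have h1 := hd a (by rw [hA.eq]; exact Finset.mem_union_left _ ha)
    have h2 := nbr_split (R := R) hB.eq (Finset.Subset.refl _) a
    have h3 := nbr_add_miss (R := R) a B₁
    have h4 := hA.cross₁ a ha
    rw [Finset.sdiff_self, Finset.card_empty] at h2
    omega
  · intro a ha
    have h1 := hd a (by
      rw [hA.eq]; exact Finset.mem_union_right _ (Finset.mem_union_right _ ha))
    have h2 := nbr_split (R := R) hB.eq (Finset.Subset.refl _) a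
    have h3 := nbr_add_miss (R := R) a B₂
    have h4 := hA.cross₂ a ha
    rw [Finset.sdiff_self, Finset.card_empty] at h2
    omega

theorem tileable_half (hs : 1 ≤ s) (hst : s < t) :
    ∃ n₀ : ℕ, ∀ (α β : Type) [DecidableEq α] [DecidableEq β] (R : α → β → Prop)
      (A A₁ A₀ A₂ C D F L' : Finset α) (B B₁ B₀ B₂ C' D' E M : Finset β) (n κ f μ : ℕ),
      Split R A A₁ A₀ A₂ B₁ B₂ n κ f μ → Split (flip R) B B₁ B₀ B₂ A₁ A₂ n κ f μ →
      A.card = n → B.card = n → 2 * κ ≤ μ → 12 * (κ * t) ≤ f → (∀ x ∈ A, n ≤ 2 * nbr R x B) →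
      (∀ x ∈ B, n ≤ 2 * nbr (flip R) x A) →
      n₀ + 201 * t * (2 * μ + 4 * (2 * κ * t)) + 2 * κ ≤ A₁.card →
      n₀ + 201 * t * (2 * μ + 4 * (2 * κ * t)) + 2 * κ ≤ B₁.card →
      F ⊆ A₀ → E ⊆ B₀ → C ⊆ A₁ → D ⊆ A₂ → D' ⊆ B₁ → C' ⊆ B₂ →
      C.card ≤ 2 * κ → D.card ≤ 2 * κ → C'.card ≤ 2 * κ → D'.card ≤ 2 * κ →
      StarSet R s D M → StarSet (flip R) s C' L' → M ⊆ B₁ → L' ⊆ A₁ →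
      Disjoint C L' → Disjoint D' M →
      (InLat s t ((A₁ \ C).card + F.card + D.card) ((B₁ \ D').card + E.card + C'.card)) →
      Tileable R s t (D ∪ (F ∪ A₁ \ C)) (C' ∪ (E ∪ B₁ \ D')) := by
  obtain ⟨n₀, hn₀⟩ := tileable_block (s := s) (t := t) hs hst
  refine ⟨n₀, ?_⟩
  intro α β _ _ R A A₁ A₀ A₂ C D F L' B B₁ B₀ B₂ C' D' E M n κ f μ hA hB cA cB hκμ hf dA dB
    bA bB hF hE hC hD hD' hC' kC kD kC' kD' HT HS' hM hL' d1 d2 hlat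
  have mA := hA.miss_le hB cB hκμ dA
  have mB := hB.miss_le hA cA hκμ dB
  have eC := Finset.card_sdiff_add_card_eq_card hC
  have eD' := Finset.card_sdiff_add_card_eq_card hD'
  have c1 : A₁.card ≤ B₁.card + 2 * κ := by
    have := hA.card_eq
    have := hA.card₂
    have := hB.card₁
    omega
  have c2 : B₁.card ≤ A₁.card + 2 * κ := by
    have := hB.card_eq
    have := hB.card₂
    have := hA.card₁
    omega
  have hκt : κ ≤ κ * t := Nat.le_mul_of_pos_right _ (by omega)
  have e5 : 5 * (2 * κ * t) = 10 * (κ * t) := by ring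
  have cF := (Finset.card_le_card hF).trans hA.card₀
  have cE := (Finset.card_le_card hE).trans hB.card₀
  refine hn₀ α β R (A₁ \ C) F D L' (B₁ \ D') E C' M (2 * κ) (2 * μ) (by omega) (by omega)
    (by omega) (by omega) (fun x hx => ?_) (fun x hx => ?_)
    ((hA.disj₁₀.mono Finset.sdiff_subset hF).symm) ((hA.disj₁₂.mono Finset.sdiff_subset hD).symm)
    ((hA.disj₀₂.mono hF hD).symm) ((hB.disj₁₀.mono Finset.sdiff_subset hE).symm)
    ((hB.disj₁₂.mono Finset.sdiff_subset hC').symm) ((hB.disj₀₂.mono hE hC').symm) HT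
    (Finset.subset_sdiff.2 ⟨hM, d2.symm⟩) HS' (Finset.subset_sdiff.2 ⟨hL', d1.symm⟩)
    (by omega) kD (by omega) kC' (fun x hx => ?_) (fun x hx => ?_) hlat
  · exact (miss_mono x Finset.sdiff_subset).trans (mA.1 x (Finset.sdiff_subset hx))
  · exact (miss_mono x Finset.sdiff_subset).trans (mB.1 x (Finset.sdiff_subset hx))
  · have h1 := hA.free₁ x (hF hx)
    have h2 := nbr_le_nbr_sdiff (R := R) x B₁ D'
    omega
  · have h1 := hB.free₁ x (hE hx)
    have h2 := nbr_le_nbr_sdiff (R := flip R) x A₁ C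
    omega

theorem tileable_of_split (hs : 1 ≤ s) (hst : s < t) :
    ∃ n₀ : ℕ, ∀ (α β : Type) [DecidableEq α] [DecidableEq β] (R : α → β → Prop)
      (A A₁ A₀ A₂ : Finset α) (B B₁ B₀ B₂ : Finset β) (n a b d κ f μ : ℕ),
      Split R A A₁ A₀ A₂ B₁ B₂ n κ f μ → Split (flip R) B B₁ B₀ B₂ A₁ A₂ n κ f μ →
      A.card = n → B.card = n → n₀ + 402 * t * (2 * μ + 4 * (2 * κ * t)) + 6 * κ ≤ n →
      a + b = n → InLat s t a b → a ≤ b + t → b ≤ a + t → t ≤ κ → 2 * κ ≤ μ →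
      12 * (κ * t) ≤ f → a + s ≤ d + 1 → b + s ≤ d + 1 →
      (∀ x ∈ A, d ≤ nbr R x B) → (∀ x ∈ B, d ≤ nbr (flip R) x A) → Tileable R s t A B := by
  obtain ⟨n₀, hn₀⟩ := tileable_half (s := s) (t := t) hs hst
  refine ⟨2 * n₀, ?_⟩
  intro α β _ _ R A A₁ A₀ A₂ B B₁ B₀ B₂ n a b d κ f μ hA hB cA cB hn hab hlat hab1 hab2 htκ hκμ hf
    had hbd dA dB
  have hd : n ≤ 2 * d := by omega
  have dA' : ∀ x ∈ A, n ≤ 2 * nbr R x B := fun x hx => by have := dA x hx; omega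
  have dB' : ∀ x ∈ B, n ≤ 2 * nbr (flip R) x A := fun x hx => by have := dB x hx; omega
  have hsμ : 2 * (s + 1) * μ + (s - 1) * (2 * κ) ≤ 4 * (t * μ) := by
    have h1 : (s - 1) * (2 * κ) ≤ s * μ := Nat.mul_le_mul (Nat.sub_le _ _) hκμ
    have h2 : (s + 1) * μ ≤ t * μ := Nat.mul_le_mul_right _ hst
    nlinarith
  obtain ⟨w, hw⟩ : ∃ w, w = 201 * t * (2 * μ + 4 * (2 * κ * t)) := ⟨_, rfl⟩
  have hbig : 2 * n₀ + 2 * w + 6 * κ ≤ n := by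
    refine le_trans (le_of_eq ?_) hn
    rw [hw]
    ring
  have hμw : 402 * (t * μ) ≤ w := by
    have : 0 ≤ t * (κ * t) := by positivity
    rw [hw]
    nlinarith
  have htμ : 1 ≤ t * μ := Nat.mul_pos (by omega) (by omega)
  have b1 : n₀ + w + 2 * κ ≤ A₁.card := by have := hA.card₁; omega
  have b2 : n₀ + w + 2 * κ ≤ A₂.card := by have := hA.card₂; omega
  have b3 : n₀ + w + 2 * κ ≤ B₁.card := by have := hB.card₁; omega
  have b4 : n₀ + w + 2 * κ ≤ B₂.card := by have := hB.card₂; omega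
  have iB {y : β} : y ∈ B₁ ∨ y ∈ B₀ ∨ y ∈ B₂ → y ∈ B := by
    rw [hB.eq]; simp only [Finset.mem_union]; tauto
  have iA {y : α} : y ∈ A₁ ∨ y ∈ A₀ ∨ y ∈ A₂ → y ∈ A := by
    rw [hA.eq]; simp only [Finset.mem_union]; tauto
  have eA := hA.card_eq
  have eB := hB.card_eq
  have c12 : A₁.card ≤ B₂.card + 2 * κ ∧ B₂.card ≤ A₁.card + 2 * κ ∧
      A₂.card ≤ B₁.card + 2 * κ ∧ B₁.card ≤ A₂.card + 2 * κ := by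
    have := hA.card₁
    have := hA.card₂
    have := hB.card₁
    have := hB.card₂
    clear hn hf hsμ hbig b1 b2 b3 b4
    omega
  obtain ⟨F, hF, p, p', eF, lp, lp', dp, dp'⟩ := hA.exists_fill (s := s) cA hab hab1 hab2 htκ
  obtain ⟨E, hE, q', q, eE, lq', lq, dq', dq⟩ :=
    hB.exists_fill (s := s) cB ((add_comm _ _).trans hab) hab2 hab1 htκ
  obtain ⟨C, L, C', L', hC, hL, hC', hL', HS, HS', cC, cC', hd1, hd2⟩ := exists_stars (R := R)
    (s := s) (P := A₁) (Q := B₂) (μ := μ) (ν := 2 * κ) hs hA.cross₁ hB.cross₂ p q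
    (fun h y hy => dp y d hbd (dB y (iB (Or.inr (Or.inr hy)))) h)
    (fun h x hx => dq x d hbd (dA x (iA (Or.inl hx))) h) c12.1 c12.2.1 (by omega) (by omega)
  obtain ⟨D, M, D', M', hD, hM, hD', hM', HT, HT', cD, cD', hd3, hd4⟩ := exists_stars (R := R)
    (s := s) (P := A₂) (Q := B₁) (μ := μ) (ν := 2 * κ) hs hA.cross₂ hB.cross₁ p' q'
    (fun h y hy => dp' y d had (dB y (iB (Or.inl hy))) h)
    (fun h x hx => dq' x d had (dA x (iA (Or.inr (Or.inr hx)))) h)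
    c12.2.2.1 c12.2.2.2 (by omega) (by omega)
  have kF := Finset.card_sdiff_add_card_eq_card hF
  have kE := Finset.card_sdiff_add_card_eq_card hE
  have kC := Finset.card_sdiff_add_card_eq_card hC
  have kC' := Finset.card_sdiff_add_card_eq_card hC'
  have kD := Finset.card_sdiff_add_card_eq_card hD
  have kD' := Finset.card_sdiff_add_card_eq_card hD'
  have T₁ := hn₀ α β R A A₁ A₀ A₂ C D F L' B B₁ B₀ B₂ C' D' E M n κ f μ hA hB cA cB hκμ hf dA' dB'
    (hw ▸ b1) (hw ▸ b3) hF hE hC hD hD' hC' (cC ▸ lp) (cD ▸ lp') (cC' ▸ lq) (cD' ▸ lq') HT HS' hM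
    hL' hd1 hd4 (by
      clear hn hf hsμ hbig b1 b2 b3 b4 c12
      convert hlat using 1 <;> omega)
  have T₂ := hn₀ α β R A A₂ A₀ A₁ D C (A₀ \ F) M' B B₂ B₀ B₁ D' C' (B₀ \ E) L n κ f μ hA.swap hB.swap
    cA cB hκμ hf dA' dB' (hw ▸ b2) (hw ▸ b4) Finset.sdiff_subset Finset.sdiff_subset hD hC hC' hD'
    (cD ▸ lp') (cC ▸ lp) (cD' ▸ lq') (cC' ▸ lq) HS HT' hL hM' hd3 hd2 (by
      clear hn hf hsμ hbig b1 b2 b3 b4 c12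
      convert hlat.swap using 1 <;> omega)
  have rA := rearrange hA.disj₁₀ hA.disj₁₂ hA.disj₀₂ hF hC hD
  have rB := rearrange hB.disj₁₀ hB.disj₁₂ hB.disj₀₂ hE hD' hC'
  have := T₁.union T₂ rA.2 rB.2
  rwa [rA.1, rB.1, ← hA.eq, ← hB.eq] at this

end Split

section Stability

set_option linter.unusedSectionVars false
set_option linter.unusedDecidableInType false

variable {α β : Type} [DecidableEq α] [DecidableEq β] {R : α → β → Prop} {s t : ℕ}

/-- The elements of `A` with fewer than `n / c` neighbours in `Z`. -/
noncomputable def low (R : α → β → Prop) (c n : ℕ) (A : Finset α) (Z : Finset β) : Finset α :=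
  A.filter fun a => c * nbr R a Z < n

theorem mem_low {c n : ℕ} {A : Finset α} {Z : Finset β} {a : α} :
    a ∈ low R c n A Z ↔ a ∈ A ∧ c * nbr R a Z < n := Finset.mem_filter

theorem nbr_le_nbr_add (a : α) (S T : Finset β) : nbr R a S ≤ nbr R a T + (S \ T).card := by
  have h1 : nbr R a S ≤ nbr R a (T ∪ S \ T) := nbr_mono a (by simp [Finset.subset_union_right])
  have h2 := nbr_union_le (R := R) a T (S \ T)
  have h3 := nbr_le_card (R := R) a (S \ T)
  omega

theorem card_le_of_high {X H : Finset α} {Z : Finset β} {c F e n : ℕ} (hn : 0 < n)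
    (hF : ∑ a ∈ X, nbr R a Z ≤ F) (he : c * F ≤ e * n) (hH : H ⊆ X)
    (hh : ∀ a ∈ H, n ≤ c * nbr R a Z) : H.card ≤ e := by
  have h1 := Finset.card_nsmul_le_sum H _ _ hh
  rw [← Finset.mul_sum, smul_eq_mul] at h1
  have h2 : ∑ a ∈ H, nbr R a Z ≤ ∑ a ∈ X, nbr R a Z :=
    Finset.sum_le_sum_of_subset hH
  have h3 := Nat.mul_le_mul_left c (h2.trans hF)
  exact Nat.le_of_mul_le_mul_right (h1.trans (h3.trans he)) hn

theorem le_card_of_sum_le {X : Finset α} {B Y : Finset β} {F e n : ℕ} (hY : Y ⊆ B)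
    (hX : n ≤ 3 * X.card) (hd : ∀ a ∈ X, n ≤ 2 * nbr R a B)
    (hF : ∑ a ∈ X, nbr R a (B \ Y) ≤ F) (he : F ≤ e * n) (hn : 0 < n) :
    n ≤ 2 * Y.card + 6 * e := by
  have h1 := Finset.card_nsmul_le_sum X _ _ hd
  have h2 : ∑ a ∈ X, 2 * nbr R a B ≤ 2 * (X.card * Y.card) + 2 * F := by
    rw [← Finset.mul_sum, ← Nat.mul_add]
    refine Nat.mul_le_mul_left _ ?_
    calc ∑ a ∈ X, nbr R a B = ∑ a ∈ X, nbr R a Y + ∑ a ∈ X, nbr R a (B \ Y) := by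
          rw [← Finset.sum_add_distrib]
          exact Finset.sum_congr rfl fun a _ => by rw [add_comm]; exact (nbr_sdiff_add a hY).symm
      _ ≤ X.card * Y.card + F := by
          refine add_le_add ?_ hF
          rw [← smul_eq_mul]
          exact Finset.sum_le_card_nsmul _ _ _ fun a _ => nbr_le_card a Y
  rw [smul_eq_mul] at h1
  have hX0 : 0 < X.card := by omega
  have h3 : e * n ≤ e * (3 * X.card) := Nat.mul_le_mul_left _ hX
  refine le_of_mul_le_mul_left ?_ hX0
  nlinarith

/-- The low sets of a sparse cut differ little from the sides of the cut. -/
theorem low_near {A X : Finset α} {B Y : Finset β} {c F e n : ℕ} (hn : 0 < n) (hc : 4 ≤ c)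
    (hX : X ⊆ A) (hY : Y ⊆ B) (hd : ∀ a ∈ A, n ≤ 2 * nbr R a B)
    (h1 : ∑ a ∈ X, nbr R a (B \ Y) ≤ F) (h2 : ∑ a ∈ A \ X, nbr R a Y ≤ F) (he : c * F ≤ e * n) :
    Disjoint (low R c n A (B \ Y)) (low R c n A Y) ∧
      (X \ low R c n A (B \ Y)).card ≤ e ∧ ((A \ X) \ low R c n A Y).card ≤ e ∧
      (low R c n A (B \ Y) \ X).card ≤ e ∧ (low R c n A Y \ (A \ X)).card ≤ e ∧
      (A \ (low R c n A (B \ Y) ∪ low R c n A Y)).card ≤ 2 * e := by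
  have hor : ∀ a ∈ A, c * nbr R a (B \ Y) < n → n ≤ c * nbr R a Y := by
    intro a ha h
    have k1 := nbr_sdiff_add (R := R) a hY
    have k2 := hd a ha
    have k3 : c * nbr R a (B \ Y) + c * nbr R a Y = c * nbr R a B := by rw [← Nat.mul_add, k1]
    have k4 : 4 * nbr R a B ≤ c * nbr R a B := Nat.mul_le_mul_right _ hc
    omega
  have e1 : (X \ low R c n A (B \ Y)).card ≤ e := by
    refine card_le_of_high hn h1 he Finset.sdiff_subset fun a ha => ?_
    rw [Finset.mem_sdiff, mem_low] at ha
    exact not_lt.1 fun h => ha.2 ⟨hX ha.1, h⟩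
  have e2 : ((A \ X) \ low R c n A Y).card ≤ e := by
    refine card_le_of_high hn h2 he Finset.sdiff_subset fun a ha => ?_
    rw [Finset.mem_sdiff, mem_low] at ha
    exact not_lt.1 fun h => ha.2 ⟨Finset.sdiff_subset ha.1, h⟩
  refine ⟨?_, e1, e2, ?_, ?_, ?_⟩
  · rw [Finset.disjoint_left]
    intro a ha hb
    rw [mem_low] at ha hb
    exact absurd (hor a ha.1 ha.2) (not_le.2 hb.2)
  · refine card_le_of_high hn h2 he ?_ fun a ha => ?_
    · exact Finset.sdiff_subset_sdiff (Finset.filter_subset _ _) (Finset.Subset.refl _)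
    · rw [Finset.mem_sdiff, mem_low] at ha
      exact hor a ha.1.1 ha.1.2
  · refine card_le_of_high hn h1 he (fun a ha => ?_) fun a ha => ?_
    · rw [Finset.mem_sdiff, Finset.mem_sdiff, mem_low] at ha
      exact not_not.1 fun h => ha.2 ⟨ha.1.1, h⟩
    · rw [Finset.mem_sdiff, mem_low] at ha
      exact not_lt.1 fun h => absurd (hor a ha.1.1 h) (not_le.2 ha.1.2)
  · have : A \ (low R c n A (B \ Y) ∪ low R c n A Y) ⊆
        (X \ low R c n A (B \ Y)) ∪ ((A \ X) \ low R c n A Y) := by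
      intro a
      simp only [Finset.mem_sdiff, Finset.mem_union]
      tauto
    have := (Finset.card_le_card this).trans (Finset.card_union_le _ _)
    omega

theorem split_low {A X : Finset α} {B Y : Finset β} {c F e n f μ : ℕ} (hn : 0 < n) (hc : 4 ≤ c)
    (hX : X ⊆ A) (hY : Y ⊆ B) (hdA : ∀ a ∈ A, n ≤ 2 * nbr R a B)
    (hdB : ∀ b ∈ B, n ≤ 2 * nbr (flip R) b A)
    (c1 : n ≤ 3 * Y.card) (c2 : n ≤ 3 * (B \ Y).card)
    (h1 : ∑ a ∈ X, nbr R a (B \ Y) ≤ F) (h2 : ∑ a ∈ A \ X, nbr R a Y ≤ F)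
    (he : c * F ≤ e * n) (hf : c * (f + e) ≤ n) (hμ : n + c * e ≤ c * μ) :
    Split R A (low R c n A (B \ Y)) (A \ (low R c n A (B \ Y) ∪ low R c n A Y)) (low R c n A Y)
      (low (flip R) c n B (A \ X)) (low (flip R) c n B X) n (4 * e) f μ := by
  have g1 : ∑ b ∈ Y, nbr (flip R) b (A \ X) ≤ F := by rw [← sum_nbr_comm]; exact h2
  have g2 : ∑ b ∈ B \ Y, nbr (flip R) b X ≤ F := by rw [← sum_nbr_comm]; exact h1
  obtain ⟨d1, a1, a2, a3, a4, a5⟩ := low_near hn hc hX hY hdA h1 h2 he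
  obtain ⟨d2, b1, b2, b3, b4, b5⟩ := low_near hn hc hY hX hdB g1 g2 he
  have hcF : F ≤ e * n := (Nat.le_mul_of_pos_left F (by omega)).trans he
  have k1 := le_card_of_sum_le hX c1 (fun b hb => hdB b (hY hb)) g1 hcF hn
  have k2 := le_card_of_sum_le (Finset.sdiff_subset (s := A) (t := X)) c2
    (fun b hb => hdB b (Finset.sdiff_subset hb)) (by
      rw [Finset.sdiff_sdiff_eq_self hX]; exact g2) hcF hn
  have hcard {γ : Type} [DecidableEq γ] (S T : Finset γ) : S.card ≤ (S \ T).card + T.card :=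
    Finset.card_le_card_sdiff_add_card
  have hc0 : 0 < c := by omega
  refine ⟨?_, ?_, d1, ?_, by omega, ?_, ?_, fun a ha => ?_, fun a ha => ?_, fun a ha => ?_,
    fun a ha => ?_⟩
  · ext a
    simp only [Finset.mem_union, Finset.mem_sdiff, mem_low]
    tauto
  · exact Finset.disjoint_sdiff.mono_left Finset.subset_union_left
  · exact Finset.sdiff_disjoint.mono_right Finset.subset_union_right
  · have := hcard X (low R c n A (B \ Y))
    omega
  · have := hcard (A \ X) (low R c n A Y)
    omega
  · refine le_of_mul_le_mul_left ?_ hc0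
    have m1 := (mem_low.1 ha).2
    have m2 : nbr R a (low (flip R) c n B X) ≤ nbr R a (B \ Y) + e :=
      (nbr_le_nbr_add a _ _).trans (Nat.add_le_add_left b4 _)
    have m3 := Nat.mul_le_mul_left c m2
    rw [Nat.mul_add] at m3
    omega
  · refine le_of_mul_le_mul_left ?_ hc0
    have m1 := (mem_low.1 ha).2
    have m2 : nbr R a (low (flip R) c n B (A \ X)) ≤ nbr R a Y + e :=
      (nbr_le_nbr_add a _ _).trans (Nat.add_le_add_left b3 _)
    have m3 := Nat.mul_le_mul_left c m2
    rw [Nat.mul_add] at m3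
    omega
  · simp only [Finset.mem_sdiff, Finset.mem_union, mem_low] at ha
    have m1 : n ≤ c * nbr R a Y := not_lt.1 fun h => ha.2 (Or.inr ⟨ha.1, h⟩)
    have m2 : nbr R a Y ≤ nbr R a (low (flip R) c n B (A \ X)) + e :=
      (nbr_le_nbr_add a _ _).trans (Nat.add_le_add_left b1 _)
    have m3 := Nat.le_of_mul_le_mul_left (hf.trans (m1.trans (Nat.mul_le_mul_left c m2))) hc0
    omega
  · simp only [Finset.mem_sdiff, Finset.mem_union, mem_low] at ha
    have m1 : n ≤ c * nbr R a (B \ Y) := not_lt.1 fun h => ha.2 (Or.inl ⟨ha.1, h⟩)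
    have m2 : nbr R a (B \ Y) ≤ nbr R a (low (flip R) c n B X) + e :=
      (nbr_le_nbr_add a _ _).trans (Nat.add_le_add_left b2 _)
    have m3 := Nat.le_of_mul_le_mul_left (hf.trans (m1.trans (Nat.mul_le_mul_left c m2))) hc0
    omega

theorem Extremal.exists_split {A : Finset α} {B : Finset β} {c F e n f μ : ℕ}
    (h : Extremal R F A B) (hA : A.card = n) (hB : B.card = n) (hn : 0 < n) (hc : 4 ≤ c)
    (hdA : ∀ a ∈ A, n ≤ 2 * nbr R a B) (hdB : ∀ b ∈ B, n ≤ 2 * nbr (_root_.flip R) b A)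
    (he : c * F ≤ e * n) (hf : c * (f + e) ≤ n) (hμ : n + c * e ≤ c * μ) :
    ∃ A₁ A₀ A₂ B₁ B₀ B₂, Split R A A₁ A₀ A₂ B₁ B₂ n (4 * e) f μ ∧
      Split (_root_.flip R) B B₁ B₀ B₂ A₁ A₂ n (4 * e) f μ := by
  obtain ⟨X, hX, Y, hY, c1, c2, c3, c4, h1, h2⟩ := h
  rw [hA] at c1 c2
  rw [hB] at c3 c4
  exact ⟨_, _, _, _, _, _, split_low hn hc hX hY hdA hdB c3 c4 h1 h2 he hf hμ,
    split_low hn hc hY hX hdB hdA c1 c2 (by rw [← sum_nbr_comm]; exact h2)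
      (by rw [← sum_nbr_comm]; exact h1) he hf hμ⟩

/-- The bipartite tiling theorem, with prescribed sizes `a`, `b` of the two extremal blocks. -/
theorem tileable_of_degree (hs : 1 ≤ s) (hst : s < t) :
    ∃ n₀ : ℕ, ∀ (α β : Type) [DecidableEq α] [DecidableEq β] (R : α → β → Prop)
      (A : Finset α) (B : Finset β) (n a b d : ℕ), n₀ ≤ n → A.card = n → B.card = n →
      s + t ∣ n → a + b = n → InLat s t a b → a ≤ b + t → b ≤ a + t →
      a + s ≤ d + 1 → b + s ≤ d + 1 →
      (∀ x ∈ A, d ≤ nbr R x B) → (∀ x ∈ B, d ≤ nbr (flip R) x A) → Tileable R s t A B := by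
  have ht : 0 < t := by omega
  obtain ⟨n₀, hn₀⟩ := tileable_of_split hs hst
  obtain ⟨n₁, hn₁⟩ := tileable_or_extremal hs hst (N := 800000 * t ^ 2 * (4000 * t))
    (by have : 0 < 800000 * t ^ 2 * (4000 * t) := by positivity
        omega)
  refine ⟨n₁ + 800000 * t ^ 2 * (n₀ + t + 1), ?_⟩
  intro α β _ _ R A B n a b d hn hA hB hdvd hab hlat hab1 hab2 had hbd dA dB
  have dA' : ∀ x ∈ A, n ≤ 2 * nbr R x B := fun x hx => by have := dA x hx; omega
  have dB' : ∀ x ∈ B, n ≤ 2 * nbr (flip R) x A := fun x hx => by have := dB x hx; omega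
  rcases hn₁ α β R A B n (by omega) hA hB hdvd dA' dB' with h | ⟨F, hF, hext⟩
  · exact h
  have hK : 0 < 800000 * t ^ 2 := by positivity
  obtain ⟨q, hq⟩ : ∃ q, q = n / (800000 * t ^ 2) := ⟨_, rfl⟩
  have hq1 : 800000 * t ^ 2 * q ≤ n := by rw [hq]; exact Nat.mul_div_le _ _
  have hq2 : n ≤ 800000 * t ^ 2 * (q + 1) := by rw [hq]; exact (Nat.lt_mul_div_succ n hK).le
  have hq3 : n₀ + t + 1 ≤ q := by
    rw [hq, Nat.le_div_iff_mul_le hK, Nat.mul_comm]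
    omega
  have htq : t ≤ t ^ 2 := Nat.le_self_pow (by norm_num) t
  have hn0 : 0 < n := by nlinarith
  have hF' : 4000 * t * F ≤ (q + 1) * n := by
    refine le_of_mul_le_mul_left ?_ hK
    calc 800000 * t ^ 2 * (4000 * t * F) = 800000 * t ^ 2 * (4000 * t) * F := by ring
      _ ≤ n ^ 2 := hF
      _ = n * n := sq n
      _ ≤ 800000 * t ^ 2 * (q + 1) * n := Nat.mul_le_mul_right _ hq2
      _ = _ := by ring
  have hqq : t ^ 2 * (q + 1) ≤ t ^ 2 * (2 * q) := Nat.mul_le_mul_left _ (by omega)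
  have htqq : t * (q + 1) ≤ t ^ 2 * (q + 1) := Nat.mul_le_mul_right _ htq
  have hqt : q + 1 ≤ t * (q + 1) := Nat.le_mul_of_pos_left _ ht
  have hqn : n₀ ≤ t ^ 2 * q := (show n₀ ≤ q by omega).trans
    (Nat.le_mul_of_pos_left _ (by positivity))
  obtain ⟨A₁, A₀, A₂, B₁, B₀, B₂, S₁, S₂⟩ := hext.exists_split (c := 4000 * t) (e := q + 1)
    (f := 48 * (t * (q + 1))) (μ := (200 * t + 1) * (q + 1)) hA hB hn0 (by omega) dA' dB' hF'
    (by nlinarith) (by nlinarith)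
  refine hn₀ α β R A A₁ A₀ A₂ B B₁ B₀ B₂ n a b d _ _ _ S₁ S₂ hA hB ?_ hab hlat hab1 hab2
    (by omega) (by nlinarith) (by nlinarith) had hbd dA dB
  have e1 : 402 * t * (2 * ((200 * t + 1) * (q + 1)) + 4 * (2 * (4 * (q + 1)) * t)) +
      6 * (4 * (q + 1)) = 173664 * (t ^ 2 * (q + 1)) + 804 * (t * (q + 1)) + 24 * (q + 1) := by
    ring
  have e2 : 800000 * t ^ 2 * q = 800000 * (t ^ 2 * q) := by ring
  have e3 : t ^ 2 * (2 * q) = 2 * (t ^ 2 * q) := by ring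
  omega

end Stability

section Conclusion

set_option linter.unusedSectionVars false
set_option linter.unusedDecidableInType false

theorem exists_isKst {W : Type} [DecidableEq W] {G : SimpleGraph W} {s t : ℕ} {S T : Finset W}
    (hd : Disjoint S T) (h : S.card = s ∧ T.card = t ∨ S.card = t ∧ T.card = s)
    (hj : Joined G.Adj S T) : ∃ P : Finset W × Finset W, IsKst G s t P.1 P.2 ∧
      P.1 ∪ P.2 = S ∪ T := by
  rcases h with ⟨h1, h2⟩ | ⟨h1, h2⟩
  · exact ⟨(S, T), ⟨hd, h1, h2, hj⟩, rfl⟩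
  · exact ⟨(T, S), ⟨hd.symm, h2, h1, fun u hu v hv => (hj v hv u hu).symm⟩, Finset.union_comm _ _⟩

theorem exists_kstTiling {W : Type} [DecidableEq W] {G : SimpleGraph W} {s t : ℕ}
    {A B : Finset W} (h : Tileable G.Adj s t A B) (hd : Disjoint A B) :
    ∃ 𝒯 : Finset (Finset W × Finset W), (∀ P ∈ 𝒯, IsKst G s t P.1 P.2) ∧
      (𝒯 : Set (Finset W × Finset W)).PairwiseDisjoint (fun P => P.1 ∪ P.2) ∧
      𝒯.sup (fun P => P.1 ∪ P.2) = A ∪ B := by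
  induction h with
  | empty => exact ⟨∅, by simp, by simp, by simp⟩
  | @union_tile A S B T _ hS hT hc hj ih =>
    rw [Finset.disjoint_union_left, Finset.disjoint_union_right, Finset.disjoint_union_right] at hd
    obtain ⟨⟨d1, d2⟩, d3, d4⟩ := hd
    obtain ⟨𝒯, h1, h2, h3⟩ := ih d1
    obtain ⟨P, hP, hPu⟩ := exists_isKst d4 hc hj
    have hdis : Disjoint (A ∪ B) (P.1 ∪ P.2) := by
      rw [hPu, Finset.disjoint_union_left, Finset.disjoint_union_right,
        Finset.disjoint_union_right]
      exact ⟨⟨hS, d2⟩, d3.symm, hT⟩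
    refine ⟨insert P 𝒯, ?_, ?_, ?_⟩
    · intro Q hQ
      rw [Finset.mem_insert] at hQ
      rcases hQ with rfl | hQ
      exacts [hP, h1 Q hQ]
    · rw [Finset.coe_insert]
      refine h2.insert fun Q hQ _ => ?_
      rw [← h3] at hdis
      exact (hdis.mono_left (Finset.le_sup (f := fun P : Finset W × Finset W => P.1 ∪ P.2)
        (Finset.mem_coe.1 hQ))).symm
    · rw [Finset.sup_insert, h3, hPu]
      ext x
      simp only [Finset.sup_eq_union, Finset.mem_union]
      tauto

theorem degS_univ_of_mem_left {W : Type} [Fintype W] [DecidableEq W] {G : SimpleGraph W}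
    {A B : Finset W} (h : IsBipartition G A B) {v : W} (hv : v ∈ A) :
    degS G v Finset.univ = nbr G.Adj v B := by
  unfold degS nbr
  congr 1
  ext w
  simp only [Finset.mem_filter, Finset.mem_univ, true_and]
  refine ⟨fun hw => ⟨?_, hw⟩, fun hw => hw.2⟩
  rcases h.2.2 v w hw with h1 | h1
  · exact h1.2
  · exact absurd h1.1 (Finset.disjoint_left.1 h.1 hv)

theorem IsBipartition.symm {W : Type} [Fintype W] [DecidableEq W] {G : SimpleGraph W}
    {A B : Finset W} (h : IsBipartition G A B) : IsBipartition G B A :=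
  ⟨h.1.symm, by rw [Finset.union_comm, h.2.1], fun u v huv => (h.2.2 u v huv).symm⟩

theorem kstTileable_of_degree {s t : ℕ} (hs : 1 ≤ s) (hst : s < t) :
    ∃ n₀ : ℕ, ∀ (W : Type) [Fintype W] [DecidableEq W] (G : SimpleGraph W) (A B : Finset W)
      (n a b d : ℕ), IsBipartition G A B → n₀ ≤ n → A.card = n → B.card = n →
      s + t ∣ n → a + b = n → InLat s t a b → a ≤ b + t → b ≤ a + t →
      a + s ≤ d + 1 → b + s ≤ d + 1 → (∀ v, d ≤ degS G v Finset.univ) → KstTileable G s t := by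
  obtain ⟨n₀, hn₀⟩ := tileable_of_degree hs hst
  refine ⟨n₀, ?_⟩
  intro W _ _ G A B n a b d hbip hn hA hB hdvd hab hlat h1 h2 h3 h4 hd
  have hflip : flip G.Adj = G.Adj := by
    ext u v
    exact G.adj_comm v u
  obtain ⟨𝒯, k1, k2, k3⟩ := exists_kstTiling (hn₀ W W G.Adj A B n a b d hn hA hB hdvd hab hlat
    h1 h2 h3 h4 (fun x hx => by rw [← degS_univ_of_mem_left hbip hx]; exact hd x)
    (fun x hx => by rw [hflip, ← degS_univ_of_mem_left hbip.symm hx]; exact hd x)) hbip.1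
  exact ⟨𝒯, k1, k2, k3.trans hbip.2.1⟩

end Conclusion

/-- Hladký–Schacht: minimum degree condition for tiling a
balanced bipartite graph on `2n = 2m(s+t)` vertices with `K_{s,t}`. -/
theorem hladky_schacht_upper_bound (s t : ℕ) (hs : 1 ≤ s) (hst : s < t) :
    ∃ m₀ : ℕ, ∀ m : ℕ, m₀ ≤ m →
      ∀ (V : Type) (_ : Fintype V) (_ : DecidableEq V),
      ∀ (G : SimpleGraph V) (A B : Finset V) (n : ℕ),
        IsBipartition G A B → A.card = n → B.card = n → n = m * (s + t) →
        (∀ v : V,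
          (Even m → (n : ℝ) / 2 + s - 1 ≤ (degS G v Finset.univ : ℝ)) ∧
          (Odd m → ((n : ℝ) + t + s) / 2 - 1 ≤ (degS G v Finset.univ : ℝ))) →
        KstTileable G s t := by
  obtain ⟨n₀, hn₀⟩ := kstTileable_of_degree hs hst
  refine ⟨n₀, ?_⟩
  intro m hm V _ _ G A B n hbip hA hB hn hdeg
  have hmn : n₀ ≤ n := hm.trans (hn ▸ Nat.le_mul_of_pos_right m (by omega))
  have hdvd : s + t ∣ n := hn ▸ Nat.dvd_mul_left _ _
  rcases Nat.even_or_odd' m with ⟨k, hk | hk⟩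
  · obtain ⟨a, ha⟩ : ∃ a, a = k * (s + t) := ⟨_, rfl⟩
    have hna : n = 2 * a := by rw [hn, hk, ha]; ring
    refine hn₀ V G A B n a a (a + s - 1) hbip hmn hA hB hdvd (by omega) ⟨k, k, ?_, ?_⟩
      (by omega) (by omega) (by omega) (by omega) fun v => ?_
    · rw [ha]; push_cast; ring
    · rw [ha]; push_cast; ring
    · have h1 := (hdeg v).1 ⟨k, by omega⟩
      rw [hna] at h1
      push_cast at h1
      have h2 : ((a + s : ℕ) : ℝ) ≤ ((degS G v Finset.univ + 1 : ℕ) : ℝ) := by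
        push_cast
        linarith
      have h3 := Nat.cast_le.1 h2
      omega
  · obtain ⟨c, hc⟩ : ∃ c, c = k * (s + t) := ⟨_, rfl⟩
    have hna : n = 2 * c + s + t := by rw [hn, hk, hc]; ring
    refine hn₀ V G A B n (c + t) (c + s) (c + t + s - 1) hbip hmn hA hB hdvd (by omega)
      ⟨k, k + 1, ?_, ?_⟩ (by omega) (by omega) (by omega) (by omega) fun v => ?_
    · rw [hc]; push_cast; ring
    · rw [hc]; push_cast; ring
    · have h1 := (hdeg v).2 ⟨k, hk⟩
      rw [hna] at h1
      push_cast at h1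
      have h2 : ((c + t + s : ℕ) : ℝ) ≤ ((degS G v Finset.univ + 1 : ℕ) : ℝ) := by
        push_cast
        linarith
      have h3 := Nat.cast_le.1 h2
      omega

end PaperTiling
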